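/- (1/640) · S^⧢(Gr_5) = Alt_10 S^⧢[ I_{4,1}( ρ_{2,3}/ρ_{2,1}, ρ_{4,3}/ρ_{4,5} ) + 2·I_{4,1}( ρ_{4,5}/ρ_{4,1}, (ρ_{1,2}ρ_{3,4})/(ρ_{3,2}ρ_{1,4}) ) + 8·Li_5( (ρ_{1,2}ρ_{3,4})/(ρ_{2,3}ρ_{4,5}) ) + I_{4,1}( (ρ_{1,2}ρ_{3,4})/(ρ_{3,2}ρ_{1,4}), ρ_1/ρ_{1,4} ) + 2·I_{4,1}( ρ_{1,2}/ρ_1, ρ_{3,2}/ρ_{3,4} ) + 8·Li_5( (ρ_1 ρ_{3,2})/(ρ_{1,2}ρ_{3,4}) ) ] in V_F^{⊗5}. -/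

import Mathlib

open scoped TensorProduct
open PiTensorProduct

attribute [local instance] Classical.propDecidable

set_option maxHeartbeats 1000000
set_option synthInstance.maxHeartbeats 400000

noncomputable section

namespace GrassPoly

variable (F : Type) [Field F]

/-- `V_F = F^× ⊗_ℤ ℚ` as a `ℚ`-vector space. -/
abbrev VF : Type := ℚ ⊗[ℤ] (Additive Fˣ)

variable {F}

/-- The class `[a]` of a nonzero field element in `V_F` (defined to be `0` for `a = 0`). -/
def cls (a : F) : VF F :=
  if h : a = 0 then 0 else (1 : ℚ) ⊗ₜ[ℤ] (Additive.ofMul (Units.mk0 a h))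

variable (F) in
/-- Tensor powers of V_F over ℚ. -/
abbrev TP (n : ℕ) : Type := ⨂[ℚ]^n (VF F)

instance instTPAddCommGroup (n : ℕ) : AddCommGroup (TP F n) :=
  Module.addCommMonoidToAddCommGroup ℚ

/-- Appending one extra tensor factor on the right. -/
def snoc {n : ℕ} : TP F n →ₗ[ℚ] VF F →ₗ[ℚ] TP F (n + 1) :=
  PiTensorProduct.lift
    ((PiTensorProduct.tprod ℚ (s := fun _ : Fin (n + 1) => VF F)).curryRight)

/-- The factor `t_i` appearing in the recursive definition of the symbol,
as a function of `(a_{i-1}, a_i, a_{i+1})`. -/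
def tCoef (p a q : F) : VF F :=
  if p = a then (if a = q then 0 else cls (q - a))
  else if a = q then - cls (p - a)
  else cls ((q - a) / (p - a))

/-- The symbol `S I(a₀; a₁, …, a_m; a_{m+1})`, with the middle entries given as a list
(of length `n`). -/
def SIaux : (n : ℕ) → (a0 : F) → (as : List F) → (b : F) → as.length = n → TP F n
  | 0, _, _, _, _ => tprod ℚ (fun i : Fin 0 => i.elim0)
  | n + 1, a0, as, b, h =>
      ∑ i : Fin (n + 1),
        snoc (SIaux n a0 (as.eraseIdx i.val) b
            (by
              have hi' := i.isLt
              have hi : i.val < as.length := by omega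
              have h2 := List.length_eraseIdx_of_lt hi
              omega))
          (tCoef ((a0 :: as).getD i.val 0) (as.getD i.val 0) ((as ++ [b]).getD (i.val + 1) 0))

/-- Cyclic rotation `b₁ ⊗ … ⊗ b_N ↦ b₂ ⊗ … ⊗ b_N ⊗ b₁` on tensor powers. -/
def rotN (n : ℕ) : TP F n ≃ₗ[ℚ] TP F n :=
  PiTensorProduct.reindex ℚ (fun _ : Fin n => VF F) (finRotate n).symm

/-- Splitting off the last tensor factor. -/
def splitLast (n : ℕ) : TP F (n + 1) ≃ₗ[ℚ] (TP F n) ⊗[ℚ] (VF F) :=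
  ((PiTensorProduct.reindex ℚ (fun _ : Fin (n + 1) => VF F)
      (finSumFinEquiv (m := n) (n := 1)).symm).trans
    (PiTensorProduct.tmulEquiv ℚ (VF F)).symm).trans
    (TensorProduct.congr (LinearEquiv.refl ℚ _)
      (PiTensorProduct.subsingletonEquiv (0 : Fin 1)))

/-- The projector `Π̃_N` annihilating symbols of products. -/
def Pit : (n : ℕ) → TP F n →ₗ[ℚ] TP F n
  | 0 => LinearMap.id
  | 1 => LinearMap.id
  | (n + 2) =>
      ((splitLast (n + 1)).symm.toLinearMap
        ∘ₗ TensorProduct.map (Pit (n + 1)) LinearMap.id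
        ∘ₗ (splitLast (n + 1)).toLinearMap)
      ∘ₗ ((LinearMap.id : TP F (n + 2) →ₗ[ℚ] TP F (n + 2)) - (rotN (F := F) (n + 2)).toLinearMap)

/-- The map on `V_F` induced by a field automorphism. -/
def vmap (φ : F ≃+* F) : VF F →ₗ[ℚ] VF F :=
  TensorProduct.AlgebraTensorModule.map (LinearMap.id : ℚ →ₗ[ℚ] ℚ)
    (AddMonoidHom.toIntLinearMap
      { toFun := fun a => Additive.ofMul ((Units.map (φ : F →* F)) a.toMul)
        map_zero' := by simp
        map_add' := by intro a b; simp [_root_.map_mul] })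

/-- The induced map on tensor powers. -/
def tpMap {n : ℕ} (φ : F ≃+* F) : TP F n →ₗ[ℚ] TP F n :=
  PiTensorProduct.map (fun _ => vmap φ)


/-! ### Symbols of (multiple) polylogarithms -/

/-- Symbol of `Li₂`. -/
def SLi2 (x : F) : TP F 2 := - SIaux 2 0 [x⁻¹, 0] 1 rfl

/-- Symbol of `Li₃`. -/
def SLi3 (x : F) : TP F 3 := - SIaux 3 0 [x⁻¹, 0, 0] 1 rfl

/-- Symbol of `Li₄`. -/
def SLi4 (x : F) : TP F 4 := - SIaux 4 0 [x⁻¹, 0, 0, 0] 1 rfl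

/-- Symbol of `Li₅`. -/
def SLi5 (x : F) : TP F 5 := - SIaux 5 0 [x⁻¹, 0, 0, 0, 0] 1 rfl

/-- Symbol of `I_{3,1}(x,y) = I(0; x,0,0,y; 1)`. -/
def SI31 (x y : F) : TP F 4 := SIaux 4 0 [x, 0, 0, y] 1 rfl

/-- Symbol of `I_{4,1}(x,y) = I(0; x,0,0,0,y; 1)`. -/
def SI41 (x y : F) : TP F 5 := SIaux 5 0 [x, 0, 0, 0, y] 1 rfl

/-- Symbol of `I⁺_{4,1}(x,y) = ½ (I_{4,1}(x,y) + I_{4,1}(x,y⁻¹))`. -/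
def I41p (x y : F) : TP F 5 := (2 : ℚ)⁻¹ • (SI41 x y + SI41 x y⁻¹)

/-- The anharmonic orbit of `x`, together with the signs of the
corresponding permutations in `S₃`. -/
def anhList (x : F) : List (ℚ × F) :=
  [(1, x), (1, (1 - x)⁻¹), (1, 1 - x⁻¹), (-1, x⁻¹), (-1, 1 - x), (-1, x / (x - 1))]

/-- Symbol of `Ĩ_{3,1}(x,y) = (1/36) Σ_{σ,π ∈ S₃} sgn(σ) sgn(π) I_{3,1}(x^σ, y^π)`. -/
def tI31 (x y : F) : TP F 4 :=
  (36 : ℚ)⁻¹ •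
    ((anhList x).map (fun p =>
      ((anhList y).map (fun q => (p.1 * q.1) • SI31 p.2 q.2)).sum)).sum

/-- Symbol of `Ĩ⁺_{4,1}(x,y) = (1/6) Σ_{σ ∈ S₃} sgn(σ) I⁺_{4,1}(x^σ, y)`. -/
def tI41p (x y : F) : TP F 5 :=
  (6 : ℚ)⁻¹ • ((anhList x).map (fun p => p.1 • I41p p.2 y)).sum

/-- Symbol of `V(z; x, y) = Ĩ_{3,1}(z, [x]+[y]+[(1-x)/(1-xy)]+[1-xy]+[(1-y)/(1-xy)])`. -/
def Vc (z x y : F) : TP F 4 :=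
  tI31 z x + tI31 z y + tI31 z ((1 - x) / (1 - x * y)) + tI31 z (1 - x * y)
    + tI31 z ((1 - y) / (1 - x * y))

/-- `Sym₃₆(a,b) := I_{3,1}(a,b) - Ĩ_{3,1}(a,b)` (on the level of symbols). -/
def S36 (a b : F) : TP F 4 := SI31 a b - tI31 a b

/-! ### Generic vectors -/

variable (N m : ℕ)

/-- Polynomial ring on the entries of `N` generic vectors in `m`-space. -/
abbrev Pol : Type := MvPolynomial (Fin N × Fin m) ℚ

/-- The field of rational functions in the entries of `N` generic vectors in `m`-space. -/
abbrev FF : Type := FractionRing (Pol N m)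

/-- The `j`-th coordinate of the `i`-th generic vector. -/
def gen (i : Fin N) (j : Fin m) : FF N m :=
  algebraMap (Pol N m) (FF N m) (MvPolynomial.X (i, j))

/-- `⟨i₁ … i_m⟩`: the determinant of the matrix whose columns are
the generic vectors selected by `cols`. -/
def dets (cols : Fin m → Fin N) : FF N m :=
  (Matrix.of fun r c => gen N m (cols c) r).det

/-- The field automorphism of `FF N m` induced by a permutation of the `N` vectors. -/
def permAut (σ : Equiv.Perm (Fin N)) : FF N m ≃+* FF N m :=
  IsFractionRing.ringEquivOfRingEquiv
    ((MvPolynomial.renameEquiv ℚ (σ.prodCongr (Equiv.refl (Fin m)))).toRingEquiv)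

variable {N m}

/-- Skew-symmetrization over all permutations of the `N` generic vectors. -/
def Alt {n : ℕ} (x : TP (FF N m) n) : TP (FF N m) n :=
  ∑ σ : Equiv.Perm (Fin N), (((Equiv.Perm.sign σ : ℤˣ) : ℤ) : ℚ) • tpMap (permAut N m σ) x

end GrassPoly

end

namespace GrassPoly

noncomputable section W5

/-- The field of rational functions in the entries of 10 generic vectors in 5-space. -/
abbrev K5 : Type := FF 10 5

/-- The vector label `k ∈ {1, …, 9, 0}` as an index (`0` stands for the 10th vector). -/
def L10 (k : ℕ) : Fin 10 := ⟨(k + 9) % 10, Nat.mod_lt _ (by norm_num)⟩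

/-- `⟨abcde⟩` for vector labels in `{1, …, 9, 0}`. -/
def d5 (a b c d e : ℕ) : K5 := dets 10 5 ![L10 a, L10 b, L10 c, L10 d, L10 e]

/-- Vector labels taken mod 8 in `{1, …, 8}`. -/
def M8 (j : ℕ) : ℕ := (j - 1) % 8 + 1

/-- `ρ_i = ρ_{i,i+1,i+2,i+3} = ⟨i,i+1,i+2,i+3,9⟩ / ⟨i,i+1,i+2,i+3,0⟩`, indices mod 8. -/
def rho5 (i : ℕ) : K5 :=
  d5 (M8 i) (M8 (i + 1)) (M8 (i + 2)) (M8 (i + 3)) 9 /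
    d5 (M8 i) (M8 (i + 1)) (M8 (i + 2)) (M8 (i + 3)) 0

/-- `ρ_{i,j} = ρ_i - ρ_j`. -/
def rr5 (i j : ℕ) : K5 := rho5 i - rho5 j

/-- The projected cross-ratio `CR(abc|defg) = ⟨abcdf⟩⟨abceg⟩ / (⟨abcdg⟩⟨abcef⟩)`. -/
def CR5 (a b c d e f g : ℕ) : K5 :=
  (d5 a b c d f * d5 a b c e g) / (d5 a b c d g * d5 a b c e f)

/-- The projected triple-ratio
`R₃(ab|cde,fgh) = ⟨abcdf⟩⟨abceh⟩⟨abdeg⟩ / (⟨abcdg⟩⟨abcef⟩⟨abdeh⟩)`. -/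
def R3 (a b c d e f g h : ℕ) : K5 :=
  (d5 a b c d f * d5 a b c e h * d5 a b d e g) /
    (d5 a b c d g * d5 a b c e f * d5 a b d e h)

/-- The symbol `S(Gr₅) = -2·(5!)²·Alt₁₀ [⟨12345⟩ ⊗ ⟨23456⟩ ⊗ ⟨34567⟩ ⊗ ⟨45678⟩ ⊗ ⟨56789⟩]`. -/
def SGr5 : TP K5 5 :=
  ((-2 : ℚ) * ((Nat.factorial 5 : ℚ)) ^ 2) •
    Alt (tprod ℚ ![cls (d5 1 2 3 4 5), cls (d5 2 3 4 5 6), cls (d5 3 4 5 6 7),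
      cls (d5 4 5 6 7 8), cls (d5 5 6 7 8 9)])

end W5

end GrassPoly

noncomputable section

namespace GrassPoly

namespace Kernel

/-- Evaluate a natural number before passing it on. -/
def force (n : ℕ) (K : ℕ → Bool) : Bool :=
  Nat.rec (motive := fun _ => Bool) (K 0) (fun m _ => K (Nat.succ m)) n

/-- Branching on a boolean through the bare recursor. -/
def br (b : Bool) (x y : Bool) : Bool := Bool.rec (motive := fun _ => Bool) y x b

/-- The smaller of two numbers. -/
def minK (x y : ℕ) (K : ℕ → Bool) : Bool := br (Nat.ble x y) (K x) (K y)

/-- The larger of two numbers. -/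
def maxK (x y : ℕ) (K : ℕ → Bool) : Bool := br (Nat.ble x y) (K y) (K x)

/-- An option `± m • l` for a letter; `s` is the exponent of the sign and the binary digits of `f`
record transpositions that fix the letter. -/
structure Opt where
  s : ℕ
  m : ℕ
  l : ℕ
  f : ℕ

/-- An expansion of the letter `c`, which is fixed by the transpositions recorded in `f`. -/
structure Ent where
  c : ℕ
  f : ℕ
  o : List Opt

/-- A five letter word with the coefficient `± m`. -/
structure Word where
  s : ℕ
  m : ℕ
  a : ℕ
  b : ℕ
  c : ℕ
  d : ℕ
  e : ℕ

/-- Search trees storing a key `h`, its scrambled value `x`, and the total `p - n` of the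
coefficients of `h`. -/
inductive Tr where
  | nil : Tr
  | node (l : Tr) (x h p n : ℕ) (r : Tr) : Tr

/-- A continuation passing accumulation of `± m` times a five letter word. -/
abbrev Step : Type := ℕ → ℕ → ℕ → ℕ → ℕ → ℕ → ℕ → Tr → (Tr → Bool) → Bool

/-- Insertion of `(-1) ^ s * m` at the key `h`. -/
def ins (x h s m : ℕ) (t : Tr) : (Tr → Bool) → Bool :=
  Tr.rec (motive := fun _ => (Tr → Bool) → Bool)
    (fun K => br (Nat.beq (s % 2) 0) (K (.node .nil x h m 0 .nil)) (K (.node .nil x h 0 m .nil)))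
    (fun l x' h' p n r ihl ihr K =>
      br (Nat.beq h h')
        (br (Nat.beq (s % 2) 0)
          (force (p + m) fun p' => K (.node l x' h' p' n r))
          (force (n + m) fun n' => K (.node l x' h' p n' r)))
        (br (Nat.ble x x')
          (ihl fun l' => K (.node l' x' h' p n r))
          (ihr fun r' => K (.node l x' h' p n r'))))
    t

/-- The key of a word whose letters are less than `2 ^ 16`. -/
def enc (a b c d e : ℕ) : ℕ :=
  Nat.add (Nat.mul (Nat.add (Nat.mul (Nat.add (Nat.mul (Nat.add (Nat.mul a 65536) b) 65536) c)
    65536) d) 65536) e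

/-- Insertion of a word at its key. -/
def insWord : Step := fun a b c d e s m t K =>
  br (Nat.blt (Nat.lor a (Nat.lor b (Nat.lor c (Nat.lor d e)))) 65536)
    (force (enc a b c d e) fun h => force (Nat.mod h 10007) fun x => ins x h s m t K) false

/-- Handle the word with key `h` and coefficient `p - n`. -/
def visit (f : Step) (h p n : ℕ) (t : Tr) (K : Tr → Bool) : Bool :=
  br (Nat.beq p n) (K t)
    (force (Nat.mod h 65536) fun e => force (Nat.mod (Nat.div h 65536) 65536) fun d =>
      force (Nat.mod (Nat.div h (65536 ^ 2)) 65536) fun c =>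
      force (Nat.mod (Nat.div h (65536 ^ 3)) 65536) fun b =>
      force (Nat.mod (Nat.div h (65536 ^ 4)) 65536) fun a =>
      br (Nat.ble n p)
        (force (p - n) fun m => f a b c d e 0 m t K)
        (force (n - p) fun m => f a b c d e 1 m t K))

/-- Handle all the words stored in a tree. -/
def foldTr (f : Step) (src : Tr) : Tr → (Tr → Bool) → Bool :=
  Tr.rec (motive := fun _ => Tr → (Tr → Bool) → Bool)
    (fun t K => K t)
    (fun _ _ h p n _ ihl ihr t K => ihl t fun t1 => visit f h p n t1 fun t2 => ihr t2 K)
    src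

/-- Handle all the words of a list. -/
def foldWords (f : Step) (src : List Word) : Tr → (Tr → Bool) → Bool :=
  List.rec (motive := fun _ => Tr → (Tr → Bool) → Bool)
    (fun t K => K t)
    (fun w _ ih t K => Word.rec (motive := fun _ => Bool)
      (fun s m a b c d e => f a b c d e s m t fun t' => ih t' K) w)
    src

/-- Look up the letter `c`. -/
def look (tab : List Ent) (c : ℕ) (K : ℕ → List Opt → Bool) : Bool :=
  List.rec (motive := fun _ => Bool) false
    (fun x _ ih => Ent.rec (motive := fun _ => Bool)
      (fun c' f o => br (Nat.beq c c') (K f o) ih) x) tab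

/-- Handle all the options of a letter that do not lead to a word fixed by a transposition. -/
def loop (body : ℕ → ℕ → ℕ → ℕ → Tr → (Tr → Bool) → Bool) (s m a suf : ℕ) (o : List Opt) :
    Tr → (Tr → Bool) → Bool :=
  List.rec (motive := fun _ => Tr → (Tr → Bool) → Bool)
    (fun t K => K t)
    (fun x _ ih t K => Opt.rec (motive := fun _ => Bool)
      (fun s' m' l f =>
        force (Nat.land a f) fun a' =>
          br (Nat.beq (Nat.land a' suf) 0)
            (force (Nat.add s s') fun s1 => force (Nat.mul m m') fun m1 =>
              body l a' s1 m1 t fun t' => ih t' K)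
            (ih t K)) x)
    o

/-- Expand all letters of a word. -/
def expand (tab : List Ent) (leaf : Step) : Step := fun a b c d e s m t K =>
  look tab a fun _ oa => look tab b fun fb ob => look tab c fun fc oc =>
  look tab d fun fd od => look tab e fun fe oe =>
  force (Nat.land fd fe) fun f4 => force (Nat.land fc f4) fun f3 =>
  force (Nat.land fb f3) fun f2 =>
  loop (fun a' f s m =>
    loop (fun b' f s m =>
      loop (fun c' f s m =>
        loop (fun d' f s m =>
          loop (fun e' _ s m => leaf a' b' c' d' e' s m) s m f f oe)
          s m f fe od)
        s m f f4 oc)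
      s m f f3 ob)
    s m (2 ^ 100 - 1) f2 oa t K

/-- Replace a word by words starting with its first, second, … letter, with weights `w₀`, `w₁`, … -/
def lead (w0 w1 w2 w3 w4 : ℕ) (leaf : Step) : Step := fun a b c d e s m t K =>
  (fun t K => br (Nat.beq w0 0) (K t) (force (Nat.mul m w0) fun m => leaf a b c d e s m t K))
  t fun t =>
  (fun t K => br (Nat.beq w1 0) (K t) (force (Nat.mul m w1) fun m => force (Nat.succ s) fun s =>
    leaf b a c d e s m t fun t => leaf b c a d e s m t fun t =>
    leaf b c d a e s m t fun t => leaf b c d e a s m t K))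
  t fun t =>
  (fun t K => br (Nat.beq w2 0) (K t) (force (Nat.mul m w2) fun m =>
    leaf c b a d e s m t fun t => leaf c b d a e s m t fun t => leaf c b d e a s m t fun t =>
    leaf c d b a e s m t fun t => leaf c d b e a s m t fun t => leaf c d e b a s m t K))
  t fun t =>
  (fun t K => br (Nat.beq w3 0) (K t) (force (Nat.mul m w3) fun m => force (Nat.succ s) fun s =>
    leaf d c b a e s m t fun t => leaf d c b e a s m t fun t =>
    leaf d c e b a s m t fun t => leaf d e c b a s m t K))
  t fun t =>
  (fun t K => br (Nat.beq w4 0) (K t) (force (Nat.mul m w4) fun m => leaf e d c b a s m t K))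
  t K

/-- `1` for a letter that is odd under the exchange of the last two vectors, else `0`. -/
def odd (c : ℕ) (K : ℕ → Bool) : Bool := br (Nat.ble 3072 c) (K 1) (K 0)

/-- Lead a word by its only odd letter, by its even letters if there are three odd ones, and by all
its letters if they are all odd. -/
def leadOdd (leaf : Step) : Step := fun a b c d e s m t K =>
  odd a fun oa => odd b fun ob => odd c fun oc => odd d fun od => odd e fun oe =>
  force (oa + (ob + (oc + (od + oe)))) fun n =>
  br (Nat.beq (n % 2) 0) (K t)
    (br (Nat.beq n 1)
      (lead (oa * 10) (ob * 10) (oc * 10) (od * 10) (oe * 10) leaf a b c d e s m t K)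
      (br (Nat.beq n 3)
        (lead (5 - oa * 5) (5 - ob * 5) (5 - oc * 5) (5 - od * 5) (5 - oe * 5) leaf
          a b c d e s m t K)
        (br (Nat.beq n 5) (lead 2 2 2 2 2 leaf a b c d e s m t K) false)))

/-- The indices of a letter are increasing and lie between `1` and `5`. -/
def valid (c : ℕ) : Bool :=
  br (Nat.ble 1 (c / 16 % 16)) (br (Nat.ble (c / 16 % 16) (c % 16))
    (br (Nat.ble (c % 16) 5) (Nat.blt c 2048) false) false) false

/-- Reverse the indices of a letter. -/
def flip (n c : ℕ) : ℕ := c / 256 * 256 + (17 * n - c % 16 * 16 - c / 16 % 16)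

/-- Normalize the indices in a word using the dihedral symmetry. -/
def dihedral (leaf : Step) : Step := fun a b c d e s m t K =>
  br (valid a) (br (valid b) (br (valid c) (br (valid d) (br (valid e)
  (minK (a / 16 % 16) (b / 16 % 16) fun x => minK (c / 16 % 16) x fun x =>
  minK (d / 16 % 16) x fun x => minK (e / 16 % 16) x fun x =>
  force (17 * Nat.pred x) fun x17 =>
  force (a - x17) fun a => force (b - x17) fun b => force (c - x17) fun c =>
  force (d - x17) fun d => force (e - x17) fun e =>
  maxK (a % 16) (b % 16) fun z => maxK (c % 16) z fun z => maxK (d % 16) z fun z =>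
  maxK (e % 16) z fun z =>
  force (Nat.succ z) fun z =>
  force (s + Nat.pred x) fun s =>
  force (flip z a) fun a' => force (flip z b) fun b' => force (flip z c) fun c' =>
  force (flip z d) fun d' => force (flip z e) fun e' =>
  br (Nat.beq (enc a b c d e) (enc a' b' c' d' e'))
    (br (Nat.beq (z % 2) 0) (leaf a b c d e s m t K) (K t))
    (br (Nat.ble (enc a b c d e) (enc a' b' c' d' e'))
      (leaf a b c d e s m t K) (leaf a' b' c' d' e' (s + z) m t K)))
  false) false) false) false) false

/-- Insert the column `x` in an increasing list of columns. -/
def insCol (x : ℕ) (l : List ℕ) : ℕ → (ℕ → List ℕ → Bool) → Bool → Bool :=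
  List.rec (motive := fun _ => ℕ → (ℕ → List ℕ → Bool) → Bool → Bool)
    (fun s K _ => K s [x])
    (fun y l ih s K k0 => br (Nat.beq x y) k0
      (br (Nat.ble x y) (K s (x :: y :: l))
        (ih (Nat.succ s) (fun s' l' => K s' (y :: l')) k0))) l

/-- Sort `n` columns of a word of brackets. -/
def sortCols (n : ℕ) : ℕ → ℕ → (ℕ → List ℕ → Bool) → Bool → Bool :=
  Nat.rec (motive := fun _ => ℕ → ℕ → (ℕ → List ℕ → Bool) → Bool → Bool)
    (fun _ s K _ => K s [])
    (fun _ ih w s K k0 => force (Nat.div w 32) fun w' =>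
      ih w' s (fun s' l' => force (Nat.mod w 32) fun x => force s' fun s' =>
        insCol x l' s' K k0) k0) n

/-- The number with the given columns. -/
def unCols (l : List ℕ) : ℕ :=
  List.rec (motive := fun _ => ℕ) 0 (fun x _ ih => Nat.add x (Nat.mul 32 ih)) l

/-- The mask of the first letter in a word of brackets. -/
def fstMask : ℕ := 36319351833633

/-- Insert a word of brackets, with sorted columns. -/
def brackets : Step := fun a b c d e s m t K =>
  force (Nat.lor (Nat.land a fstMask) (Nat.lor (Nat.mul 2 (Nat.land b fstMask))
      (Nat.lor (Nat.mul 4 (Nat.land c fstMask)) (Nat.lor (Nat.mul 8 (Nat.land d fstMask))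
        (Nat.mul 16 (Nat.land e fstMask)))))) fun w =>
    sortCols 10 w s
      (fun s l => force (unCols l) fun h => force (Nat.mod h 10007) fun x => ins x h s m t K) (K t)

/-- Handle the word of brackets with key `h` and coefficient `p - n`. -/
def visitBr (f : Step) (h p n : ℕ) (t : Tr) (K : Tr → Bool) : Bool :=
  br (Nat.beq p n) (K t)
    (force (Nat.land h fstMask) fun a =>
      force (Nat.land (Nat.div h 2) fstMask) fun b =>
      force (Nat.land (Nat.div h 4) fstMask) fun c =>
      force (Nat.land (Nat.div h 8) fstMask) fun d =>
      force (Nat.land (Nat.div h 16) fstMask) fun e =>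
      br (Nat.ble n p)
        (force (p - n) fun m => f a b c d e 0 m t K)
        (force (n - p) fun m => f a b c d e 1 m t K))

/-- Handle all the words of brackets stored in a tree. -/
def foldBr (f : Step) (src : Tr) : Tr → (Tr → Bool) → Bool :=
  Tr.rec (motive := fun _ => Tr → (Tr → Bool) → Bool)
    (fun t K => K t)
    (fun _ _ h p n _ ihl ihr t K => ihl t fun t1 => visitBr f h p n t1 fun t2 => ihr t2 K)
    src

/-- The number of common vectors of two brackets. -/
def meet (a b : ℕ) : ℕ := Nat.mod (Nat.land a b) 31

/-- `1` if the numbers agree, else `0`. -/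
def eqK (x y : ℕ) (K : ℕ → Bool) : Bool := br (Nat.beq x y) (K 1) (K 0)

/-- Lead a word of brackets by its letters having the fewest vectors in common with the others. -/
def leadMin (leaf : Step) : Step := fun a b c d e s m t K =>
  force (meet a b + (meet a c + (meet a d + meet a e))) fun va =>
  force (meet b a + (meet b c + (meet b d + meet b e))) fun vb =>
  force (meet c a + (meet c b + (meet c d + meet c e))) fun vc =>
  force (meet d a + (meet d b + (meet d c + meet d e))) fun vd =>
  force (meet e a + (meet e b + (meet e c + meet e d))) fun ve =>
  minK va vb fun x => minK vc x fun x => minK vd x fun x => minK ve x fun x =>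
  eqK va x fun oa => eqK vb x fun ob => eqK vc x fun oc => eqK vd x fun od => eqK ve x fun oe =>
  force (60 / (oa + (ob + (oc + (od + oe))))) fun n =>
  br (Nat.beq (n * (oa + (ob + (oc + (od + oe))))) 60)
    (lead (n * oa) (n * ob) (n * oc) (n * od) (n * oe) leaf a b c d e s m t K) false

/-- All coefficients in a tree vanish. -/
def vanishes (t : Tr) : Bool :=
  Tr.rec (motive := fun _ => Bool) true
    (fun _ _ _ p n _ ihl ihr => br (Nat.beq p n) (br ihl ihr false) false) t

def tabF : List Ent :=
  [⟨4096, 0, [⟨0, 1, 2048, 0⟩, ⟨0, 1, 3072, 0⟩]⟩,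
   ⟨4097, 0, [⟨0, 1, 2049, 0⟩, ⟨0, 1, 3073, 0⟩]⟩,
   ⟨4098, 0, [⟨0, 1, 2050, 0⟩, ⟨0, 1, 3074, 0⟩]⟩,
   ⟨4099, 0, [⟨0, 1, 2051, 0⟩, ⟨0, 1, 3075, 0⟩]⟩,
   ⟨4100, 0, [⟨0, 1, 2052, 0⟩, ⟨0, 1, 3076, 0⟩]⟩,
   ⟨4101, 0, [⟨0, 1, 2053, 0⟩, ⟨0, 1, 3077, 0⟩]⟩,
   ⟨4102, 0, [⟨0, 1, 2054, 0⟩, ⟨0, 1, 3078, 0⟩]⟩,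
   ⟨4103, 0, [⟨0, 1, 2055, 0⟩, ⟨0, 1, 3079, 0⟩]⟩,
   ⟨4104, 0, [⟨0, 1, 2056, 0⟩, ⟨0, 1, 3080, 0⟩]⟩,
   ⟨4105, 0, [⟨0, 1, 2057, 0⟩, ⟨0, 1, 3081, 0⟩]⟩,
   ⟨4106, 0, [⟨0, 1, 2058, 0⟩, ⟨0, 1, 3078, 0⟩]⟩,
   ⟨4107, 0, [⟨0, 1, 2059, 0⟩]⟩,
   ⟨4108, 0, [⟨0, 1, 2060, 0⟩, ⟨0, 1, 3074, 0⟩]⟩,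
   ⟨4109, 0, [⟨0, 1, 2061, 0⟩]⟩,
   ⟨4110, 0, [⟨0, 1, 2062, 0⟩]⟩,
   ⟨4111, 0, [⟨0, 1, 2063, 0⟩, ⟨0, 1, 3082, 0⟩]⟩,
   ⟨4112, 0, [⟨0, 1, 2064, 0⟩, ⟨0, 1, 3083, 0⟩]⟩,
   ⟨4113, 0, [⟨0, 1, 2056, 0⟩]⟩,
   ⟨4114, 0, [⟨0, 1, 2065, 0⟩, ⟨0, 1, 3084, 0⟩]⟩,
   ⟨4115, 0, [⟨0, 1, 2066, 0⟩, ⟨0, 1, 3081, 0⟩]⟩,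
   ⟨4116, 0, [⟨0, 1, 2067, 0⟩, ⟨0, 1, 3081, 0⟩]⟩,
   ⟨4117, 0, [⟨0, 1, 3084, 0⟩]⟩,
   ⟨4118, 0, [⟨0, 1, 2067, 0⟩, ⟨0, 1, 3085, 0⟩]⟩,
   ⟨4119, 0, [⟨0, 1, 2068, 0⟩, ⟨0, 1, 3086, 0⟩]⟩,
   ⟨4120, 0, [⟨0, 1, 2069, 0⟩, ⟨0, 1, 3087, 0⟩]⟩,
   ⟨4121, 0, [⟨0, 1, 3088, 0⟩]⟩,
   ⟨4122, 0, [⟨0, 1, 2070, 0⟩, ⟨0, 1, 3089, 0⟩]⟩,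
   ⟨4123, 0, [⟨0, 1, 2071, 0⟩, ⟨0, 1, 3086, 0⟩]⟩,
   ⟨4124, 0, [⟨0, 1, 2072, 0⟩, ⟨0, 1, 3090, 0⟩]⟩,
   ⟨4125, 0, [⟨0, 1, 2073, 0⟩, ⟨0, 1, 3091, 0⟩]⟩,
   ⟨4126, 0, [⟨0, 1, 2074, 0⟩]⟩,
   ⟨4127, 0, [⟨0, 1, 2075, 0⟩, ⟨0, 1, 3085, 0⟩]⟩]

def tabS : List Ent :=
  [⟨2048, 618970019714747731487494144, [⟨1, 1, 18, 618970167432815509248159744⟩, ⟨1, 1, 69,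
    618970019714853284603760646⟩]⟩,
   ⟨2049, 618970019642690137449562112, [⟨1, 1, 19, 618970167216677911506452482⟩, ⟨0, 1, 35,
     618970167216642744331010240⟩, ⟨1, 1, 52, 618970019642725373361389698⟩, ⟨0, 1, 53,
     618970167216677911506452482⟩]⟩,
   ⟨2050, 618970019642690137449562112, [⟨1, 1, 18, 618970167432815509248159744⟩, ⟨0, 1, 35,
     618970167216642744331010240⟩, ⟨1, 1, 52, 618970019642725373361389698⟩, ⟨0, 1, 69,
     618970019714853284603760646⟩]⟩,
   ⟨2051, 618970167216642727134363648, [⟨1, 1, 18, 618970167432815509248159744⟩, ⟨0, 1, 19,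
     618970167216677911506452482⟩]⟩,
   ⟨2052, 618970019642725321821650946, [⟨0, 1, 53, 618970167216677911506452482⟩, ⟨1, 1, 69,
     618970019714853284603760646⟩]⟩,
   ⟨2053, 618970167216642727134363648, [⟨1, 1, 18, 618970167432815509248159744⟩, ⟨0, 1, 35,
     618970167216642744331010240⟩]⟩,
   ⟨2054, 618970019642725321821650946, [⟨1, 1, 52, 618970019642725373361389698⟩, ⟨0, 1, 53,
     618970167216677911506452482⟩]⟩,
   ⟨2055, 618970019642725321821650946, [⟨0, 1, 52, 618970019642725373361389698⟩, ⟨1, 1, 69,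
     618970019714853284603760646⟩]⟩,
   ⟨2056, 618970019642690137449562112, [⟨1, 1, 20, 618970019714853284603760646⟩, ⟨1, 1, 35,
     618970167216642744331010240⟩]⟩,
   ⟨2057, 618970019642690137449562112, [⟨1, 1, 18, 618970167432815509248159744⟩, ⟨0, 1, 19,
     618970167216677911506452482⟩, ⟨1, 1, 21, 618970167433061799852781582⟩, ⟨0, 1, 36,
     618970019714747748667363456⟩, ⟨1, 1, 52, 618970019642725373361389698⟩, ⟨0, 1, 69,
     618970019714853284603760646⟩]⟩,
   ⟨2058, 618970019714853284603760646, [⟨1, 1, 20, 618970019714853284603760646⟩, ⟨0, 1, 21,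
     618970167433061799852781582⟩]⟩,
   ⟨2059, 618970019642690137449562112, [⟨0, 1, 19, 618970167216677911506452482⟩, ⟨1, 1, 20,
     618970019714853284603760646⟩, ⟨1, 1, 35, 618970167216642744331010240⟩, ⟨0, 1, 36,
     618970019714747748667363456⟩]⟩,
   ⟨2060, 618970019714853284603760646, [⟨1, 1, 20, 618970019714853284603760646⟩, ⟨0, 1, 69,
     618970019714853284603760646⟩]⟩,
   ⟨2061, 618970019642690137449562112, [⟨1, 1, 18, 618970167432815509248159744⟩, ⟨0, 1, 19,
     618970167216677911506452482⟩, ⟨0, 1, 36, 618970019714747748667363456⟩, ⟨1, 1, 52,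
     618970019642725373361389698⟩]⟩,
   ⟨2062, 618970019642690137449562112, [⟨0, 1, 18, 618970167432815509248159744⟩, ⟨1, 1, 20,
     618970019714853284603760646⟩, ⟨1, 1, 35, 618970167216642744331010240⟩, ⟨0, 1, 52,
     618970019642725373361389698⟩]⟩,
   ⟨2063, 618970019642690137449562112, [⟨1, 1, 35, 618970167216642744331010240⟩, ⟨1, 1, 69,
     618970019714853284603760646⟩]⟩,
   ⟨2064, 618970019642690137449562112, [⟨0, 1, 18, 618970167432815509248159744⟩, ⟨1, 1, 35,
     618970167216642744331010240⟩, ⟨0, 1, 52, 618970019642725373361389698⟩, ⟨1, 1, 69,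
     618970019714853284603760646⟩]⟩,
   ⟨2065, 618970019642690137449562112, [⟨0, 1, 18, 618970167432815509248159744⟩, ⟨1, 1, 19,
     618970167216677911506452482⟩, ⟨1, 1, 36, 618970019714747748667363456⟩, ⟨0, 1, 52,
     618970019642725373361389698⟩]⟩,
   ⟨2066, 618970019642690137449562112, [⟨0, 1, 18, 618970167432815509248159744⟩, ⟨1, 1, 35,
     618970167216642744331010240⟩, ⟨0, 1, 52, 618970019642725373361389698⟩]⟩,
   ⟨2067, 618970019714853284603760646, [⟨1, 1, 20, 618970019714853284603760646⟩]⟩,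
   ⟨2068, 618970019642725373361389698, [⟨1, 1, 52, 618970019642725373361389698⟩]⟩,
   ⟨2069, 618970019642690137449562112, [⟨0, 1, 18, 618970167432815509248159744⟩, ⟨1, 1, 35,
     618970167216642744331010240⟩, ⟨0, 1, 36, 618970019714747748667363456⟩]⟩,
   ⟨2070, 618970019642690154629431424, [⟨0, 1, 36, 618970019714747748667363456⟩, ⟨1, 1, 52,
     618970019642725373361389698⟩]⟩,
   ⟨2071, 618970167432815509248159744, [⟨0, 1, 18, 618970167432815509248159744⟩]⟩,
   ⟨2072, 618970019642690154629431424, [⟨1, 1, 35, 618970167216642744331010240⟩, ⟨0, 1, 36,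
     618970019714747748667363456⟩]⟩,
   ⟨2073, 618970019642690154629431424, [⟨0, 1, 35, 618970167216642744331010240⟩, ⟨1, 1, 52,
     618970019642725373361389698⟩]⟩,
   ⟨2074, 618970019642690137449562112, [⟨1, 1, 18, 618970167432815509248159744⟩, ⟨1, 1, 52,
     618970019642725373361389698⟩]⟩,
   ⟨2075, 618970019642690137449562112, [⟨1, 1, 18, 618970167432815509248159744⟩, ⟨0, 1, 35,
     618970167216642744331010240⟩, ⟨1, 1, 52, 618970019642725373361389698⟩]⟩,
   ⟨3072, 72057594037932032, [⟨1, 1, 17, 147790371662403219470⟩, ⟨1, 1, 34,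
     147790125388995260640⟩, ⟨1, 1, 68, 72163267547631750⟩, ⟨1, 1, 85, 147790371662403219470⟩]⟩,
   ⟨3073, 72057594037932032, [⟨1, 1, 17, 147790371662403219470⟩, ⟨0, 1, 34,
     147790125388995260640⟩, ⟨1, 1, 68, 72163267547631750⟩, ⟨0, 1, 85, 147790371662403219470⟩]⟩,
   ⟨3074, 147790371662403219470, [⟨1, 1, 17, 147790371662403219470⟩, ⟨0, 1, 85,
     147790371662403219470⟩]⟩,
   ⟨3075, 147573952606881448128, [⟨1, 1, 34, 147790125388995260640⟩, ⟨0, 1, 51,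
     147573987825647026370⟩]⟩,
   ⟨3076, 35235911827586, [⟨0, 1, 51, 147573987825647026370⟩, ⟨1, 1, 68, 72163267547631750⟩]⟩,
   ⟨3077, 147573987774056890370, [⟨1, 1, 17, 147790371662403219470⟩, ⟨0, 1, 51,
     147573987825647026370⟩]⟩,
   ⟨3078, 72163147154198534, [⟨1, 1, 68, 72163267547631750⟩, ⟨0, 1, 85, 147790371662403219470⟩]⟩,
   ⟨3079, 147573987774056890370, [⟨0, 1, 51, 147573987825647026370⟩, ⟨1, 1, 85,
     147790371662403219470⟩]⟩,
   ⟨3080, 0, [⟨1, 1, 17, 147790371662403219470⟩, ⟨1, 1, 34, 147790125388995260640⟩, ⟨1, 1, 51,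
     147573987825647026370⟩, ⟨1, 1, 68, 72163267547631750⟩]⟩,
   ⟨3081, 72163147154198534, [⟨1, 1, 17, 147790371662403219470⟩, ⟨0, 1, 68, 72163267547631750⟩]⟩,
   ⟨3082, 0, [⟨1, 1, 34, 147790125388995260640⟩, ⟨1, 1, 51, 147573987825647026370⟩, ⟨1, 1, 68,
     72163267547631750⟩, ⟨1, 1, 85, 147790371662403219470⟩]⟩,
   ⟨3083, 147790371662403219470, [⟨0, 1, 17, 147790371662403219470⟩, ⟨1, 1, 85,
     147790371662403219470⟩]⟩,
   ⟨3084, 72163147154198534, [⟨1, 2, 17, 147790371662403219470⟩, ⟨0, 2, 68, 72163267547631750⟩]⟩,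
   ⟨3085, 72163147154198534, [⟨0, 1, 17, 147790371662403219470⟩, ⟨1, 1, 68, 72163267547631750⟩]⟩,
   ⟨3086, 147790125371798597632, [⟨1, 1, 17, 147790371662403219470⟩, ⟨0, 1, 34,
     147790125388995260640⟩]⟩,
   ⟨3087, 0, [⟨0, 1, 17, 147790371662403219470⟩, ⟨1, 1, 34, 147790125388995260640⟩, ⟨1, 1, 51,
     147573987825647026370⟩, ⟨0, 1, 68, 72163267547631750⟩]⟩,
   ⟨3088, 147790125371798597632, [⟨1, 2, 17, 147790371662403219470⟩, ⟨0, 2, 34,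
     147790125388995260640⟩]⟩,
   ⟨3089, 147573952606881448128, [⟨0, 1, 34, 147790125388995260640⟩, ⟨1, 1, 51,
     147573987825647026370⟩]⟩,
   ⟨3090, 35235911827586, [⟨1, 1, 51, 147573987825647026370⟩, ⟨0, 1, 68, 72163267547631750⟩]⟩,
   ⟨3091, 72057611217801344, [⟨0, 1, 34, 147790125388995260640⟩, ⟨1, 1, 68, 72163267547631750⟩]⟩]

def tabP : List Ent :=
  [⟨17, 147790371662403219470, [⟨0, 1, 17, 147790371662403219470⟩]⟩,
   ⟨18, 618970167432815509248159744, [⟨0, 2, 786, 619877748105933164839464990⟩, ⟨0, 2, 1042,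
     618970167433062625292595440⟩, ⟨1, 1, 529, 618970167433061799852781582⟩, ⟨1, 1, 546,
     618970167432815526444822752⟩]⟩,
   ⟨19, 618970167216677911506452482, [⟨0, 1, 19, 618970167216677911506452482⟩]⟩,
   ⟨20, 618970019714853284603760646, [⟨0, 1, 20, 618970019714853284603760646⟩]⟩,
   ⟨21, 618970167433061799852781582, [⟨0, 1, 21, 618970167433061799852781582⟩]⟩,
   ⟨34, 147790125388995260640, [⟨0, 1, 34, 147790125388995260640⟩]⟩,
   ⟨35, 618970167216642744331010240, [⟨0, 2, 803, 619877747025104473035961280⟩, ⟨0, 2, 1059,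
     618970167433660776814182626⟩, ⟨1, 1, 546, 618970167432815526444822752⟩, ⟨1, 1, 563,
     618970167216677963096588482⟩]⟩,
   ⟨36, 618970019714747748667363456, [⟨0, 1, 36, 618970019714747748667363456⟩]⟩,
   ⟨37, 618970167432815509248159744, [⟨0, 1, 37, 618970167432815509248159744⟩]⟩,
   ⟨51, 147573987825647026370, [⟨0, 1, 51, 147573987825647026370⟩]⟩,
   ⟨52, 618970019642725373361389698, [⟨0, 2, 820, 619876714079564376870617986⟩, ⟨0, 2, 1076,
     618970168082214341258186950⟩, ⟨1, 1, 563, 618970167216677963096588482⟩, ⟨1, 1, 580,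
     618970019714853404997193862⟩]⟩,
   ⟨53, 618970167216677911506452482, [⟨0, 1, 53, 618970167216677911506452482⟩]⟩,
   ⟨68, 72163267547631750, [⟨0, 1, 68, 72163267547631750⟩]⟩,
   ⟨69, 618970019714853284603760646, [⟨0, 2, 837, 618970167433062058348516102⟩, ⟨0, 2, 1093,
     618970906024104513629204622⟩, ⟨1, 1, 580, 618970019714853404997193862⟩, ⟨1, 1, 597,
     618970167433061799852781582⟩]⟩,
   ⟨85, 147790371662403219470, [⟨0, 1, 85, 147790371662403219470⟩]⟩]

def tabB : List Ent :=
  [⟨17, 147790371662403219470, [⟨0, 1, 1099511661601, 605201573013313099673870⟩, ⟨1, 1,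
    35184372122657, 302674681692900471353870⟩]⟩,
   ⟨529, 618970167433061799852781582, [⟨0, 1, 1099511661601, 605201573013313099673870⟩, ⟨0, 1,
     35184372122657, 302674681692900471353870⟩]⟩,
   ⟨786, 619877748105933164839464990, [⟨0, 1, 1082401, 619877748105933164839464990⟩]⟩,
   ⟨1042, 618970167433062625292595440, [⟨0, 1, 36283883750432, 618970167433062625292595440⟩]⟩,
   ⟨34, 147790125388995260640, [⟨0, 1, 1099512710176, 605201572485564715004640⟩, ⟨1, 1,
     35184373171232, 302674681728102040105440⟩]⟩,
   ⟨546, 618970167432815526444822752, [⟨0, 1, 1099512710176, 605201572485564715004640⟩, ⟨0, 1,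
     35184373171232, 302674681728102040105440⟩]⟩,
   ⟨803, 619877747025104473035961280, [⟨0, 1, 34636832, 619877747025104473035961280⟩]⟩,
   ⟨1059, 618970167433660776814182626, [⟨0, 1, 36283884798976, 618970167433660776814182626⟩]⟩,
   ⟨51, 147573987825647026370, [⟨0, 1, 1099546264576, 605201068117625215320770⟩, ⟨1, 1,
     35184406725632, 302674753820914843320770⟩]⟩,
   ⟨563, 618970167216677963096588482, [⟨0, 1, 1099546264576, 605201068117625215320770⟩, ⟨0, 1,
     35184406725632, 302674753820914843320770⟩]⟩,
   ⟨820, 619876714079564376870617986, [⟨0, 1, 1108378624, 619876714079564376870617986⟩]⟩,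
   ⟨1076, 618970168082214341258186950, [⟨0, 1, 36283918352384, 618970168082214341258186950⟩]⟩,
   ⟨68, 72163267547631750, [⟨0, 1, 1100620005376, 604758418387888031535750⟩, ⟨1, 1,
     35185480466432, 302822399901535828316550⟩]⟩,
   ⟨580, 618970019714853404997193862, [⟨0, 1, 1100620005376, 604758418387888031535750⟩, ⟨0, 1,
     35185480466432, 302822399901535828316550⟩]⟩,
   ⟨837, 618970167433062058348516102, [⟨0, 1, 35468115968, 618970167433062058348516102⟩]⟩,
   ⟨1093, 618970906024104513629204622, [⟨0, 1, 36284992061440, 618970906024104513629204622⟩]⟩,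
   ⟨85, 147790371662403219470, [⟨0, 1, 1134979710976, 302674681692900471353870⟩, ⟨1, 1,
     35219840172032, 605201573013313099673870⟩]⟩,
   ⟨597, 618970167433061799852781582, [⟨0, 1, 1134979710976, 302674681692900471353870⟩, ⟨0, 1,
     35219840172032, 605201573013313099673870⟩]⟩]

def baseWords : List Word :=
  [⟨0, 1, 4096, 4097, 4098, 4098, 4098⟩,
   ⟨0, 1, 4096, 4098, 4097, 4098, 4098⟩,
   ⟨0, 1, 4096, 4098, 4098, 4097, 4098⟩,
   ⟨0, 1, 4096, 4098, 4098, 4098, 4097⟩,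
   ⟨1, 1, 4099, 4100, 4098, 4098, 4098⟩,
   ⟨1, 1, 4099, 4101, 4102, 4098, 4098⟩,
   ⟨1, 1, 4099, 4101, 4101, 4102, 4098⟩,
   ⟨1, 1, 4099, 4101, 4101, 4101, 4102⟩,
   ⟨0, 1, 4100, 4103, 4098, 4098, 4098⟩,
   ⟨0, 1, 4100, 4103, 4103, 4103, 4103⟩,
   ⟨0, 1, 4098, 4103, 4098, 4098, 4098⟩,
   ⟨0, 2, 4104, 4105, 4098, 4098, 4098⟩,
   ⟨0, 2, 4104, 4098, 4105, 4098, 4098⟩,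
   ⟨0, 2, 4104, 4098, 4098, 4105, 4098⟩,
   ⟨0, 2, 4104, 4098, 4098, 4098, 4105⟩,
   ⟨1, 2, 4106, 4107, 4098, 4098, 4098⟩,
   ⟨1, 2, 4106, 4108, 4109, 4098, 4098⟩,
   ⟨1, 2, 4106, 4108, 4108, 4109, 4098⟩,
   ⟨1, 2, 4106, 4108, 4108, 4108, 4109⟩,
   ⟨0, 2, 4107, 4110, 4098, 4098, 4098⟩,
   ⟨0, 2, 4107, 4110, 4110, 4110, 4110⟩,
   ⟨0, 2, 4098, 4110, 4098, 4098, 4098⟩,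
   ⟨1, 8, 4111, 4112, 4112, 4112, 4112⟩,
   ⟨0, 1, 4113, 4114, 4115, 4115, 4115⟩,
   ⟨0, 1, 4113, 4115, 4114, 4115, 4115⟩,
   ⟨0, 1, 4113, 4115, 4115, 4114, 4115⟩,
   ⟨0, 1, 4113, 4115, 4115, 4115, 4114⟩,
   ⟨1, 1, 4107, 4116, 4115, 4115, 4115⟩,
   ⟨1, 1, 4107, 4110, 4117, 4115, 4115⟩,
   ⟨1, 1, 4107, 4110, 4110, 4117, 4115⟩,
   ⟨1, 1, 4107, 4110, 4110, 4110, 4117⟩,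
   ⟨0, 1, 4116, 4118, 4115, 4115, 4115⟩,
   ⟨0, 1, 4116, 4118, 4118, 4118, 4118⟩,
   ⟨0, 1, 4115, 4118, 4115, 4115, 4115⟩,
   ⟨0, 2, 4119, 4120, 4115, 4115, 4115⟩,
   ⟨0, 2, 4119, 4115, 4120, 4115, 4115⟩,
   ⟨0, 2, 4119, 4115, 4115, 4120, 4115⟩,
   ⟨0, 2, 4119, 4115, 4115, 4115, 4120⟩,
   ⟨1, 2, 4121, 4122, 4115, 4115, 4115⟩,
   ⟨1, 2, 4121, 4123, 4124, 4115, 4115⟩,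
   ⟨1, 2, 4121, 4123, 4123, 4124, 4115⟩,
   ⟨1, 2, 4121, 4123, 4123, 4123, 4124⟩,
   ⟨0, 2, 4122, 4125, 4115, 4115, 4115⟩,
   ⟨0, 2, 4122, 4125, 4125, 4125, 4125⟩,
   ⟨0, 2, 4115, 4125, 4115, 4115, 4115⟩,
   ⟨1, 8, 4126, 4127, 4127, 4127, 4127⟩]

/-- The whole verification. -/
def verify : Bool :=
  foldWords (expand tabF (leadOdd insWord)) baseWords .nil fun t =>
  foldTr (expand tabS insWord) t .nil fun t =>
  foldTr (dihedral insWord) t .nil fun t =>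
  foldTr (expand tabP (dihedral insWord)) t .nil fun t =>
  brackets 1082401 34636832 1108378624 35468115968 1134979710976 0 14400 .nil fun t' =>
  foldTr (expand tabB brackets) t t' fun t =>
  foldBr (leadMin brackets) t .nil vanishes

/-- A proposition stating that a boolean is true. -/
inductive Good : Bool → Prop
  | mk : Good true

instance decidableGood (b : Bool) : Decidable (Good b) :=
  Bool.rec (motive := fun b => Decidable (Good b)) (isFalse fun h => by cases h) (isTrue .mk) b

end Kernel

end GrassPoly

end

noncomputable section

namespace GrassPoly

namespace Kernel

theorem force_eq (n : ℕ) (K : ℕ → Bool) : force n K = K n := by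
  cases n <;> rfl

theorem br_eq (b x y : Bool) : br b x y = bif b then x else y := by
  cases b <;> rfl

theorem lt_of_ble_eq_false {x y : ℕ} (h : Nat.ble x y = false) : y < x := by
  by_contra hxy
  rw [Nat.ble_eq_true_of_le (not_lt.1 hxy)] at h
  cases h

theorem minK_eq (x y : ℕ) (K : ℕ → Bool) : minK x y K = K (min x y) := by
  unfold minK
  rw [br_eq]
  cases h : Nat.ble x y
  · have := lt_of_ble_eq_false h
    simp [min_eq_right this.le]
  · have := Nat.le_of_ble_eq_true h
    simp [min_eq_left this]

theorem maxK_eq (x y : ℕ) (K : ℕ → Bool) : maxK x y K = K (max x y) := by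
  unfold maxK
  rw [br_eq]
  cases h : Nat.ble x y
  · have := lt_of_ble_eq_false h
    simp [max_eq_left this.le]
  · have := Nat.le_of_ble_eq_true h
    simp [max_eq_right this]

variable {V M : Type*} [AddCommGroup V] [Module ℚ V] [AddCommGroup M] [Module ℚ M]

/-- The rational number `(-1) ^ s * m`. -/
def sg (s m : ℕ) : ℚ := (-1) ^ s * m

theorem sg_even {s : ℕ} (h : s % 2 = 0) (m : ℕ) : sg s m = m := by
  simp [sg, (Nat.even_iff.2 h).neg_one_pow]

theorem sg_odd {s : ℕ} (h : s % 2 ≠ 0) (m : ℕ) : sg s m = -m := by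
  simp [sg, (Nat.odd_iff.2 (by omega : s % 2 = 1)).neg_one_pow]

theorem sg_succ (s m : ℕ) : sg (s + 1) m = -sg s m := by
  simp [sg, pow_succ]

theorem sg_add_mul (s s' m m' : ℕ) : sg (s + s') (m * m') = sg s m * sg s' m' := by
  simp only [sg, pow_add, Nat.cast_mul]
  ring

theorem sg_mul (s m m' : ℕ) : sg s (m * m') = m' * sg s m := by
  simp only [sg, Nat.cast_mul]
  ring

theorem sg_add (s s' m : ℕ) : sg (s + s') m = (-1) ^ s' * sg s m := by
  simp only [sg, pow_add]
  ring

/-- The linear combination stored in a tree. -/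
def sem (G : ℕ → M) : Tr → M
  | .nil => 0
  | .node l _ h p n r => sem G l + ((p : ℚ) - n) • G h + sem G r

/-- A computation on trees adds `v` to the stored linear combination. -/
def Run (G : ℕ → M) (f : Tr → (Tr → Bool) → Bool) (v : M) : Prop :=
  ∀ t K, f t K = true → ∃ t', sem G t' = sem G t + v ∧ K t' = true

theorem Run.pure (G : ℕ → M) : Run G (fun t K => K t) 0 :=
  fun t _ h => ⟨t, by simp, h⟩

theorem Run.bind {G : ℕ → M} {f g : Tr → (Tr → Bool) → Bool} {v w : M} (hf : Run G f v)
    (hg : Run G g w) : Run G (fun t K => f t fun t' => g t' K) (v + w) := by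
  intro t K h
  obtain ⟨t', h1, h2⟩ := hf _ _ h
  obtain ⟨t'', h3, h4⟩ := hg _ _ h2
  exact ⟨t'', by rw [h3, h1, add_assoc], h4⟩

theorem Run.congr {G : ℕ → M} {f : Tr → (Tr → Bool) → Bool} {v w : M} (hf : Run G f v)
    (h : v = w) : Run G f w := h ▸ hf

theorem Run.abort (G : ℕ → M) (v : M) : Run G (fun _ _ => false) v := by
  intro t K h
  cases h

theorem Run.br {G : ℕ → M} {b : Bool} {f g : Tr → (Tr → Bool) → Bool} {v : M}
    (hf : b = true → Run G f v) (hg : b = false → Run G g v) :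
    Run G (fun t K => br b (f t K) (g t K)) v := by
  cases b
  · exact hg rfl
  · exact hf rfl

theorem ins_nil (x h s m : ℕ) (K : Tr → Bool) : ins x h s m .nil K =
    br (Nat.beq (s % 2) 0) (K (.node .nil x h m 0 .nil)) (K (.node .nil x h 0 m .nil)) := rfl

theorem ins_node (x h s m : ℕ) (l : Tr) (x' h' p n : ℕ) (r : Tr) (K : Tr → Bool) :
    ins x h s m (.node l x' h' p n r) K =
      br (Nat.beq h h')
        (br (Nat.beq (s % 2) 0) (K (.node l x' h' (p + m) n r)) (K (.node l x' h' p (n + m) r)))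
        (br (Nat.ble x x') (ins x h s m l fun l' => K (.node l' x' h' p n r))
          (ins x h s m r fun r' => K (.node l x' h' p n r'))) := by
  rw [← force_eq (p + m) fun p' => K (.node l x' h' p' n r),
    ← force_eq (n + m) fun n' => K (.node l x' h' p n' r)]
  rfl

theorem isRun_ins (G : ℕ → M) (x h s m : ℕ) : Run G (ins x h s m) (sg s m • G h) := by
  intro t
  induction t with
  | nil =>
    intro K hK
    rw [ins_nil] at hK
    cases hs : Nat.beq (s % 2) 0
    · rw [hs] at hK
      refine ⟨_, ?_, hK⟩
      rw [sg_odd (Nat.ne_of_beq_eq_false hs)]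
      simp [sem]
    · rw [hs] at hK
      refine ⟨_, ?_, hK⟩
      rw [sg_even (Nat.eq_of_beq_eq_true hs)]
      simp [sem]
  | node l x' h' p n r ihl ihr =>
    intro K hK
    rw [ins_node] at hK
    cases hh : Nat.beq h h'
    · rw [hh] at hK
      cases hx : Nat.ble x x'
      · rw [hx] at hK
        obtain ⟨t', h1, h2⟩ := ihr _ hK
        refine ⟨_, ?_, h2⟩
        simp only [sem, h1]
        abel
      · rw [hx] at hK
        obtain ⟨t', h1, h2⟩ := ihl _ hK
        refine ⟨_, ?_, h2⟩
        simp only [sem, h1]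
        abel
    · rw [hh] at hK
      have hh := Nat.eq_of_beq_eq_true hh
      subst hh
      cases hs : Nat.beq (s % 2) 0
      · rw [hs] at hK
        refine ⟨_, ?_, hK⟩
        rw [sg_odd (Nat.ne_of_beq_eq_false hs)]
        simp only [sem]
        push_cast
        module
      · rw [hs] at hK
        refine ⟨_, ?_, hK⟩
        rw [sg_even (Nat.eq_of_beq_eq_true hs)]
        simp only [sem]
        push_cast
        module

/-- A step adds the given combination of words. -/
def StepSpec (G : ℕ → M) (g : ℕ → ℕ → ℕ → ℕ → ℕ → M) (f : Step) : Prop :=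
  ∀ a b c d e s m, Run G (f a b c d e s m) (sg s m • g a b c d e)

/-- The value of an encoded word. -/
def decoded (g : ℕ → ℕ → ℕ → ℕ → ℕ → M) (h : ℕ) : M :=
  g (h / 65536 ^ 4 % 65536) (h / 65536 ^ 3 % 65536) (h / 65536 ^ 2 % 65536)
    (h / 65536 % 65536) (h % 65536)

omit [AddCommGroup M] [Module ℚ M] in
theorem decoded_enc (g : ℕ → ℕ → ℕ → ℕ → ℕ → M) {a b c d e : ℕ}
    (h : Nat.lor a (Nat.lor b (Nat.lor c (Nat.lor d e))) < 65536) :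
    decoded g (enc a b c d e) = g a b c d e := by
  have key : ∀ x y : ℕ, Nat.lor x y < 65536 → x < 65536 ∧ y < 65536 := fun x y hxy =>
    ⟨lt_of_le_of_lt Nat.left_le_or hxy, lt_of_le_of_lt Nat.right_le_or hxy⟩
  obtain ⟨ha, h⟩ := key _ _ h
  obtain ⟨hb, h⟩ := key _ _ h
  obtain ⟨hc, h⟩ := key _ _ h
  obtain ⟨hd, he⟩ := key _ _ h
  unfold decoded
  congr 1 <;>
  · simp only [enc, Nat.add_eq, Nat.mul_eq]
    omega

theorem stepSpec_insWord (g : ℕ → ℕ → ℕ → ℕ → ℕ → M) :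
    StepSpec (decoded g) g insWord := by
  intro a b c d e s m
  unfold insWord
  simp only [force_eq]
  refine Run.br (fun h => ?_) (fun _ => Run.abort _ _)
  rw [← decoded_enc g (by simpa [Nat.blt_eq] using h)]
  exact isRun_ins _ _ _ _ _

theorem isRun_visit {G : ℕ → M} {g : ℕ → ℕ → ℕ → ℕ → ℕ → M} {f : Step} (hf : StepSpec G g f)
    (h p n : ℕ) : Run G (visit f h p n) (((p : ℚ) - n) • decoded g h) := by
  unfold visit
  simp only [force_eq]
  refine Run.br (fun hpn => ?_) (fun _ => Run.br (fun hpn => ?_) (fun hpn => ?_))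
  · refine (Run.pure G).congr ?_
    rw [Nat.eq_of_beq_eq_true hpn]
    simp
  · refine (hf _ _ _ _ _ 0 (p - n)).congr ?_
    rw [sg_even rfl, Nat.cast_sub (Nat.le_of_ble_eq_true hpn)]
    rfl
  · refine (hf _ _ _ _ _ 1 (n - p)).congr ?_
    rw [sg_odd (by norm_num), Nat.cast_sub (lt_of_ble_eq_false hpn).le, neg_sub]
    rfl

theorem isRun_foldTr {G : ℕ → M} {g : ℕ → ℕ → ℕ → ℕ → ℕ → M} {f : Step} (hf : StepSpec G g f)
    (src : Tr) : Run G (foldTr f src) (sem (decoded g) src) := by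
  induction src with
  | nil => exact Run.pure G
  | node l x h p n r ihl ihr =>
    exact (ihl.bind ((isRun_visit hf h p n).bind ihr)).congr (by simp only [sem]; abel)

theorem isRun_foldWords {G : ℕ → M} {g : ℕ → ℕ → ℕ → ℕ → ℕ → M} {f : Step} (hf : StepSpec G g f)
    (src : List Word) :
    Run G (foldWords f src) (src.map fun w => sg w.s w.m • g w.a w.b w.c w.d w.e).sum := by
  induction src with
  | nil => exact Run.pure G
  | cons w l ih => exact (hf _ _ _ _ _ _ _).bind ih

/-- A number is the code of a word of brackets. -/
def unwoven (g : ℕ → ℕ → ℕ → ℕ → ℕ → M) (h : ℕ) : M :=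
  g (Nat.land h fstMask) (Nat.land (Nat.div h 2) fstMask) (Nat.land (Nat.div h 4) fstMask)
    (Nat.land (Nat.div h 8) fstMask) (Nat.land (Nat.div h 16) fstMask)

theorem isRun_visitBr {G : ℕ → M} {g : ℕ → ℕ → ℕ → ℕ → ℕ → M} {f : Step} (hf : StepSpec G g f)
    (h p n : ℕ) : Run G (visitBr f h p n) (((p : ℚ) - n) • unwoven g h) := by
  unfold visitBr
  simp only [force_eq]
  refine Run.br (fun hpn => ?_) (fun _ => Run.br (fun hpn => ?_) (fun hpn => ?_))
  · refine (Run.pure G).congr ?_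
    rw [Nat.eq_of_beq_eq_true hpn]
    simp
  · refine (hf _ _ _ _ _ 0 (p - n)).congr ?_
    rw [sg_even rfl, Nat.cast_sub (Nat.le_of_ble_eq_true hpn)]
    rfl
  · refine (hf _ _ _ _ _ 1 (n - p)).congr ?_
    rw [sg_odd (by norm_num), Nat.cast_sub (lt_of_ble_eq_false hpn).le, neg_sub]
    rfl

theorem isRun_foldBr {G : ℕ → M} {g : ℕ → ℕ → ℕ → ℕ → ℕ → M} {f : Step} (hf : StepSpec G g f)
    (src : Tr) : Run G (foldBr f src) (sem (unwoven g) src) := by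
  induction src with
  | nil => exact Run.pure G
  | node l x h p n r ihl ihr =>
    exact (ihl.bind ((isRun_visitBr hf h p n).bind ihr)).congr (by simp only [sem]; abel)

theorem sem_eq_zero_of_vanishes (G : ℕ → M) {t : Tr} (h : vanishes t = true) : sem G t = 0 := by
  induction t with
  | nil => rfl
  | node l x h' p n r ihl ihr =>
    change br (Nat.beq p n) (br (vanishes l) (vanishes r) false) false = true at h
    simp only [br_eq, Bool.cond_false_right, Bool.and_eq_true] at h
    obtain ⟨h1, h2, h3⟩ := h
    simp only [sem, ihl h2, ihr h3, Nat.eq_of_beq_eq_true h1]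
    simp

/-- The linear combination of the options of a letter. -/
def total (val : ℕ → V) (o : List Opt) : V := (o.map fun x => sg x.s x.m • val x.l).sum

/-- Conditions for words to be expanded by a table: `Fix p v` means that the `p`th transposition
fixes `v`. -/
structure TabSpec (Fix : ℕ → V → Prop) (val val' : ℕ → V) (tab : List Ent) : Prop where
  total : ∀ x ∈ tab, val x.c = total val' x.o
  fix : ∀ x ∈ tab, ∀ p, x.f.testBit p = true → Fix p (val x.c)
  fix' : ∀ x ∈ tab, ∀ y ∈ x.o, ∀ p, y.f.testBit p = true → Fix p (val' y.l)

/-- A function of five vectors which is linear in each of them and vanishes if they are all fixed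
by a transposition. -/
structure Alternating (Fix : ℕ → V → Prop) (q : V → V → V → V → V → M) : Prop where
  lin1 : ∀ b c d e, IsLinearMap ℚ fun a => q a b c d e
  lin2 : ∀ a c d e, IsLinearMap ℚ fun b => q a b c d e
  lin3 : ∀ a b d e, IsLinearMap ℚ fun c => q a b c d e
  lin4 : ∀ a b c e, IsLinearMap ℚ fun d => q a b c d e
  lin5 : ∀ a b c d, IsLinearMap ℚ fun e => q a b c d e
  fixed : ∀ p a b c d e, Fix p a → Fix p b → Fix p c → Fix p d → Fix p e → q a b c d e = 0

theorem isRun_look {G : ℕ → M} {tab : List Ent} {c : ℕ}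
    {f : ℕ → List Opt → Tr → (Tr → Bool) → Bool} {v : M}
    (h : ∀ x ∈ tab, x.c = c → Run G (f x.f x.o) v) :
    Run G (fun t K => look tab c fun a o => f a o t K) v := by
  induction tab with
  | nil => exact Run.abort _ _
  | cons x l ih =>
    change Run G (fun t K => Kernel.br (Nat.beq c x.c) (f x.f x.o t K)
      (look l c fun a o => f a o t K)) v
    refine Run.br (fun hc => h x (by simp) (Nat.eq_of_beq_eq_true hc).symm)
      (fun _ => ih fun y hy => h y (by simp [hy]))

theorem isRun_loop {G : ℕ → M} {Fix : ℕ → V → Prop} {val' : ℕ → V} {g : V → M}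
    (hg : IsLinearMap ℚ g)
    {body : ℕ → ℕ → ℕ → ℕ → Tr → (Tr → Bool) → Bool} {s m a suf : ℕ} {o : List Opt}
    (ho : ∀ y ∈ o, ∀ p, y.f.testBit p = true → Fix p (val' y.l))
    (hz : ∀ v p, a.testBit p = true → suf.testBit p = true → Fix p v → g v = 0)
    (hb : ∀ y ∈ o, ∀ s' m', Run G (body y.l (Nat.land a y.f) s' m') (sg s' m' • g (val' y.l))) :
    Run G (loop body s m a suf o) (sg s m • g (total val' o)) := by
  induction o with
  | nil =>
    refine (Run.pure G).congr ?_
    simp [total, hg.map_zero]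
  | cons x l ih =>
    have ih := ih (fun y hy => ho y (by simp [hy])) (fun y hy => hb y (by simp [hy]))
    have hx : g (total val' (x :: l)) = sg x.s x.m • g (val' x.l) + g (total val' l) := by
      simp [total, hg.map_add, hg.map_smul]
    rw [hx]
    change Run G (fun t K => force (Nat.land a x.f) fun a' =>
        Kernel.br (Nat.beq (Nat.land a' suf) 0)
      (force (Nat.add s x.s) fun s1 => force (Nat.mul m x.m) fun m1 =>
        body x.l a' s1 m1 t fun t' => loop body s m a suf l t' K) (loop body s m a suf l t K)) _
    simp only [force_eq]
    refine Run.br (fun _ => ((hb x (by simp) _ _).bind ih).congr ?_) (fun h => ih.congr ?_)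
    · rw [show sg (s.add x.s) (m.mul x.m) = _ from sg_add_mul s x.s m x.m]
      module
    · have hne := Nat.ne_of_beq_eq_false h
      obtain ⟨p, hp⟩ : ∃ p, (Nat.land (Nat.land a x.f) suf).testBit p = true := by
        by_contra! hcon
        refine hne (Nat.eq_of_testBit_eq fun i => ?_)
        simpa using hcon i
      have hp' : (a.testBit p = true ∧ x.f.testBit p = true) ∧ suf.testBit p = true := by
        have : ((a &&& x.f) &&& suf).testBit p = true := hp
        simpa using this
      rw [hz _ p hp'.1.1 hp'.2 (ho x (by simp) p hp'.1.2)]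
      simp

theorem testBit_land' (a b p : ℕ) :
    (Nat.land a b).testBit p = true ↔ a.testBit p = true ∧ b.testBit p = true := by
  change (a &&& b).testBit p = true ↔ _
  simp

theorem stepSpec_expand {G : ℕ → M} {Fix : ℕ → V → Prop} {val val' : ℕ → V} {tab : List Ent}
    (htab : TabSpec Fix val val' tab) {q : V → V → V → V → V → M} (hq : Alternating Fix q)
    {leaf : Step}
    (hleaf : StepSpec G (fun a b c d e => q (val' a) (val' b) (val' c) (val' d) (val' e)) leaf) :
    StepSpec G (fun a b c d e => q (val a) (val b) (val c) (val d) (val e)) (expand tab leaf) := by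
  intro a b c d e s m
  unfold expand
  simp only [force_eq]
  refine isRun_look fun xa ha ea => isRun_look fun xb hb eb => isRun_look fun xc hc ec =>
    isRun_look fun xd hd ed => isRun_look fun xe he ee => ?_
  subst ea eb ec ed ee
  have fa' := htab.fix' _ ha
  have fb := htab.fix _ hb
  have fb' := htab.fix' _ hb
  have fc := htab.fix _ hc
  have fc' := htab.fix' _ hc
  have fd := htab.fix _ hd
  have fd' := htab.fix' _ hd
  have fe := htab.fix _ he
  have fe' := htab.fix' _ he
  rw [htab.total _ ha]
  refine isRun_loop (Fix := Fix) (g := fun v => q v (val xb.c) (val xc.c) (val xd.c) (val xe.c))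
    (hq.lin1 _ _ _ _) fa' ?_ fun ya hya s m => ?_
  · intro v p _ h2 hv
    simp only [testBit_land'] at h2
    exact hq.fixed p _ _ _ _ _ hv (fb _ h2.1) (fc _ h2.2.1) (fd _ h2.2.2.1) (fe _ h2.2.2.2)
  rw [htab.total _ hb]
  refine isRun_loop (Fix := Fix) (g := fun v => q _ v (val xc.c) (val xd.c) (val xe.c))
    (hq.lin2 _ _ _ _) fb' ?_ fun yb hyb s m => ?_
  · intro v p h1 h2 hv
    simp only [testBit_land'] at h1 h2
    exact hq.fixed p _ _ _ _ _ (fa' _ hya _ h1.2) hv (fc _ h2.1) (fd _ h2.2.1) (fe _ h2.2.2)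
  rw [htab.total _ hc]
  refine isRun_loop (Fix := Fix) (g := fun v => q _ _ v (val xd.c) (val xe.c))
    (hq.lin3 _ _ _ _) fc' ?_ fun yc hyc s m => ?_
  · intro v p h1 h2 hv
    simp only [testBit_land'] at h1 h2
    exact hq.fixed p _ _ _ _ _ (fa' _ hya _ h1.1.2) (fb' _ hyb _ h1.2) hv (fd _ h2.1) (fe _ h2.2)
  rw [htab.total _ hd]
  refine isRun_loop (Fix := Fix) (g := fun v => q _ _ _ v (val xe.c))
    (hq.lin4 _ _ _ _) fd' ?_ fun yd hyd s m => ?_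
  · intro v p h1 h2 hv
    simp only [testBit_land'] at h1
    exact hq.fixed p _ _ _ _ _ (fa' _ hya _ h1.1.1.2) (fb' _ hyb _ h1.1.2) (fc' _ hyc _ h1.2) hv
      (fe _ h2)
  rw [htab.total _ he]
  refine isRun_loop (Fix := Fix) (g := fun v => q _ _ _ _ v)
    (hq.lin5 _ _ _ _) fe' ?_ fun ye _ s m => hleaf _ _ _ _ _ _ _
  intro v p h1 _ hv
  simp only [testBit_land'] at h1
  exact hq.fixed p _ _ _ _ _ (fa' _ hya _ h1.1.1.1.2) (fb' _ hyb _ h1.1.1.2) (fc' _ hyc _ h1.1.2)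
    (fd' _ hyd _ h1.2) hv

end Kernel

end GrassPoly

end

noncomputable section

namespace GrassPoly

namespace Kernel

variable {M : Type*} [AddCommGroup M] [Module ℚ M]

theorem eq_zero_of_eq_neg {v : M} (h : v = -v) : v = 0 := by
  have h2 : (2 : ℚ) • v = 0 := by rw [two_smul, ← eq_neg_iff_add_eq_zero]; exact h
  simpa using h2

/-- A function of five letters that allows to choose the first letter of a word. -/
structure Leads (g : ℕ → ℕ → ℕ → ℕ → ℕ → M) : Prop where
  two : ∀ a b c d e, g a b c d e = -(g b a c d e + (g b c a d e + (g b c d a e + g b c d e a)))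
  three : ∀ a b c d e, g a b c d e =
    g c b a d e + (g c b d a e + (g c b d e a + (g c d b a e + (g c d b e a + g c d e b a))))
  four : ∀ a b c d e, g a b c d e = -(g d c b a e + (g d c b e a + (g d c e b a + g d e c b a)))
  five : ∀ a b c d e, g a b c d e = g e d c b a

theorem isRun_weight {G : ℕ → M} {w s m : ℕ} {v : M} {f : Tr → (Tr → Bool) → Bool}
    (hf : Run G f ((w : ℚ) • sg s m • v)) :
    Run G (fun t K => br (Nat.beq w 0) (K t) (f t K)) ((w : ℚ) • sg s m • v) := by
  refine Run.br (fun h => (Run.pure G).congr ?_) fun _ => hf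
  rw [Nat.eq_of_beq_eq_true h]
  simp

theorem isRun_lead {G : ℕ → M} {g : ℕ → ℕ → ℕ → ℕ → ℕ → M} (hg : Leads g) {leaf : Step}
    (hleaf : StepSpec G g leaf) (w0 w1 w2 w3 w4 a b c d e s m : ℕ) :
    Run G (lead w0 w1 w2 w3 w4 leaf a b c d e s m)
      (((w0 + w1 + w2 + w3 + w4 : ℕ) : ℚ) • sg s m • g a b c d e) := by
  have h0 : Run G (fun t K => br (Nat.beq w0 0) (K t) (force (Nat.mul m w0) fun m =>
      leaf a b c d e s m t K))
      ((w0 : ℚ) • sg s m • g a b c d e) := by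
    simp only [force_eq]
    refine isRun_weight ((hleaf _ _ _ _ _ _ _).congr ?_)
    rw [show m.mul w0 = m * w0 from rfl, sg_mul]
    module
  have h1 : Run G (fun t K => br (Nat.beq w1 0) (K t) (force (Nat.mul m w1) fun m =>
      force (Nat.succ s) fun s =>
        leaf b a c d e s m t fun t => leaf b c a d e s m t fun t =>
        leaf b c d a e s m t fun t => leaf b c d e a s m t K))
      ((w1 : ℚ) • sg s m • g a b c d e) := by
    simp only [force_eq]
    refine isRun_weight (((hleaf _ _ _ _ _ _ _).bind ((hleaf _ _ _ _ _ _ _).bind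
        ((hleaf _ _ _ _ _ _ _).bind (hleaf _ _ _ _ _ _ _)))).congr ?_)
    rw [show m.mul w1 = m * w1 from rfl, Nat.succ_eq_add_one, sg_succ, sg_mul, hg.two a b c d e]
    module
  have h2 : Run G (fun t K => br (Nat.beq w2 0) (K t) (force (Nat.mul m w2) fun m =>
        leaf c b a d e s m t fun t => leaf c b d a e s m t fun t => leaf c b d e a s m t fun t =>
        leaf c d b a e s m t fun t => leaf c d b e a s m t fun t => leaf c d e b a s m t K))
      ((w2 : ℚ) • sg s m • g a b c d e) := by
    simp only [force_eq]
    refine isRun_weight (((hleaf _ _ _ _ _ _ _).bind ((hleaf _ _ _ _ _ _ _).bind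
        ((hleaf _ _ _ _ _ _ _).bind ((hleaf _ _ _ _ _ _ _).bind ((hleaf _ _ _ _ _ _ _).bind
            (hleaf _ _ _ _ _ _ _)))))).congr ?_)
    rw [show m.mul w2 = m * w2 from rfl, sg_mul, hg.three a b c d e]
    module
  have h3 : Run G (fun t K => br (Nat.beq w3 0) (K t) (force (Nat.mul m w3) fun m =>
      force (Nat.succ s) fun s =>
        leaf d c b a e s m t fun t => leaf d c b e a s m t fun t =>
        leaf d c e b a s m t fun t => leaf d e c b a s m t K))
      ((w3 : ℚ) • sg s m • g a b c d e) := by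
    simp only [force_eq]
    refine isRun_weight (((hleaf _ _ _ _ _ _ _).bind ((hleaf _ _ _ _ _ _ _).bind
        ((hleaf _ _ _ _ _ _ _).bind (hleaf _ _ _ _ _ _ _)))).congr ?_)
    rw [show m.mul w3 = m * w3 from rfl, Nat.succ_eq_add_one, sg_succ, sg_mul, hg.four a b c d e]
    module
  have h4 : Run G (fun t K => br (Nat.beq w4 0) (K t) (force (Nat.mul m w4) fun m =>
      leaf e d c b a s m t K))
      ((w4 : ℚ) • sg s m • g a b c d e) := by
    simp only [force_eq]
    refine isRun_weight ((hleaf _ _ _ _ _ _ _).congr ?_)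
    rw [show m.mul w4 = m * w4 from rfl, sg_mul, hg.five a b c d e]
    module
  refine (h0.bind (h1.bind (h2.bind (h3.bind h4)))).congr ?_
  push_cast
  module

/-- `1` for an odd letter, else `0`. -/
def oddN (c : ℕ) : ℕ := if 3072 ≤ c then 1 else 0

theorem odd_eq (c : ℕ) (K : ℕ → Bool) : odd c K = K (oddN c) := by
  unfold odd oddN
  rw [br_eq]
  cases h : Nat.ble 3072 c
  · have := lt_of_ble_eq_false h
    rw [if_neg (by omega)]
    rfl
  · rw [if_pos (Nat.le_of_ble_eq_true h)]
    rfl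

theorem eqK_eq (x y : ℕ) (K : ℕ → Bool) : eqK x y K = K (if x = y then 1 else 0) := by
  unfold eqK
  rw [br_eq]
  cases h : Nat.beq x y
  · rw [if_neg (Nat.ne_of_beq_eq_false h)]
    rfl
  · rw [if_pos (Nat.eq_of_beq_eq_true h)]
    rfl

theorem oddN_le (c : ℕ) : oddN c ≤ 1 := by
  unfold oddN
  split <;> omega

theorem stepSpec_leadOdd {G : ℕ → M} {g : ℕ → ℕ → ℕ → ℕ → ℕ → M} (hg : Leads g)
    (hodd : ∀ a b c d e, (oddN a + (oddN b + (oddN c + (oddN d + oddN e)))) % 2 = 0 →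
      g a b c d e = 0) {leaf : Step} (hleaf : StepSpec G g leaf) :
    StepSpec G (fun a b c d e => (10 : ℚ) • g a b c d e) (leadOdd leaf) := by
  intro a b c d e s m
  unfold leadOdd
  simp only [force_eq, odd_eq]
  have ha := oddN_le a
  have hb := oddN_le b
  have hc := oddN_le c
  have hd := oddN_le d
  have he := oddN_le e
  have key : ∀ w0 w1 w2 w3 w4 : ℕ, w0 + w1 + w2 + w3 + w4 = 10 →
      Run G (lead w0 w1 w2 w3 w4 leaf a b c d e s m) (sg s m • (10 : ℚ) • g a b c d e) := by
    intro w0 w1 w2 w3 w4 hw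
    refine (isRun_lead hg hleaf w0 w1 w2 w3 w4 a b c d e s m).congr ?_
    rw [hw, smul_comm]
    rfl
  refine Run.br (fun h => (Run.pure G).congr ?_) fun _ => Run.br (fun h => ?_) fun _ =>
    Run.br (fun h => ?_) fun _ => Run.br (fun h => ?_) fun _ => Run.abort _ _
  · rw [hodd _ _ _ _ _ (Nat.eq_of_beq_eq_true h)]
    simp
  · have := Nat.eq_of_beq_eq_true h
    exact key _ _ _ _ _ (by omega)
  · have := Nat.eq_of_beq_eq_true h
    exact key _ _ _ _ _ (by omega)
  · exact key _ _ _ _ _ (by omega)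

theorem stepSpec_leadMin {G : ℕ → M} {g : ℕ → ℕ → ℕ → ℕ → ℕ → M} (hg : Leads g) {leaf : Step}
    (hleaf : StepSpec G g leaf) :
    StepSpec G (fun a b c d e => (60 : ℚ) • g a b c d e) (leadMin leaf) := by
  intro a b c d e s m
  unfold leadMin
  simp only [force_eq, minK_eq, eqK_eq]
  refine Run.br (fun h => ?_) fun _ => Run.abort _ _
  have h := Nat.eq_of_beq_eq_true h
  refine (isRun_lead hg hleaf _ _ _ _ _ a b c d e s m).congr ?_
  rw [← mul_add, ← mul_add, ← mul_add, ← mul_add, add_assoc, add_assoc, add_assoc, h, smul_comm]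
  rfl

/-- The indices of the letter `c` are increasing and lie between `k + 1` and `5`. -/
def Within (k c : ℕ) : Prop :=
  k < c / 16 % 16 ∧ c / 16 % 16 ≤ c % 16 ∧ c % 16 ≤ 5 ∧ c < 2048

theorem within_of_valid {c : ℕ} (h : valid c = true) : Within 0 c := by
  unfold valid at h
  simp only [br_eq, Bool.cond_false_right, Bool.and_eq_true, Nat.blt_eq] at h
  obtain ⟨h1, h2, h3, h4⟩ := h
  have h1 := Nat.le_of_ble_eq_true h1
  have h2 := Nat.le_of_ble_eq_true h2
  have h3 := Nat.le_of_ble_eq_true h3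
  exact ⟨by omega, by omega, by omega, h4⟩

theorem Within.sub {k c : ℕ} (h : Within k c) :
    (c - 17 * k) / 16 % 16 = c / 16 % 16 - k ∧ (c - 17 * k) % 16 = c % 16 - k ∧
      Within 0 (c - 17 * k) := by
  obtain ⟨h1, h2, h3, h4⟩ := h
  have hc : c - 17 * k = 256 * (c / 256) + 16 * (c / 16 % 16 - k) + (c % 16 - k) := by omega
  have hc' : (c - 17 * k) / 16 = 16 * (c / 256) + (c / 16 % 16 - k) := by omega
  have e1 : (c - 17 * k) / 16 % 16 = c / 16 % 16 - k := by omega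
  have e2 : (c - 17 * k) % 16 = c % 16 - k := by omega
  exact ⟨e1, e2, by omega, by omega, by omega, by omega⟩

theorem stepSpec_dihedral {G : ℕ → M} {g : ℕ → ℕ → ℕ → ℕ → ℕ → M}
    (hshift : ∀ k a b c d e, Within k a → Within k b → Within k c → Within k d → Within k e →
      g a b c d e = (-1 : ℚ) ^ k •
        g (a - 17 * k) (b - 17 * k) (c - 17 * k) (d - 17 * k) (e - 17 * k))
    (hflip : ∀ n a b c d e, Within 0 a → Within 0 b → Within 0 c → Within 0 d → Within 0 e →
      a % 16 < n → b % 16 < n → c % 16 < n → d % 16 < n → e % 16 < n → n ≤ 6 →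
      g a b c d e = (-1 : ℚ) ^ n • g (flip n a) (flip n b) (flip n c) (flip n d) (flip n e))
    {leaf : Step} (hleaf : StepSpec G g leaf) : StepSpec G g (dihedral leaf) := by
  intro a b c d e s m
  unfold dihedral
  simp only [force_eq, minK_eq, maxK_eq]
  refine Run.br (fun ha => Run.br (fun hb => Run.br (fun hc => Run.br (fun hd =>
    Run.br (fun he => ?_) fun _ => Run.abort _ _) fun _ => Run.abort _ _) fun _ => Run.abort _ _)
    fun _ => Run.abort _ _) fun _ => Run.abort _ _
  have ha := within_of_valid ha
  have hb := within_of_valid hb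
  have hc := within_of_valid hc
  have hd := within_of_valid hd
  have he := within_of_valid he
  obtain ⟨k, hk⟩ : ∃ k, k = Nat.pred (min (e / 16 % 16) (min (d / 16 % 16) (min (c / 16 % 16)
    (min (a / 16 % 16) (b / 16 % 16))))) := ⟨_, rfl⟩
  rw [← hk]
  rw [Nat.pred_eq_sub_one] at hk
  have within : ∀ {x}, Within 0 x → k < x / 16 % 16 → Within k x := fun h hx => ⟨hx, h.2⟩
  have ha := within ha (by have := ha.1; omega)
  have hb := within hb (by have := hb.1; omega)
  have hc := within hc (by have := hc.1; omega)
  have hd := within hd (by have := hd.1; omega)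
  have he := within he (by have := he.1; omega)
  rw [hshift k a b c d e ha hb hc hd he, smul_comm, ← mul_smul, ← sg_add]
  have ha := ha.sub.2.2
  have hb := hb.sub.2.2
  have hc := hc.sub.2.2
  have hd := hd.sub.2.2
  have he := he.sub.2.2
  generalize a - 17 * k = a at *
  generalize b - 17 * k = b at *
  generalize c - 17 * k = c at *
  generalize d - 17 * k = d at *
  generalize e - 17 * k = e at *
  generalize s + k = s
  clear hk within
  obtain ⟨z, hz⟩ : ∃ z, z = Nat.succ (max (e % 16) (max (d % 16) (max (c % 16)
    (max (a % 16) (b % 16))))) := ⟨_, rfl⟩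
  rw [← hz]
  have h1 := ha.2.2.1
  have h2 := hb.2.2.1
  have h3 := hc.2.2.1
  have h4 := hd.2.2.1
  have h5 := he.2.2.1
  have key := hflip z a b c d e ha hb hc hd he (by omega) (by omega) (by omega) (by omega)
    (by omega) (by omega)
  refine Run.br (fun heq => ?_) fun _ => Run.br (fun _ => hleaf _ _ _ _ _ _ _) fun _ => ?_
  · refine Run.br (fun _ => hleaf _ _ _ _ _ _ _) fun hz2 => (Run.pure G).congr ?_
    have hz2 := Nat.ne_of_beq_eq_false hz2
    have heq := Nat.eq_of_beq_eq_true heq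
    have lt : ∀ {x}, Within 0 x → flip z x < 65536 := by
      intro x hx
      have h1 := hx.2.2.1
      have h2 := hx.2.2.2
      unfold flip
      omega
    have la := lt ha
    have lb := lt hb
    have lc := lt hc
    have ld := lt hd
    have le := lt he
    have h1 := ha.2.2.2
    have h2 := hb.2.2.2
    have h3 := hc.2.2.2
    have h4 := hd.2.2.2
    have h5 := he.2.2.2
    simp only [enc, Nat.add_eq, Nat.mul_eq] at heq
    rw [← (by omega : a = flip z a), ← (by omega : b = flip z b), ← (by omega : c = flip z c),
      ← (by omega : d = flip z d), ← (by omega : e = flip z e),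
      (Nat.odd_iff.2 (by omega : z % 2 = 1)).neg_one_pow, neg_one_smul] at key
    rw [eq_zero_of_eq_neg key, smul_zero]
  · refine (hleaf _ _ _ _ _ _ _).congr ?_
    rw [sg_add, mul_smul, smul_comm, ← key]

end Kernel

end GrassPoly

end

noncomputable section

namespace GrassPoly

namespace Kernel

variable {M : Type*} [AddCommGroup M] [Module ℚ M]

/-- The columns of a word of brackets. -/
def cols : ℕ → ℕ → List ℕ
  | 0, _ => []
  | n + 1, w => w % 32 :: cols n (w / 32)

theorem unCols_cols (n w : ℕ) : unCols (cols n w) = w % 32 ^ n := by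
  induction n generalizing w with
  | zero => simp [cols, unCols, Nat.mod_one]
  | succ n ih =>
    change w % 32 + 32 * unCols (cols n (w / 32)) = _
    rw [ih, pow_succ', Nat.mod_mul]

/-- A function on lists of columns changes its sign if adjacent columns are exchanged. -/
def Skew (N : ℕ) (F : List ℕ → M) : Prop :=
  ∀ l₁ x y l₂, (l₁ ++ x :: y :: l₂).length = N → (∀ z ∈ l₁ ++ x :: y :: l₂, z < 32) →
    F (l₁ ++ y :: x :: l₂) = -F (l₁ ++ x :: y :: l₂)

/-- Either `v = 0` and the computation continues with `k0`, or it continues with a list of columns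
to which `F` assigns `v`. -/
def Sorted (F : List ℕ → M) (pre : List ℕ) (n : ℕ) (v : M) (K : ℕ → List ℕ → Bool) (k0 : Bool) :
    Prop :=
  (k0 = true ∧ v = 0) ∨ ∃ s l, K s l = true ∧ l.length = n ∧ (∀ z ∈ l, z < 32) ∧
    (-1 : ℚ) ^ s • F (pre ++ l) = v

theorem insCol_sorted {N : ℕ} {F : List ℕ → M} (hF : Skew N F) (x : ℕ) (hx : x < 32) (l : List ℕ)
    (hl : ∀ z ∈ l, z < 32) (pre : List ℕ) (hpre : ∀ z ∈ pre, z < 32) (s : ℕ)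
    (hN : (pre ++ x :: l).length = N) (K : ℕ → List ℕ → Bool) (k0 : Bool)
    (h : insCol x l s K k0 = true) :
    Sorted F pre (l.length + 1) ((-1 : ℚ) ^ s • F (pre ++ x :: l)) K k0 := by
  induction l generalizing pre s K with
  | nil => exact Or.inr ⟨s, [x], h, rfl, by simpa using hx, rfl⟩
  | cons y l ih =>
    change br (Nat.beq x y) k0 (br (Nat.ble x y) (K s (x :: y :: l))
      (insCol x l (Nat.succ s) (fun s' l' => K s' (y :: l')) k0)) = true at h
    have hall : ∀ z ∈ pre ++ x :: y :: l, z < 32 := by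
      intro z hz
      simp only [List.mem_append, List.mem_cons] at hz hl
      rcases hz with hz | rfl | hz
      · exact hpre z hz
      · exact hx
      · exact hl z hz
    have hswap := hF pre x y l hN hall
    cases h1 : Nat.beq x y
    · rw [h1] at h
      cases h2 : Nat.ble x y
      · rw [h2] at h
        have h : insCol x l (Nat.succ s) (fun s' l' => K s' (y :: l')) k0 = true := h
        obtain ⟨h3, h4⟩ | ⟨s', l', h3, h4, h5, h6⟩ := ih (fun z hz => hl z (by simp [hz]))
          (pre ++ [y]) (by
            intro z hz
            simp only [List.mem_append, List.mem_singleton] at hz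
            rcases hz with hz | rfl
            · exact hpre z hz
            · exact hl _ (by simp)) (s + 1) (by simpa using hN) _ h
        · refine Or.inl ⟨h3, ?_⟩
          rw [List.append_assoc, List.singleton_append, hswap, pow_succ] at h4
          simpa using h4
        · refine Or.inr ⟨s', y :: l', h3, by simpa using h4, ?_, ?_⟩
          · intro z hz
            obtain rfl | hz := List.mem_cons.1 hz
            · exact hl _ (by simp)
            · exact h5 z hz
          · rw [List.append_assoc, List.append_assoc, List.singleton_append, List.singleton_append,
              hswap, pow_succ] at h6
            simpa using h6
      · rw [h2] at h
        exact Or.inr ⟨s, x :: y :: l, h, rfl, fun z hz => hall z (by simp_all), rfl⟩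
    · rw [h1] at h
      refine Or.inl ⟨h, ?_⟩
      rw [Nat.eq_of_beq_eq_true h1] at hswap ⊢
      rw [eq_zero_of_eq_neg hswap, smul_zero]

theorem sortCols_sorted {N : ℕ} {F : List ℕ → M} (hF : Skew N F) (n w s : ℕ) (pre : List ℕ)
    (hpre : ∀ z ∈ pre, z < 32) (hN : pre.length + n = N) (K : ℕ → List ℕ → Bool) (k0 : Bool)
    (h : sortCols n w s K k0 = true) :
    Sorted F pre n ((-1 : ℚ) ^ s • F (pre ++ cols n w)) K k0 := by
  induction n generalizing w s pre K with
  | zero => exact Or.inr ⟨s, [], h, rfl, by simp, rfl⟩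
  | succ n ih =>
    have h : (force (Nat.div w 32) fun w' =>
      sortCols n w' s (fun s' l' => force (Nat.mod w 32) fun x => force s' fun s' =>
        insCol x l' s' K k0) k0) = true := h
    rw [force_eq] at h
    obtain ⟨h1, h2⟩ | ⟨s', l', h1, h2, h3, h4⟩ := ih _ s (pre ++ [w % 32]) (by
      intro z hz
      simp only [List.mem_append, List.mem_singleton] at hz
      rcases hz with hz | rfl
      · exact hpre z hz
      · omega) (by simp; omega) _ h
    · refine Or.inl ⟨h1, ?_⟩
      rw [List.append_assoc] at h2
      exact h2
    · beta_reduce at h1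
      rw [force_eq, force_eq] at h1
      have := insCol_sorted hF (w % 32) (by omega) l' h3 pre hpre s' (by simp; omega) K k0 h1
      rw [h2] at this
      rw [List.append_assoc, List.append_assoc] at h4
      rw [show (-1 : ℚ) ^ s • F (pre ++ cols (n + 1) w) = _ from h4.symm]
      exact this

theorem testBit_unCols (l : List ℕ) (hl : ∀ z ∈ l, z < 32) (v j : ℕ) (hj : j < 5) :
    (unCols l).testBit (5 * v + j) = (l.getD v 0).testBit j := by
  induction l generalizing v with
  | nil => simp [unCols]
  | cons x l ih =>
    rw [show unCols (x :: l) = 2 ^ 5 * unCols l + x from Nat.add_comm _ _,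
      Nat.testBit_two_pow_mul_add _ (hl x (by simp))]
    cases v with
    | zero => simp [hj]
    | succ v =>
      rw [if_neg (by omega), show 5 * (v + 1) + j - 5 = 5 * v + j by omega,
        ih (fun z hz => hl z (by simp [hz]))]
      simp

theorem testBit_fstMask (i : ℕ) : fstMask.testBit i = decide (i % 5 = 0 ∧ i < 50) := by
  by_cases h : i < 50
  · have : ∀ i < 50, fstMask.testBit i = decide (i % 5 = 0 ∧ i < 50) := by decide +kernel
    exact this i h
  · rw [Nat.testBit_lt_two_pow (lt_of_lt_of_le (by decide : fstMask < 2 ^ 50)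
      (Nat.pow_le_pow_right (by norm_num) (by omega)))]
    simp [h]

/-- The word of brackets with the given letters. -/
def woven (a b c d e : ℕ) : ℕ :=
  Nat.lor (Nat.land a fstMask) (Nat.lor (Nat.mul 2 (Nat.land b fstMask))
    (Nat.lor (Nat.mul 4 (Nat.land c fstMask)) (Nat.lor (Nat.mul 8 (Nat.land d fstMask))
      (Nat.mul 16 (Nat.land e fstMask)))))

theorem testBit_woven (a b c d e i : ℕ) : (woven a b c d e).testBit i =
    ((a &&& fstMask).testBit i || ((decide (i ≥ 1) && (b &&& fstMask).testBit (i - 1)) ||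
      ((decide (i ≥ 2) && (c &&& fstMask).testBit (i - 2)) ||
        ((decide (i ≥ 3) && (d &&& fstMask).testBit (i - 3)) ||
          (decide (i ≥ 4) && (e &&& fstMask).testBit (i - 4)))))) := by
  change ((a &&& fstMask) ||| (2 ^ 1 * (b &&& fstMask) ||| (2 ^ 2 * (c &&& fstMask) |||
    (2 ^ 3 * (d &&& fstMask) ||| 2 ^ 4 * (e &&& fstMask))))).testBit i = _
  simp only [Nat.testBit_or, Nat.testBit_two_pow_mul]

omit [AddCommGroup M] [Module ℚ M] in
theorem unwoven_woven (g : ℕ → ℕ → ℕ → ℕ → ℕ → M) (a b c d e : ℕ) :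
    unwoven g (woven a b c d e) = g (Nat.land a fstMask) (Nat.land b fstMask)
      (Nat.land c fstMask) (Nat.land d fstMask) (Nat.land e fstMask) := by
  unfold unwoven
  have key : ∀ j x, (∀ i, i % 5 = 0 → i < 50 → (woven a b c d e).testBit (i + j) = x.testBit i) →
      Nat.land (Nat.div (woven a b c d e) (2 ^ j)) fstMask = Nat.land x fstMask := by
    intro j x h
    change woven a b c d e / 2 ^ j &&& fstMask = x &&& fstMask
    refine Nat.eq_of_testBit_eq fun i => ?_
    rw [Nat.testBit_and, Nat.testBit_and, Nat.testBit_div_two_pow, testBit_fstMask]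
    by_cases hi : i % 5 = 0 ∧ i < 50
    · rw [h i hi.1 hi.2]
    · simp [hi]
  have hbit : ∀ i, i % 5 = 0 → i < 50 → (woven a b c d e).testBit i = a.testBit i ∧
      (woven a b c d e).testBit (i + 1) = b.testBit i ∧
      (woven a b c d e).testBit (i + 2) = c.testBit i ∧
      (woven a b c d e).testBit (i + 3) = d.testBit i ∧
      (woven a b c d e).testBit (i + 4) = e.testBit i := by
    intro i h1 h2
    obtain ⟨v, rfl⟩ := Nat.dvd_of_mod_eq_zero h1
    have hv : v < 10 := by omega
    clear h1 h2 key
    simp only [testBit_woven, Nat.testBit_and, testBit_fstMask]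
    interval_cases v <;> simp
  rw [← key 0 a fun i h1 h2 => (hbit i h1 h2).1, ← key 1 b fun i h1 h2 => (hbit i h1 h2).2.1,
    ← key 2 c fun i h1 h2 => (hbit i h1 h2).2.2.1, ← key 3 d fun i h1 h2 => (hbit i h1 h2).2.2.2.1,
    ← key 4 e fun i h1 h2 => (hbit i h1 h2).2.2.2.2]
  rw [show (woven a b c d e).div (2 ^ 0) = woven a b c d e from Nat.div_one _]
  rfl

theorem woven_lt (a b c d e : ℕ) : woven a b c d e < 32 ^ 10 := by
  refine Nat.lt_pow_two_of_testBit (n := 50) _ fun i hi => ?_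
  simp only [testBit_woven, Nat.testBit_and, testBit_fstMask]
  have h0 : ¬(i % 5 = 0 ∧ i < 50) := by omega
  have h1 : ¬((i - 1) % 5 = 0 ∧ i - 1 < 50) := by omega
  have h2 : ¬((i - 2) % 5 = 0 ∧ i - 2 < 50) := by omega
  have h3 : ¬((i - 3) % 5 = 0 ∧ i - 3 < 50) := by omega
  have h4 : ¬((i - 4) % 5 = 0 ∧ i - 4 < 50) := by omega
  simp [h0, h1, h2, h3, h4]

theorem stepSpec_brackets {g : ℕ → ℕ → ℕ → ℕ → ℕ → M}
    (hmask : ∀ a b c d e, g (Nat.land a fstMask) (Nat.land b fstMask) (Nat.land c fstMask)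
      (Nat.land d fstMask) (Nat.land e fstMask) = g a b c d e)
    (hskew : Skew 10 fun l => unwoven g (unCols l)) : StepSpec (unwoven g) g brackets := by
  intro a b c d e s m t K h
  have h : (force (woven a b c d e) fun w => sortCols 10 w s
      (fun s l => force (unCols l) fun h => force (Nat.mod h 10007) fun x => ins x h s m t K)
        (K t)) = true := h
  rw [force_eq] at h
  have hw : unwoven g (unCols ([] ++ cols 10 (woven a b c d e))) = g a b c d e := by
    rw [List.nil_append, unCols_cols, Nat.mod_eq_of_lt (woven_lt a b c d e), unwoven_woven, hmask]
  obtain ⟨h1, h2⟩ | ⟨s', l, h1, -, -, h4⟩ :=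
    sortCols_sorted hskew 10 (woven a b c d e) s [] (by simp) rfl _ _ h
  · refine ⟨t, ?_, h1⟩
    have h2 : (-1 : ℚ) ^ s • g a b c d e = 0 := by rw [← hw]; exact h2
    rw [sg, mul_comm, mul_smul, h2]
    simp
  · beta_reduce at h1
    rw [force_eq, force_eq] at h1
    obtain ⟨t', h5, h6⟩ := isRun_ins (unwoven g) _ _ _ _ _ _ h1
    refine ⟨t', ?_, h6⟩
    have h4 : (-1 : ℚ) ^ s' • unwoven g (unCols l) = (-1 : ℚ) ^ s • g a b c d e := by
      rw [← hw]; exact h4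
    rw [h5, sg, sg, mul_comm, mul_smul, h4, mul_comm, mul_smul]

end Kernel

end GrassPoly

end

noncomputable section

namespace GrassPoly

namespace Kernel

variable {V M : Type*} [AddCommGroup V] [Module ℚ V] [AddCommGroup M] [Module ℚ M]

/-- The function `q` on letters with the given values. -/
def onLetters (q : V → V → V → V → V → M) (val : ℕ → V) (a b c d e : ℕ) : M :=
  q (val a) (val b) (val c) (val d) (val e)

theorem Alternating.smul {Fix : ℕ → V → Prop} {q : V → V → V → V → V → M} (hq : Alternating Fix q)
    (r : ℚ) : Alternating Fix fun a b c d e => r • q a b c d e where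
  lin1 b c d e := (r • (hq.lin1 b c d e).mk').isLinear
  lin2 a c d e := (r • (hq.lin2 a c d e).mk').isLinear
  lin3 a b d e := (r • (hq.lin3 a b d e).mk').isLinear
  lin4 a b c e := (r • (hq.lin4 a b c e).mk').isLinear
  lin5 a b c d := (r • (hq.lin5 a b c d).mk').isLinear
  fixed p a b c d e ha hb hc hd he := by rw [hq.fixed p a b c d e ha hb hc hd he, smul_zero]

theorem sum_baseWords (hV : verify = true) {Fix : ℕ → V → Prop} {valF valS valC valB : ℕ → V}
    {q : V → V → V → V → V → M} (hq : Alternating Fix q)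
    (hF : TabSpec Fix valF valS tabF) (hS : TabSpec Fix valS valC tabS)
    (hP : TabSpec Fix valC valC tabP) (hB : TabSpec Fix valC valB tabB)
    (hlead : ∀ val, Leads (onLetters q val))
    (hodd : ∀ a b c d e, (oddN a + (oddN b + (oddN c + (oddN d + oddN e)))) % 2 = 0 →
      onLetters q valS a b c d e = 0)
    (hshift : ∀ k a b c d e, Within k a → Within k b → Within k c → Within k d → Within k e →
      onLetters q valC a b c d e = (-1 : ℚ) ^ k • onLetters q valC (a - 17 * k) (b - 17 * k)
        (c - 17 * k) (d - 17 * k) (e - 17 * k))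
    (hflip : ∀ n a b c d e, Within 0 a → Within 0 b → Within 0 c → Within 0 d → Within 0 e →
      a % 16 < n → b % 16 < n → c % 16 < n → d % 16 < n → e % 16 < n → n ≤ 6 →
      onLetters q valC a b c d e = (-1 : ℚ) ^ n • onLetters q valC (flip n a) (flip n b)
        (flip n c) (flip n d) (flip n e))
    (hmask : ∀ a b c d e, onLetters q valB (Nat.land a fstMask) (Nat.land b fstMask)
      (Nat.land c fstMask) (Nat.land d fstMask) (Nat.land e fstMask) = onLetters q valB a b c d e)
    (hskew : Skew 10 fun l => unwoven (onLetters q valB) (unCols l)) :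
    (10 : ℚ) • (baseWords.map fun w => sg w.s w.m • onLetters q valF w.a w.b w.c w.d w.e).sum +
      (14400 : ℚ) • onLetters q valB 1082401 34636832 1108378624 35468115968 1134979710976 = 0 := by
  unfold verify at hV
  obtain ⟨t0, e0, hV⟩ := isRun_foldWords (stepSpec_expand hF (hq.smul 10)
    (stepSpec_leadOdd (hlead valS) hodd (stepSpec_insWord _))) baseWords _ _ hV
  obtain ⟨t1, e1, hV⟩ := isRun_foldTr (stepSpec_expand hS hq (stepSpec_insWord _)) t0 _ _ hV
  obtain ⟨t2, e2, hV⟩ := isRun_foldTr (stepSpec_dihedral hshift hflip (stepSpec_insWord _)) t1 _ _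
      hV
  obtain ⟨t3, e3, hV⟩ := isRun_foldTr (stepSpec_expand hP hq
    (stepSpec_dihedral hshift hflip (stepSpec_insWord _))) t2 _ _ hV
  obtain ⟨t', e', hV⟩ := stepSpec_brackets hmask hskew 1082401 34636832 1108378624 35468115968
    1134979710976 0 14400 .nil _ hV
  obtain ⟨t4, e4, hV⟩ := isRun_foldTr (stepSpec_expand hB hq (stepSpec_brackets hmask hskew))
    t3 _ _ hV
  obtain ⟨t5, e5, hV⟩ := isRun_foldBr (stepSpec_leadMin (hlead valB)
    (stepSpec_brackets hmask hskew)) t4 _ _ hV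
  have hz := sem_eq_zero_of_vanishes (unwoven (onLetters q valB)) hV
  have h60 : ∀ t, sem (unwoven fun a b c d e => (60 : ℚ) • onLetters q valB a b c d e) t =
      (60 : ℚ) • sem (unwoven (onLetters q valB)) t := by
    intro t
    induction t with
    | nil => simp [sem]
    | node l x h p n r ihl ihr =>
      simp only [sem, ihl, ihr, unwoven, smul_add]
      rw [smul_comm]
  simp only [sem, zero_add] at e0 e1 e2 e3 e' e5
  replace e1 : sem (decoded (onLetters q valC)) t1 = sem (decoded (onLetters q valS)) t0 := e1
  replace e3 : sem (decoded (onLetters q valC)) t3 = sem (decoded (onLetters q valC)) t2 := e3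
  replace e4 : sem (unwoven (onLetters q valB)) t4 = sem (unwoven (onLetters q valB)) t' +
    sem (decoded (onLetters q valC)) t3 := e4
  rw [hz, h60, eq_comm, smul_eq_zero_iff_right (by norm_num), e4, e', e3, e2, e1, e0] at e5
  rw [List.smul_sum, List.map_map, add_comm]
  refine Eq.trans ?_ e5
  exact congrArg₂ (· + ·) (by simp [sg])
    (congrArg List.sum (List.map_congr_left fun w _ => smul_comm _ _ _))

end Kernel

end GrassPoly

end

noncomputable section

namespace GrassPoly

theorem Kernel.good_verify : Kernel.Good Kernel.verify := by
  decide +kernel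

end GrassPoly

end

noncomputable section

namespace GrassPoly

variable {F : Type} [Field F]

theorem cls_of_ne_zero {a : F} (h : a ≠ 0) :
    cls a = (1 : ℚ) ⊗ₜ[ℤ] (Additive.ofMul (Units.mk0 a h)) := dif_neg h

theorem cls_mul {a b : F} (ha : a ≠ 0) (hb : b ≠ 0) : cls (a * b) = cls a + cls b := by
  rw [cls_of_ne_zero ha, cls_of_ne_zero hb, cls_of_ne_zero (mul_ne_zero ha hb), Units.mk0_mul,
    ofMul_mul, TensorProduct.tmul_add]

theorem cls_one : cls (1 : F) = 0 := by
  have h := cls_mul (one_ne_zero (α := F)) one_ne_zero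
  rw [one_mul] at h
  exact left_eq_add.1 h

theorem cls_inv (a : F) : cls a⁻¹ = -cls a := by
  by_cases ha : a = 0
  · simp [ha, cls]
  · have h := cls_mul ha (inv_ne_zero ha)
    rw [mul_inv_cancel₀ ha, cls_one] at h
    exact (neg_eq_of_add_eq_zero_right h.symm).symm

theorem cls_div {a b : F} (ha : a ≠ 0) (hb : b ≠ 0) : cls (a / b) = cls a - cls b := by
  rw [div_eq_mul_inv, cls_mul ha (inv_ne_zero hb), cls_inv, sub_eq_add_neg]

theorem cls_neg (a : F) : cls (-a) = cls a := by
  by_cases ha : a = 0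
  · simp [ha]
  · have h1 : cls (-1 : F) = 0 := by
      have h := cls_mul (neg_ne_zero.2 (one_ne_zero (α := F))) (neg_ne_zero.2 one_ne_zero)
      rw [neg_mul_neg, one_mul, cls_one] at h
      have h2 : (2 : ℚ) • cls (-1 : F) = 0 := by rw [two_smul, ← h]
      simpa using h2
    rw [neg_eq_neg_one_mul, cls_mul (neg_ne_zero.2 one_ne_zero) ha, h1, zero_add]

theorem cls_sub_comm (a b : F) : cls (a - b) = cls (b - a) := by
  rw [← cls_neg, neg_sub]

theorem vmap_cls (φ : F ≃+* F) (a : F) : vmap φ (cls a) = cls (φ a) := by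
  by_cases ha : a = 0
  · simp [ha, cls]
  · rw [cls_of_ne_zero ha, cls_of_ne_zero ((map_ne_zero φ).2 ha)]
    simp only [vmap, TensorProduct.AlgebraTensorModule.map_tmul, LinearMap.id_apply]
    congr 1
    exact congrArg Additive.ofMul (Units.ext rfl)

theorem snoc_tprod {n : ℕ} (v : Fin n → VF F) (x : VF F) :
    snoc (tprod ℚ v : TP F n) x = (tprod ℚ (Fin.snoc (α := fun _ => VF F) v x) : TP F (n + 1)) := by
  simp [snoc]

theorem splitLast_tprod {n : ℕ} (v : Fin (n + 1) → VF F) :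
    splitLast n (tprod ℚ v : TP F (n + 1)) =
      (tprod ℚ (Fin.init (α := fun _ => VF F) v) : TP F n) ⊗ₜ[ℚ] v (Fin.last n) := by
  simp only [splitLast, LinearEquiv.trans_apply, reindex_tprod, tmulEquiv_symm_apply,
    TensorProduct.congr_tmul, LinearEquiv.refl_apply, subsingletonEquiv_apply_tprod,
    Equiv.symm_symm, finSumFinEquiv_apply_left, finSumFinEquiv_apply_right]
  rfl

theorem splitLast_symm_tmul {n : ℕ} (t : TP F n) (x : VF F) :
    (splitLast n).symm (t ⊗ₜ[ℚ] x) = snoc t x := by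
  rw [LinearEquiv.symm_apply_eq]
  induction t using PiTensorProduct.induction_on with
  | smul_tprod r v =>
    rw [← TensorProduct.smul_tmul', LinearMap.map_smul, LinearMap.smul_apply, LinearEquiv.map_smul,
      snoc_tprod, splitLast_tprod, Fin.init_snoc, Fin.snoc_last]
  | add t u ht hu => rw [TensorProduct.add_tmul, map_add, LinearMap.add_apply, map_add, ht, hu]

theorem rotN_tprod {n : ℕ} (v : Fin (n + 1) → VF F) :
    rotN (n + 1) (tprod ℚ v : TP F (n + 1)) =
      (tprod ℚ (Fin.snoc (α := fun _ => VF F) (Fin.tail v) (v 0)) : TP F (n + 1)) := by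
  simp only [rotN, reindex_tprod, Equiv.symm_symm]
  congr 1
  ext i
  refine Fin.lastCases ?_ (fun j => ?_) i
  · simp
  · simp [Fin.tail]

theorem Pit_tprod {n : ℕ} (v : Fin (n + 2) → VF F) :
    Pit (n + 2) (tprod ℚ v : TP F (n + 2)) =
      snoc (Pit (n + 1) (tprod ℚ (Fin.init (α := fun _ => VF F) v) : TP F (n + 1)))
        (v (Fin.last (n + 1))) -
      snoc (Pit (n + 1) (tprod ℚ (Fin.tail v) : TP F (n + 1))) (v 0) := by
  simp only [Pit, LinearMap.comp_apply, LinearMap.sub_apply, LinearMap.id_apply,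
    LinearEquiv.coe_coe, rotN_tprod, map_sub, splitLast_tprod, TensorProduct.map_tmul,
    splitLast_symm_tmul, Fin.init_snoc, Fin.snoc_last]

/-- A pure tensor, with its length determined by the type of the vector. -/
def tens {n : ℕ} (v : Fin n → VF F) : TP F n := tprod ℚ v

theorem snoc_tens1 (a x : VF F) : snoc (tens ![a]) x = tens ![a, x] := by
  rw [tens, snoc_tprod]
  congr 1
  ext i
  fin_cases i <;> rfl

theorem snoc_tens2 (a b x : VF F) :
    snoc (tens ![a, b]) x = tens ![a, b, x] := by
  rw [tens, snoc_tprod]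
  congr 1
  ext i
  fin_cases i <;> rfl

theorem snoc_tens3 (a b c x : VF F) :
    snoc (tens ![a, b, c]) x = tens ![a, b, c, x] := by
  rw [tens, snoc_tprod]
  congr 1
  ext i
  fin_cases i <;> rfl

theorem snoc_tens4 (a b c d x : VF F) :
    snoc (tens ![a, b, c, d]) x = tens ![a, b, c, d, x] := by
  rw [tens, snoc_tprod]
  congr 1
  ext i
  fin_cases i <;> rfl

theorem Pit_tens2 (a b : VF F) :
    Pit 2 (tens ![a, b]) =
      tens ![a, b] - tens ![b, a] := by
  have h : Pit 2 (tens ![a, b]) = snoc (Pit 1 (tens ![a])) b -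
      snoc (Pit 1 (tens ![b])) a := by
    have h₀ : Fin.init (α := fun _ => VF F) ![a, b] = ![a] := by
      ext i
      fin_cases i
      rfl
    rw [tens, Pit_tprod, h₀]
    rfl
  rw [h]
  simp only [Pit, LinearMap.id_apply, snoc_tens1]

theorem Pit_tens3 (a b c : VF F) :
    Pit 3 (tens ![a, b, c]) =
      tens ![a, b, c] - tens ![b, a, c] - tens ![b, c, a] + tens ![c, b, a] := by
  have h : Pit 3 (tens ![a, b, c]) = snoc (Pit 2 (tens ![a, b])) c -
      snoc (Pit 2 (tens ![b, c])) a := by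
    have h₀ : Fin.init (α := fun _ => VF F) ![a, b, c] = ![a, b] := by
      ext i
      fin_cases i <;> rfl
    rw [tens, Pit_tprod, h₀]
    rfl
  rw [h, Pit_tens2, Pit_tens2]
  simp only [map_sub, LinearMap.sub_apply, snoc_tens2]
  abel

theorem Pit_tens4 (a b c d : VF F) :
    Pit 4 (tens ![a, b, c, d]) =
      tens ![a, b, c, d] - tens ![b, a, c, d] - tens ![b, c, a, d] + tens ![c, b, a, d] - tens
      ![b, c, d, a] + tens ![c, b, d, a] + tens ![c, d, b, a] - tens ![d, c, b, a] := by
  have h : Pit 4 (tens ![a, b, c, d]) = snoc (Pit 3 (tens ![a, b, c])) d -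
      snoc (Pit 3 (tens ![b, c, d])) a := by
    have h₀ : Fin.init (α := fun _ => VF F) ![a, b, c, d] = ![a, b, c] := by
      ext i
      fin_cases i <;> rfl
    rw [tens, Pit_tprod, h₀]
    rfl
  rw [h, Pit_tens3, Pit_tens3]
  simp only [map_add, map_sub, LinearMap.add_apply, LinearMap.sub_apply, snoc_tens3]
  abel

theorem Pit_tens5 (a b c d e : VF F) :
    Pit 5 (tens ![a, b, c, d, e]) =
      tens ![a, b, c, d, e] - tens ![b, a, c, d, e] - tens ![b, c, a, d, e] + tens ![c, b, a, d,
      e] - tens ![b, c, d, a, e] + tens ![c, b, d, a, e] + tens ![c, d, b, a, e] - tens ![d, c,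
      b, a, e] - tens ![b, c, d, e, a] + tens ![c, b, d, e, a] + tens ![c, d, b, e, a] - tens
      ![d, c, b, e, a] + tens ![c, d, e, b, a] - tens ![d, c, e, b, a] - tens ![d, e, c, b, a] +
      tens ![e, d, c, b, a] := by
  have h : Pit 5 (tens ![a, b, c, d, e]) = snoc (Pit 4 (tens ![a, b, c, d])) e -
      snoc (Pit 4 (tens ![b, c, d, e])) a := by
    have h₀ : Fin.init (α := fun _ => VF F) ![a, b, c, d, e] = ![a, b, c, d] := by
      ext i
      fin_cases i <;> rfl
    rw [tens, Pit_tprod, h₀]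
    rfl
  rw [h, Pit_tens4, Pit_tens4]
  simp only [map_add, map_sub, LinearMap.add_apply, LinearMap.sub_apply, snoc_tens4]
  abel

end GrassPoly

end

noncomputable section

namespace GrassPoly

theorem tpMap_tens {F : Type} [Field F] (φ : F ≃+* F) (a b c d e : VF F) :
    tpMap φ (tens ![a, b, c, d, e]) =
      tens ![vmap φ a, vmap φ b, vmap φ c, vmap φ d, vmap φ e] := by
  rw [tens, tpMap, map_tprod]
  congr 1
  ext i
  fin_cases i <;> rfl

theorem Pit_tpMap {F : Type} [Field F] (φ : F ≃+* F) (x : TP F 5) :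
    Pit 5 (tpMap φ x) = tpMap φ (Pit 5 x) := by
  induction x using PiTensorProduct.induction_on with
  | smul_tprod r v =>
    have hv : (tprod ℚ v : TP F 5) = tens ![v 0, v 1, v 2, v 3, v 4] := by
      rw [tens]
      congr 1
      ext i
      fin_cases i <;> rfl
    simp only [map_smul, hv, tpMap_tens, Pit_tens5, map_add, map_sub]
  | add t u ht hu => simp only [map_add, ht, hu]

variable {N m : ℕ}

theorem permAut_gen (σ : Equiv.Perm (Fin N)) (i : Fin N) (j : Fin m) :
    permAut N m σ (gen N m i j) = gen N m (σ i) j := by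
  simp [permAut, gen]

theorem permAut_dets (σ : Equiv.Perm (Fin N)) (v : Fin m → Fin N) :
    permAut N m σ (dets N m v) = dets N m (σ ∘ v) := by
  rw [dets, RingEquiv.map_det]
  congr 1
  ext i j
  simp [permAut_gen]

theorem permAut_mul (σ τ : Equiv.Perm (Fin N)) (x : FF N m) :
    permAut N m (σ * τ) x = permAut N m σ (permAut N m τ x) := by
  have h : (permAut N m (σ * τ) : FF N m →+* FF N m) =
      (permAut N m σ : FF N m →+* FF N m).comp (permAut N m τ : FF N m →+* FF N m) := by
    refine IsLocalization.ringHom_ext (nonZeroDivisors (Pol N m)) ?_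
    refine MvPolynomial.ringHom_ext (fun r => ?_) fun p => ?_
    · simp [permAut]
    · refine (permAut_gen _ _ _).trans ?_
      exact ((congrArg (permAut N m σ) (permAut_gen τ p.1 p.2)).trans (permAut_gen _ _ _)).symm
  exact RingHom.congr_fun h x

theorem vmap_mul (σ τ : Equiv.Perm (Fin N)) (x : VF (FF N m)) :
    vmap (permAut N m (σ * τ)) x = vmap (permAut N m σ) (vmap (permAut N m τ) x) := by
  induction x using TensorProduct.induction_on with
  | zero => simp
  | tmul r a =>
    simp only [vmap, TensorProduct.AlgebraTensorModule.map_tmul, LinearMap.id_apply]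
    congr 1
    exact congrArg Additive.ofMul (Units.ext (permAut_mul σ τ _))
  | add a b ha hb => simp only [map_add, ha, hb]

theorem tpMap_mul {n : ℕ} (σ τ : Equiv.Perm (Fin N)) (x : TP (FF N m) n) :
    tpMap (permAut N m (σ * τ)) x = tpMap (permAut N m σ) (tpMap (permAut N m τ) x) := by
  induction x using PiTensorProduct.induction_on with
  | smul_tprod r v => simp only [map_smul, tpMap, map_tprod, vmap_mul]
  | add t u ht hu => simp only [map_add, ht, hu]

/-- Skew-symmetrization as a linear map. -/
def AltL (N m n : ℕ) : TP (FF N m) n →ₗ[ℚ] TP (FF N m) n :=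
  ∑ σ : Equiv.Perm (Fin N), (((Equiv.Perm.sign σ : ℤˣ) : ℤ) : ℚ) • tpMap (permAut N m σ)

theorem AltL_apply {n : ℕ} (x : TP (FF N m) n) : AltL N m n x = Alt x := by
  simp [AltL, Alt]

theorem Alt_tpMap {n : ℕ} (τ : Equiv.Perm (Fin N)) (x : TP (FF N m) n) :
    Alt (tpMap (permAut N m τ) x) = (((Equiv.Perm.sign τ : ℤˣ) : ℤ) : ℚ) • Alt x := by
  rw [Alt, Alt, Finset.smul_sum]
  refine Fintype.sum_equiv (Equiv.mulRight τ) _ _ fun σ => ?_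
  rw [Equiv.coe_mulRight, tpMap_mul, smul_smul, Equiv.Perm.sign_mul, mul_comm (Equiv.Perm.sign σ),
    Units.val_mul, Int.cast_mul, ← mul_assoc, ← Int.cast_mul, ← Units.val_mul,
    Int.units_mul_self, Units.val_one, Int.cast_one, one_mul]

/-- The skew-symmetrization of a word modulo products, as a linear map. -/
def altPit : TP (FF N m) 5 →ₗ[ℚ] TP (FF N m) 5 := AltL N m 5 ∘ₗ Pit 5

theorem altPit_apply (x : TP (FF N m) 5) : altPit x = Alt (Pit 5 x) := by
  rw [altPit, LinearMap.comp_apply, AltL_apply]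

/-- The skew-symmetrization of a word of length five modulo products. -/
def aword (a b c d e : VF (FF N m)) : TP (FF N m) 5 := altPit (tens ![a, b, c, d, e])

theorem aword_vmap (σ : Equiv.Perm (Fin N)) (a b c d e : VF (FF N m)) :
    aword (vmap (permAut N m σ) a) (vmap (permAut N m σ) b) (vmap (permAut N m σ) c)
      (vmap (permAut N m σ) d) (vmap (permAut N m σ) e) =
      (((Equiv.Perm.sign σ : ℤˣ) : ℤ) : ℚ) • aword a b c d e := by
  rw [aword, ← tpMap_tens, altPit_apply, Pit_tpMap, Alt_tpMap, aword, altPit_apply]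

theorem aword_odd {σ : Equiv.Perm (Fin N)} (hσ : Equiv.Perm.sign σ = -1)
    (a b c d e : VF (FF N m)) :
    aword (vmap (permAut N m σ) a) (vmap (permAut N m σ) b) (vmap (permAut N m σ) c)
      (vmap (permAut N m σ) d) (vmap (permAut N m σ) e) = -aword a b c d e := by
  simp [aword_vmap, hσ]

theorem aword_even {σ : Equiv.Perm (Fin N)} (hσ : Equiv.Perm.sign σ = 1)
    (a b c d e : VF (FF N m)) :
    aword (vmap (permAut N m σ) a) (vmap (permAut N m σ) b) (vmap (permAut N m σ) c)
      (vmap (permAut N m σ) d) (vmap (permAut N m σ) e) = aword a b c d e := by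
  simp [aword_vmap, hσ]

theorem aword_eq_zero_of_fixed (σ : Equiv.Perm (Fin N)) (hσ : Equiv.Perm.sign σ = -1)
    {a b c d e : VF (FF N m)} (ha : vmap (permAut N m σ) a = a) (hb : vmap (permAut N m σ) b = b)
    (hc : vmap (permAut N m σ) c = c) (hd : vmap (permAut N m σ) d = d)
    (he : vmap (permAut N m σ) e = e) : aword a b c d e = 0 := by
  have h := aword_odd hσ a b c d e
  rw [ha, hb, hc, hd, he] at h
  have h₂ : (2 : ℚ) • aword a b c d e = 0 := by
    rw [two_smul]
    exact eq_neg_iff_add_eq_zero.1 h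
  simpa using h₂

theorem tens_linear {n : ℕ} {F : Type} [Field F] (v : Fin n → VF F) (i : Fin n) :
    IsLinearMap ℚ fun x => tens (Function.update v i x) :=
  ((tprod ℚ (s := fun _ : Fin n => VF F)).toLinearMap v i).isLinear

theorem aword_linear1 (b c d e : VF (FF N m)) :
    IsLinearMap ℚ fun x => aword x b c d e := by
  have h := tens_linear ![0, b, c, d, e] 0
  have h₂ := fun x : VF (FF N m) =>
    show Function.update ![0, b, c, d, e] 0 x = ![x, b, c, d, e] by
      ext i
      fin_cases i <;> rfl
  simp only [h₂] at h
  exact (altPit ∘ₗ h.mk' _).isLinear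

theorem aword_linear2 (a c d e : VF (FF N m)) :
    IsLinearMap ℚ fun x => aword a x c d e := by
  have h := tens_linear ![a, 0, c, d, e] 1
  have h₂ := fun x : VF (FF N m) =>
    show Function.update ![a, 0, c, d, e] 1 x = ![a, x, c, d, e] by
      ext i
      fin_cases i <;> rfl
  simp only [h₂] at h
  exact (altPit ∘ₗ h.mk' _).isLinear

theorem aword_linear3 (a b d e : VF (FF N m)) :
    IsLinearMap ℚ fun x => aword a b x d e := by
  have h := tens_linear ![a, b, 0, d, e] 2
  have h₂ := fun x : VF (FF N m) =>
    show Function.update ![a, b, 0, d, e] 2 x = ![a, b, x, d, e] by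
      ext i
      fin_cases i <;> rfl
  simp only [h₂] at h
  exact (altPit ∘ₗ h.mk' _).isLinear

theorem aword_linear4 (a b c e : VF (FF N m)) :
    IsLinearMap ℚ fun x => aword a b c x e := by
  have h := tens_linear ![a, b, c, 0, e] 3
  have h₂ := fun x : VF (FF N m) =>
    show Function.update ![a, b, c, 0, e] 3 x = ![a, b, c, x, e] by
      ext i
      fin_cases i <;> rfl
  simp only [h₂] at h
  exact (altPit ∘ₗ h.mk' _).isLinear

theorem aword_linear5 (a b c d : VF (FF N m)) :
    IsLinearMap ℚ fun x => aword a b c d x := by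
  have h := tens_linear ![a, b, c, d, 0] 4
  have h₂ := fun x : VF (FF N m) =>
    show Function.update ![a, b, c, d, 0] 4 x = ![a, b, c, d, x] by
      ext i
      fin_cases i <;> rfl
  simp only [h₂] at h
  exact (altPit ∘ₗ h.mk' _).isLinear

theorem leads_aword (val : ℕ → VF (FF N m)) : Kernel.Leads (Kernel.onLetters aword val) where
  two a b c d e := by
    simp only [Kernel.onLetters, aword, altPit_apply, Pit_tens5, ← AltL_apply, map_add, map_sub]
    abel
  three a b c d e := by
    simp only [Kernel.onLetters, aword, altPit_apply, Pit_tens5, ← AltL_apply, map_add, map_sub]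
    abel
  four a b c d e := by
    simp only [Kernel.onLetters, aword, altPit_apply, Pit_tens5, ← AltL_apply, map_add, map_sub]
    abel
  five a b c d e := by
    simp only [Kernel.onLetters, aword, altPit_apply, Pit_tens5, ← AltL_apply, map_add, map_sub]
    abel

/-- The swap number `p = 10 i + j` of two of the vectors fixes the class `v`. -/
def SwapFixes (p : ℕ) (v : VF K5) : Prop :=
  ∃ i j : Fin 10, p = 10 * i + j ∧ i ≠ j ∧ vmap (permAut 10 5 (Equiv.swap i j)) v = v

theorem SwapFixes.vmap_eq {i j : Fin 10} {v : VF K5} (h : SwapFixes (10 * i + j) v) :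
    vmap (permAut 10 5 (Equiv.swap i j)) v = v := by
  obtain ⟨i', j', hp, -, hv⟩ := h
  have hi : i = i' := Fin.ext (by omega)
  have hj : j = j' := Fin.ext (by omega)
  rwa [hi, hj]

theorem alternating_aword : Kernel.Alternating SwapFixes aword where
  lin1 := aword_linear1
  lin2 := aword_linear2
  lin3 := aword_linear3
  lin4 := aword_linear4
  lin5 := aword_linear5
  fixed p a b c d e ha hb hc hd he := by
    obtain ⟨i, j, rfl, hij, ha⟩ := ha
    exact aword_eq_zero_of_fixed _ (Equiv.Perm.sign_swap hij) ha hb.vmap_eq hc.vmap_eq hd.vmap_eq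
      he.vmap_eq

end GrassPoly

end

noncomputable section

namespace GrassPoly

section Brackets

variable {N m : ℕ}

theorem dets_comp_perm (v : Fin m → Fin N) (τ : Equiv.Perm (Fin m)) :
    dets N m (v ∘ τ) = (((Equiv.Perm.sign τ : ℤˣ) : ℤ) : FF N m) * dets N m v := by
  rw [dets, dets]
  exact Matrix.det_permute' τ (Matrix.of fun r c => gen N m (v c) r)

theorem cls_dets_comp_perm (v : Fin m → Fin N) (τ : Equiv.Perm (Fin m)) :
    cls (dets N m (v ∘ τ)) = cls (dets N m v) := by
  rw [dets_comp_perm]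
  rcases Int.units_eq_one_or (Equiv.Perm.sign τ) with h | h <;> simp [h, cls_neg]

theorem cls_dets_of_range_eq {v w : Fin m → Fin N} (hv : Function.Injective v)
    (hw : Function.Injective w) (h : Set.range v = Set.range w) :
    cls (dets N m v) = cls (dets N m w) := by
  let τ : Equiv.Perm (Fin m) := (Equiv.ofInjective v hv).trans
    ((Equiv.setCongr h).trans (Equiv.ofInjective w hw).symm)
  have : v = w ∘ τ := by
    ext1 i
    exact (congrArg Subtype.val ((Equiv.ofInjective w hw).apply_symm_apply
      (Equiv.setCongr h (Equiv.ofInjective v hv i)))).symm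
  rw [this, cls_dets_comp_perm]

theorem permAut_swap_dets {v : Fin m → Fin N} (hv : Function.Injective v) {k l : Fin m}
    (hkl : k ≠ l) : permAut N m (Equiv.swap (v k) (v l)) (dets N m v) = -dets N m v := by
  rw [permAut_dets, hv.swap_comp, dets_comp_perm, Equiv.Perm.sign_swap hkl]
  simp

theorem permAut_swap_dets_of_notMem {v : Fin m → Fin N} {a b : Fin N} (ha : ∀ k, v k ≠ a)
    (hb : ∀ k, v k ≠ b) : permAut N m (Equiv.swap a b) (dets N m v) = dets N m v := by
  rw [permAut_dets]
  congr 1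
  ext1 k
  exact Equiv.swap_apply_of_ne_of_ne (ha k) (hb k)

end Brackets

/-- The five vectors whose columns are marked by `p`. -/
def IsBracket (p : ℕ) (c : Fin 5 → Fin 10) : Prop :=
  Function.Injective c ∧ ∀ v : Fin 10, p.testBit (5 * v) = true ↔ v ∈ Set.range c

/-- The class of the bracket of the vectors whose columns are marked by `p`. -/
def valB (p : ℕ) : VF K5 :=
  if h : ∃ c, IsBracket p c then cls (dets 10 5 h.choose) else 0

theorem IsBracket.valB_eq {p : ℕ} {c : Fin 5 → Fin 10} (h : IsBracket p c) :
    valB p = cls (dets 10 5 c) := by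
  have he : ∃ c, IsBracket p c := ⟨c, h⟩
  rw [valB, dif_pos he]
  refine cls_dets_of_range_eq he.choose_spec.1 h.1 (Set.ext fun v => ?_)
  rw [← he.choose_spec.2, h.2]

theorem IsBracket.comp {p p' : ℕ} {c : Fin 5 → Fin 10} (h : IsBracket p c)
    {σ : Equiv.Perm (Fin 10)} (hp : ∀ v : Fin 10, p'.testBit (5 * σ v) = p.testBit (5 * v)) :
    IsBracket p' (σ ∘ c) := by
  refine ⟨σ.injective.comp h.1, fun v => ?_⟩
  obtain ⟨w, rfl⟩ := σ.surjective v
  rw [hp, h.2]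
  simp

theorem vmap_valB {p p' : ℕ} {σ : Equiv.Perm (Fin 10)}
    (hp : ∀ v : Fin 10, p'.testBit (5 * σ v) = p.testBit (5 * v)) :
    vmap (permAut 10 5 σ) (valB p) = valB p' := by
  by_cases he : ∃ c, IsBracket p c
  · obtain ⟨c, hc⟩ := he
    rw [hc.valB_eq, (hc.comp hp).valB_eq, vmap_cls, permAut_dets]
  · have he' : ¬ ∃ c, IsBracket p' c := by
      rintro ⟨c, hc⟩
      refine he ⟨_, hc.comp (σ := σ⁻¹) fun v => ?_⟩
      rw [← hp]
      simp
    rw [valB, valB, dif_neg he, dif_neg he', map_zero]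

theorem valB_congr {p p' : ℕ} (h : ∀ v : Fin 10, p'.testBit (5 * v) = p.testBit (5 * v)) :
    valB p' = valB p := by
  have he : IsBracket p' = IsBracket p := by
    ext c
    simp only [IsBracket, h]
  simp only [valB, he]

theorem testBit_land_fstMask (a : ℕ) (v : Fin 10) :
    (Nat.land a Kernel.fstMask).testBit (5 * v) = a.testBit (5 * v) := by
  rw [show Nat.land a Kernel.fstMask = a &&& Kernel.fstMask from rfl, Nat.testBit_and,
    Kernel.testBit_fstMask, decide_eq_true (by omega), Bool.and_true]

theorem valB_land (a : ℕ) : valB (Nat.land a Kernel.fstMask) = valB a :=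
  valB_congr (testBit_land_fstMask a)

theorem swapFixes_valB {p : ℕ} {i j : Fin 10} (hij : i ≠ j)
    (h : p.testBit (5 * i) = p.testBit (5 * j)) : SwapFixes (10 * i + j) (valB p) := by
  refine ⟨i, j, rfl, hij, vmap_valB fun v => ?_⟩
  rcases eq_or_ne v i with rfl | hi
  · rw [Equiv.swap_apply_left, h]
  rcases eq_or_ne v j with rfl | hj
  · rw [Equiv.swap_apply_right, h]
  rw [Equiv.swap_apply_of_ne_of_ne hi hj]

theorem getD_swap {l₁ l₂ : List ℕ} {x y : ℕ} {i j : Fin 10} (hi : i.val = l₁.length)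
    (hj : j.val = l₁.length + 1) (v : Fin 10) :
    (l₁ ++ y :: x :: l₂).getD (Equiv.swap i j v).val 0 = (l₁ ++ x :: y :: l₂).getD v.val 0 := by
  rcases eq_or_ne v i with rfl | hvi
  · rw [Equiv.swap_apply_left, hi, hj]
    simp
  rcases eq_or_ne v j with rfl | hvj
  · rw [Equiv.swap_apply_right, hi, hj]
    simp
  rw [Equiv.swap_apply_of_ne_of_ne hvi hvj]
  have h₁ : v.val ≠ l₁.length := fun h => hvi (Fin.ext (h.trans hi.symm))
  have h₂ : v.val ≠ l₁.length + 1 := fun h => hvj (Fin.ext (h.trans hj.symm))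
  rcases lt_or_ge v.val l₁.length with h | h
  · rw [List.getD_append _ _ _ _ h, List.getD_append _ _ _ _ h]
  · obtain ⟨k, hk⟩ := Nat.exists_eq_add_of_le (show l₁.length + 2 ≤ v.val by omega)
    rw [hk, List.getD_append_right _ _ _ _ (by omega), List.getD_append_right _ _ _ _ (by omega),
      show l₁.length + 2 + k - l₁.length = k + 1 + 1 by omega]
    rfl

theorem testBit_unCols_div {l : List ℕ} (hl : ∀ z ∈ l, z < 32) (v : Fin 10) {k : ℕ} (hk : k < 5) :
    (Nat.land (Nat.div (Kernel.unCols l) (2 ^ k)) Kernel.fstMask).testBit (5 * v) =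
      (l.getD v 0).testBit k := by
  rw [testBit_land_fstMask, show Nat.div (Kernel.unCols l) (2 ^ k) = Kernel.unCols l / 2 ^ k from
      rfl,
    Nat.testBit_div_two_pow, Kernel.testBit_unCols l hl v k hk]

theorem unwoven_eq {M : Type*} (g : ℕ → ℕ → ℕ → ℕ → ℕ → M) (h : ℕ) : Kernel.unwoven g h =
    g (Nat.land (Nat.div h (2 ^ 0)) Kernel.fstMask) (Nat.land (Nat.div h (2 ^ 1)) Kernel.fstMask)
      (Nat.land (Nat.div h (2 ^ 2)) Kernel.fstMask) (Nat.land (Nat.div h (2 ^ 3)) Kernel.fstMask)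
      (Nat.land (Nat.div h (2 ^ 4)) Kernel.fstMask) := by
  rw [show Nat.div h (2 ^ 0) = h from Nat.div_one h]
  rfl

theorem skew_of_swap {V M : Type*} [AddCommGroup M] {q : V → V → V → V → V → M} {val : ℕ → V}
    (h : ∀ l₁ x y l₂, (l₁ ++ x :: y :: l₂).length = 10 → (∀ z ∈ l₁ ++ x :: y :: l₂, z < 32) →
      ∃ φ : V → V, (∀ a b c d e, q (φ a) (φ b) (φ c) (φ d) (φ e) = -q a b c d e) ∧
        ∀ k < 5, val (Nat.land (Nat.div (Kernel.unCols (l₁ ++ y :: x :: l₂)) (2 ^ k))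
          Kernel.fstMask) = φ (val (Nat.land (Nat.div (Kernel.unCols (l₁ ++ x :: y :: l₂)) (2 ^ k))
            Kernel.fstMask))) :
    Kernel.Skew 10 fun l => Kernel.unwoven (Kernel.onLetters q val) (Kernel.unCols l) := by
  intro l₁ x y l₂ hlen hl
  obtain ⟨φ, hq, hv⟩ := h l₁ x y l₂ hlen hl
  simp only [unwoven_eq, Kernel.onLetters]
  rw [hv 0 (by omega), hv 1 (by omega), hv 2 (by omega), hv 3 (by omega), hv 4 (by omega), hq]

theorem skew_valB : Kernel.Skew 10 fun l =>
    Kernel.unwoven (Kernel.onLetters aword valB) (Kernel.unCols l) := by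
  refine skew_of_swap fun l₁ x y l₂ hlen hl => ?_
  have hlen' : l₁.length + 1 < 10 := by
    simp at hlen
    omega
  have hl' : ∀ z ∈ l₁ ++ y :: x :: l₂, z < 32 := fun z hz => hl z (by simp at hz ⊢; tauto)
  refine ⟨vmap (permAut 10 5 (Equiv.swap ⟨l₁.length, by omega⟩ ⟨l₁.length + 1, hlen'⟩)),
    aword_odd (Equiv.Perm.sign_swap (by simp [Fin.ext_iff])), fun k hk => ?_⟩
  refine (vmap_valB fun v => ?_).symm
  rw [testBit_unCols_div hl _ hk, testBit_unCols_div hl' _ hk, getD_swap rfl rfl]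

end GrassPoly

end

noncomputable section

namespace GrassPoly

section Evaluation

variable {N m : ℕ}

/-- The rational function `x` is defined at the point `pt` and takes the value `q` there. -/
def EvalsTo (pt : Fin N × Fin m → ℚ) (x : FF N m) (q : ℚ) : Prop :=
  ∃ p s : Pol N m, MvPolynomial.eval pt s ≠ 0 ∧
    x * algebraMap (Pol N m) (FF N m) s = algebraMap (Pol N m) (FF N m) p ∧
      MvPolynomial.eval pt p = q * MvPolynomial.eval pt s

variable {pt : Fin N × Fin m → ℚ} {x y : FF N m} {q r : ℚ}

theorem evalsTo_algebraMap (p : Pol N m) :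
    EvalsTo pt (algebraMap (Pol N m) (FF N m) p) (MvPolynomial.eval pt p) :=
  ⟨p, 1, by simp, by simp, by simp⟩

theorem EvalsTo.ne_zero (h : EvalsTo pt x q) (hq : q ≠ 0) : x ≠ 0 := by
  obtain ⟨p, s, hs, hx, hp⟩ := h
  rintro rfl
  rw [zero_mul] at hx
  have hp0 : p = 0 := IsFractionRing.injective (Pol N m) (FF N m) (by rw [← hx, map_zero])
  rw [hp0, map_zero] at hp
  exact mul_ne_zero hq hs hp.symm

theorem EvalsTo.mul (hx : EvalsTo pt x q) (hy : EvalsTo pt y r) : EvalsTo pt (x * y) (q * r) := by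
  obtain ⟨p, s, hs, hx, hp⟩ := hx
  obtain ⟨p', s', hs', hy, hp'⟩ := hy
  refine ⟨p * p', s * s', by simp [hs, hs'], ?_, ?_⟩
  · rw [map_mul, map_mul, ← hx, ← hy]
    ring
  · rw [map_mul, map_mul, hp, hp']
    ring

theorem EvalsTo.add (hx : EvalsTo pt x q) (hy : EvalsTo pt y r) : EvalsTo pt (x + y) (q + r) := by
  obtain ⟨p, s, hs, hx, hp⟩ := hx
  obtain ⟨p', s', hs', hy, hp'⟩ := hy
  refine ⟨p * s' + p' * s, s * s', by simp [hs, hs'], ?_, ?_⟩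
  · rw [map_add, map_mul, map_mul, map_mul, ← hx, ← hy]
    ring
  · rw [map_add, map_mul, map_mul, map_mul, hp, hp']
    ring

theorem EvalsTo.neg (hx : EvalsTo pt x q) : EvalsTo pt (-x) (-q) := by
  obtain ⟨p, s, hs, hx, hp⟩ := hx
  exact ⟨-p, s, hs, by rw [map_neg, ← hx, neg_mul], by rw [map_neg, hp, neg_mul]⟩

theorem EvalsTo.sub (hx : EvalsTo pt x q) (hy : EvalsTo pt y r) : EvalsTo pt (x - y) (q - r) := by
  rw [sub_eq_add_neg, sub_eq_add_neg]
  exact hx.add hy.neg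

theorem EvalsTo.inv (hx : EvalsTo pt x q) (hq : q ≠ 0) : EvalsTo pt x⁻¹ q⁻¹ := by
  have h0 := hx.ne_zero hq
  obtain ⟨p, s, hs, hx, hp⟩ := hx
  refine ⟨s, p, hp ▸ mul_ne_zero hq hs, ?_, ?_⟩
  · rw [← hx, inv_mul_cancel_left₀ h0]
  · rw [hp, inv_mul_cancel_left₀ hq]

theorem EvalsTo.div (hx : EvalsTo pt x q) (hy : EvalsTo pt y r) (hr : r ≠ 0) :
    EvalsTo pt (x / y) (q / r) := by
  rw [div_eq_mul_inv, div_eq_mul_inv]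
  exact hx.mul (hy.inv hr)

theorem evalsTo_dets (pt : Fin N × Fin m → ℚ) (v : Fin m → Fin N) :
    EvalsTo pt (dets N m v) (Matrix.of fun r c => pt (v c, r)).det := by
  have h := evalsTo_algebraMap (pt := pt)
    (Matrix.of fun r c => (MvPolynomial.X (v c, r) : Pol N m)).det
  rw [RingHom.map_det, RingHom.map_det] at h
  have h1 : (Matrix.of fun r c => (MvPolynomial.X (v c, r) : Pol N m)).map
      (MvPolynomial.eval pt) = Matrix.of fun r c => pt (v c, r) := by
    ext i j
    simp
  rw [← h1]
  exact h

theorem evalsTo_dets_moment (v : Fin m → Fin N) :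
    EvalsTo (fun p => (p.1.val : ℚ) ^ p.2.val) (dets N m v)
      (∏ i : Fin m, ∏ j ∈ Finset.Ioi i, (((v j).val : ℚ) - (v i).val)) := by
  have h := evalsTo_dets (fun p => (p.1.val : ℚ) ^ p.2.val) v
  rw [← Matrix.det_vandermonde, ← Matrix.det_transpose]
  exact h

theorem dets_ne_zero {v : Fin m → Fin N} (hv : Function.Injective v) : dets N m v ≠ 0 := by
  refine (evalsTo_dets_moment v).ne_zero ?_
  refine Finset.prod_ne_zero_iff.2 fun i _ => Finset.prod_ne_zero_iff.2 fun j hj => ?_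
  rw [sub_ne_zero, Nat.cast_injective.ne_iff]
  exact fun h => (Finset.mem_Ioi.1 hj).ne' (hv (Fin.ext h))

end Evaluation

/-- `x` takes the value `q` if the generic vectors are the first ten natural points of the moment
curve. -/
abbrev Moment (x : K5) (q : ℚ) : Prop := EvalsTo (fun p => (p.1.val : ℚ) ^ p.2.val) x q

theorem prod_Ioi_five (f : Fin 5 → Fin 5 → ℚ) : ∏ i : Fin 5, ∏ j ∈ Finset.Ioi i, f i j =
    f 0 1 * f 0 2 * f 0 3 * f 0 4 * (f 1 2 * f 1 3 * f 1 4) * (f 2 3 * f 2 4) * f 3 4 := by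
  rw [Fin.prod_univ_five, show Finset.Ioi (0 : Fin 5) = {1, 2, 3, 4} by decide,
    show Finset.Ioi (1 : Fin 5) = {2, 3, 4} by decide,
        show Finset.Ioi (2 : Fin 5) = {3, 4} by decide,
    show Finset.Ioi (3 : Fin 5) = {4} by decide, show Finset.Ioi (4 : Fin 5) = ∅ by decide]
  simp only [Finset.prod_empty, Finset.prod_singleton]
  rw [Finset.prod_insert (by decide), Finset.prod_insert (by decide),
      Finset.prod_insert (by decide),
    Finset.prod_insert (by decide), Finset.prod_insert (by decide), Finset.prod_insert (by decide)]
  simp only [Finset.prod_singleton]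
  ring

/-- The Vandermonde product of five numbers. -/
def vander (a b c d e : ℚ) : ℚ :=
  (b - a) * (c - a) * (d - a) * (e - a) * ((c - b) * (d - b) * (e - b)) * ((d - c) * (e - c)) *
    (e - d)

theorem moment_d5 (a b c d e : ℕ) : Moment (d5 a b c d e)
    (vander (L10 a).val (L10 b).val (L10 c).val (L10 d).val (L10 e).val) := by
  have h := evalsTo_dets_moment ![L10 a, L10 b, L10 c, L10 d, L10 e]
  rw [prod_Ioi_five] at h
  exact h

theorem moment_rho5 (i : ℕ) (h1 : 1 ≤ i) (h5 : i ≤ 5) : Moment (rho5 i) ((6 - i) / (10 - i)) := by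
  have h := (moment_d5 (M8 i) (M8 (i + 1)) (M8 (i + 2)) (M8 (i + 3)) 9).div
    (moment_d5 (M8 i) (M8 (i + 1)) (M8 (i + 2)) (M8 (i + 3)) 0)
    (by interval_cases i <;> norm_num [L10, M8, vander])
  refine Eq.mp (congrArg (Moment (rho5 i)) ?_) h
  interval_cases i <;> norm_num [L10, M8, vander]

theorem rho5_ne_zero {i : ℕ} (h1 : 1 ≤ i) (h5 : i ≤ 5) : rho5 i ≠ 0 := by
  refine (moment_rho5 i h1 h5).ne_zero ?_
  interval_cases i <;> norm_num

theorem rr5_ne_zero {i j : ℕ} (h1 : 1 ≤ i) (h5 : i ≤ 5) (h1' : 1 ≤ j) (h5' : j ≤ 5) (hij : i ≠ j) :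
    rr5 i j ≠ 0 := by
  refine ((moment_rho5 i h1 h5).sub (moment_rho5 j h1' h5')).ne_zero ?_
  interval_cases i <;> interval_cases j <;> first | exact absurd rfl hij | norm_num

theorem quadric_ne_zero : rr5 1 2 * rr5 3 4 - rr5 2 3 * rr5 4 5 ≠ 0 := by
  have h (i : ℕ) (h1 : 1 ≤ i) (h5 : i ≤ 5) := moment_rho5 i h1 h5
  refine EvalsTo.ne_zero (((h 1 ?_ ?_).sub (h 2 ?_ ?_)).mul ((h 3 ?_ ?_).sub (h 4 ?_ ?_)) |>.sub
    (((h 2 ?_ ?_).sub (h 3 ?_ ?_)).mul ((h 4 ?_ ?_).sub (h 5 ?_ ?_)))) ?_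
  all_goals norm_num

theorem quadric_ne_zero' : rr5 1 2 * rr5 3 4 + rho5 1 * rr5 2 3 ≠ 0 := by
  have h (i : ℕ) (h1 : 1 ≤ i) (h5 : i ≤ 5) := moment_rho5 i h1 h5
  refine EvalsTo.ne_zero (((h 1 ?_ ?_).sub (h 2 ?_ ?_)).mul ((h 3 ?_ ?_).sub (h 4 ?_ ?_)) |>.add
    ((h 1 ?_ ?_).mul ((h 2 ?_ ?_).sub (h 3 ?_ ?_)))) ?_
  all_goals norm_num

end GrassPoly

end

noncomputable section

namespace GrassPoly

section Symmetry

theorem permAut_d5 {σ : Equiv.Perm (Fin 10)} {a b c d e a' b' c' d' e' : ℕ}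
    (ha : σ (L10 a) = L10 a') (hb : σ (L10 b) = L10 b') (hc : σ (L10 c) = L10 c')
    (hd : σ (L10 d) = L10 d') (he : σ (L10 e) = L10 e') :
    permAut 10 5 σ (d5 a b c d e) = d5 a' b' c' d' e' := by
  rw [d5, permAut_dets, d5, ← ha, ← hb, ← hc, ← hd, ← he]
  congr 1
  ext1 k
  fin_cases k <;> rfl

theorem d5_reverse (a b c d e : ℕ) : d5 d c b a e = d5 a b c d e := by
  have h := dets_comp_perm (N := 10) ![L10 a, L10 b, L10 c, L10 d, L10 e]
    (Equiv.swap 0 3 * Equiv.swap 1 2)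
  rw [show Equiv.Perm.sign (Equiv.swap (0 : Fin 5) 3 * Equiv.swap 1 2) = 1 by decide, Units.val_one,
    Int.cast_one, one_mul] at h
  rw [d5, d5, ← h]
  congr 1
  ext1 k
  fin_cases k <;> rfl

theorem cls_d5_reverse (a b c d e : ℕ) : cls (d5 e d c b a) = cls (d5 a b c d e) := by
  have h := cls_dets_comp_perm (N := 10) ![L10 a, L10 b, L10 c, L10 d, L10 e] Fin.revPerm
  rw [d5, d5, ← h]
  congr 2
  ext1 k
  fin_cases k <;> rfl

theorem cls_d5_reverse' (a b c d e : ℕ) : cls (d5 c b a d e) = cls (d5 a b c d e) := by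
  have h := cls_dets_comp_perm (N := 10) ![L10 a, L10 b, L10 c, L10 d, L10 e] (Equiv.swap 0 2)
  rw [d5, d5, ← h]
  congr 2
  ext1 k
  fin_cases k <;> rfl

/-- The cyclic permutation of the first eight vectors. -/
def cyc : Equiv.Perm (Fin 10) := Fin.cycleRange 7

theorem sign_cyc : Equiv.Perm.sign cyc = -1 := by
  rw [cyc, Fin.sign_cycleRange]
  rfl

theorem cyc_apply : ∀ v : Fin 10, (cyc v).val = if v.val < 8 then (v.val + 1) % 8 else v.val := by
  intro v
  fin_cases v <;> rfl

theorem L10_M8_val (j : ℕ) : (L10 (M8 j)).val = (j - 1) % 8 := by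
  simp only [L10, M8]
  omega

theorem cyc_M8 {j : ℕ} (hj : 1 ≤ j) : cyc (L10 (M8 j)) = L10 (M8 (j + 1)) := by
  ext
  rw [cyc_apply, L10_M8_val, L10_M8_val, if_pos (by omega)]
  omega

theorem cyc_nine : cyc (L10 9) = L10 9 := Fin.ext (cyc_apply _)

theorem cyc_zero : cyc (L10 0) = L10 0 := Fin.ext (cyc_apply _)

/-- The reversal of the first eight vectors. -/
def rev8 : Equiv.Perm (Fin 10) :=
  Equiv.swap 0 7 * Equiv.swap 1 6 * Equiv.swap 2 5 * Equiv.swap 3 4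

theorem sign_rev8 : Equiv.Perm.sign rev8 = 1 := by decide

theorem rev8_apply : ∀ v : Fin 10, (rev8 v).val = if v.val < 8 then 7 - v.val else v.val := by
  decide

theorem rev8_M8 {j k : ℕ} (hj : 1 ≤ j) (hk : 1 ≤ k) (h : j + k = 9) :
    rev8 (L10 (M8 j)) = L10 (M8 k) := by
  ext
  rw [rev8_apply, L10_M8_val, L10_M8_val, if_pos (by omega)]
  omega

theorem rev8_nine : rev8 (L10 9) = L10 9 := by decide

theorem rev8_zero : rev8 (L10 0) = L10 0 := by decide

/-- The reversal of the first seven vectors together with the exchange of the last two. -/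
def rev7 : Equiv.Perm (Fin 10) :=
  Equiv.swap 0 6 * Equiv.swap 1 5 * Equiv.swap 2 4 * Equiv.swap 8 9

theorem sign_rev7 : Equiv.Perm.sign rev7 = 1 := by decide

theorem permAut_cyc_rho5 {i : ℕ} (hi : 1 ≤ i) : permAut 10 5 cyc (rho5 i) = rho5 (i + 1) := by
  rw [rho5, map_div₀,
    permAut_d5 (cyc_M8 hi) (cyc_M8 (by omega)) (cyc_M8 (by omega)) (cyc_M8 (by omega)) cyc_nine,
    permAut_d5 (cyc_M8 hi) (cyc_M8 (by omega)) (cyc_M8 (by omega)) (cyc_M8 (by omega)) cyc_zero]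
  rfl

theorem permAut_rev8_rho5 {i j : ℕ} (hi : 1 ≤ i) (hj : 1 ≤ j) (hij : i + j = 6) :
    permAut 10 5 rev8 (rho5 i) = rho5 j := by
  rw [rho5, map_div₀,
    permAut_d5 (rev8_M8 (k := j + 3) hi (by omega) (by omega))
      (rev8_M8 (k := j + 2) (by omega) (by omega) (by omega))
      (rev8_M8 (k := j + 1) (by omega) (by omega) (by omega))
      (rev8_M8 (k := j) (by omega) (by omega) (by omega)) rev8_nine,
    permAut_d5 (rev8_M8 (k := j + 3) hi (by omega) (by omega))
      (rev8_M8 (k := j + 2) (by omega) (by omega) (by omega))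
      (rev8_M8 (k := j + 1) (by omega) (by omega) (by omega))
      (rev8_M8 (k := j) (by omega) (by omega) (by omega)) rev8_zero,
    d5_reverse (M8 j), d5_reverse (M8 j), rho5]

theorem permAut_rev7_rho5 {i j : ℕ} (hi : 1 ≤ i) (hj : 1 ≤ j) (hij : i + j = 5) :
    permAut 10 5 rev7 (rho5 i) = (rho5 j)⁻¹ := by
  have h : ∀ i j : ℕ, 1 ≤ i → 1 ≤ j → i + j = 8 → rev7 (L10 (M8 i)) = L10 (M8 j) := by
    intro i j h1 h2 h3
    obtain rfl : j = 8 - i := by omega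
    have h4 : i ≤ 7 := by omega
    interval_cases i <;> decide
  rw [rho5, map_div₀,
    permAut_d5 (h _ (j + 3) hi (by omega) (by omega)) (h _ (j + 2) (by omega) (by omega) (by omega))
      (h _ (j + 1) (by omega) (by omega) (by omega)) (h _ j (by omega) (by omega) (by omega))
      (show rev7 (L10 9) = L10 0 by decide),
    permAut_d5 (h _ (j + 3) hi (by omega) (by omega)) (h _ (j + 2) (by omega) (by omega) (by omega))
      (h _ (j + 1) (by omega) (by omega) (by omega)) (h _ j (by omega) (by omega) (by omega))
      (show rev7 (L10 0) = L10 9 by decide), d5_reverse (M8 j), d5_reverse (M8 j), rho5,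
    inv_div]

theorem permAut_swap_rho5 (i : ℕ) : permAut 10 5 (Equiv.swap 8 9) (rho5 i) = (rho5 i)⁻¹ := by
  have h : ∀ j : ℕ, Equiv.swap (8 : Fin 10) 9 (L10 (M8 j)) = L10 (M8 j) := by
    intro j
    refine Equiv.swap_apply_of_ne_of_ne ?_ ?_ <;> rw [Ne, Fin.ext_iff] <;> simp only [L10, M8] <;>
      omega
  rw [rho5, map_div₀, permAut_d5 (h _) (h _) (h _) (h _) (show _ = L10 0 from
      Equiv.swap_apply_left _ _), permAut_d5 (h _) (h _) (h _) (h _) (show _ = L10 9 from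
      Equiv.swap_apply_right _ _), inv_div]

end Symmetry

/-- The letters, of the types `0`, `2`, `3` and `4`. -/
def letter : ℕ → ℕ → ℕ → VF K5
  | 0, i, j => if i = j then cls (rho5 i) else
      (2 : ℚ) • cls (rr5 i j) - cls (rho5 i) - cls (rho5 j)
  | 2, i, j => if i = j then cls (d5 (M8 i) (M8 (i + 1)) (M8 (i + 2)) (M8 (i + 3)) 9) +
      cls (d5 (M8 i) (M8 (i + 1)) (M8 (i + 2)) (M8 (i + 3)) 0) else 0
  | 3, i, j => if i + 1 = j then
      cls (d5 (M8 i) (M8 (i + 1)) (M8 (i + 2)) (M8 (i + 3)) (M8 (i + 4))) else 0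
  | 4, i, j => if i + 1 = j then cls (d5 (M8 (i + 1)) (M8 (i + 2)) (M8 (i + 3)) 9 0) else 0
  | _, _, _ => 0

/-- The letter with the code `c`. -/
def valC (c : ℕ) : VF K5 := letter (c / 256) (c / 16 % 16) (c % 16)

theorem valC_code (τ : ℕ) {i j : ℕ} (hi : i < 16) (hj : j < 16) :
    valC (256 * τ + 16 * i + j) = letter τ i j := by
  rw [valC]
  congr 1 <;> omega

theorem vmap_cyc_letter {i j : ℕ} (hi : 1 ≤ i) (hj : 1 ≤ j) : ∀ τ : ℕ,
    vmap (permAut 10 5 cyc) (letter τ i j) = letter τ (i + 1) (j + 1)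
  | 0 => by
    rw [letter, letter, apply_ite (vmap _), map_sub, map_sub, map_smul, vmap_cls, vmap_cls,
      vmap_cls, rr5, map_sub, permAut_cyc_rho5 hi, permAut_cyc_rho5 hj]
    simp [rr5]
  | 1 => map_zero _
  | 2 => by
    rw [letter, letter, apply_ite (vmap _), map_add, vmap_cls, vmap_cls, map_zero,
      permAut_d5 (cyc_M8 hi) (cyc_M8 (by omega)) (cyc_M8 (by omega)) (cyc_M8 (by omega)) cyc_nine,
      permAut_d5 (cyc_M8 hi) (cyc_M8 (by omega)) (cyc_M8 (by omega)) (cyc_M8 (by omega)) cyc_zero]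
    exact if_congr (by omega) rfl rfl
  | 3 => by
    rw [letter, letter, apply_ite (vmap _), vmap_cls, map_zero, permAut_d5 (cyc_M8 hi)
      (cyc_M8 (by omega)) (cyc_M8 (by omega)) (cyc_M8 (by omega)) (cyc_M8 (by omega))]
    exact if_congr (by omega) rfl rfl
  | 4 => by
    rw [letter, letter, apply_ite (vmap _), vmap_cls, map_zero, permAut_d5 (cyc_M8 (by omega))
      (cyc_M8 (by omega)) (cyc_M8 (by omega)) cyc_nine cyc_zero]
    exact if_congr (by omega) rfl rfl
  | _ + 5 => map_zero _

theorem vmap_rev8_letter {i j i' j' : ℕ} (hi : 1 ≤ i) (hj : 1 ≤ j) (hi' : 1 ≤ i') (hj' : 1 ≤ j')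
    (h : i + i' = 6) (h' : j + j' = 6) : ∀ τ : ℕ,
    vmap (permAut 10 5 rev8) (letter τ i j) = letter τ j' i'
  | 0 => by
    rw [letter, letter, apply_ite (vmap _), map_sub, map_sub, map_smul, vmap_cls, vmap_cls,
      vmap_cls, rr5, map_sub, permAut_rev8_rho5 hi hi' h, permAut_rev8_rho5 hj hj' h', rr5,
      cls_sub_comm (rho5 j')]
    by_cases hij : i = j
    · rw [if_pos hij, if_pos (by omega), show i' = j' by omega]
    · rw [if_neg hij, if_neg (by omega), sub_right_comm]
  | 1 => map_zero _
  | 2 => by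
    rw [letter, letter, apply_ite (vmap _), map_add, vmap_cls, vmap_cls, map_zero]
    by_cases hij : i = j
    · rw [if_pos hij, if_pos (by omega), permAut_d5 (rev8_M8 (k := j' + 3) hi (by omega) (by omega))
        (rev8_M8 (k := j' + 2) (by omega) (by omega) (by omega))
        (rev8_M8 (k := j' + 1) (by omega) (by omega) (by omega))
        (rev8_M8 (k := j') (by omega) (by omega) (by omega)) rev8_nine,
        permAut_d5 (rev8_M8 (k := j' + 3) hi (by omega) (by omega))
        (rev8_M8 (k := j' + 2) (by omega) (by omega) (by omega))
        (rev8_M8 (k := j' + 1) (by omega) (by omega) (by omega))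
        (rev8_M8 (k := j') (by omega) (by omega) (by omega)) rev8_zero,
        d5_reverse (M8 j'), d5_reverse (M8 j')]
    · rw [if_neg hij, if_neg (by omega)]
  | 3 => by
    rw [letter, letter, apply_ite (vmap _), vmap_cls, map_zero]
    by_cases hij : i + 1 = j
    · rw [if_pos hij, if_pos (by omega), permAut_d5 (rev8_M8 (k := j' + 4) hi (by omega) (by omega))
        (rev8_M8 (k := j' + 3) (by omega) (by omega) (by omega))
        (rev8_M8 (k := j' + 2) (by omega) (by omega) (by omega))
        (rev8_M8 (k := j' + 1) (by omega) (by omega) (by omega))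
        (rev8_M8 (k := j') (by omega) (by omega) (by omega)), cls_d5_reverse]
    · rw [if_neg hij, if_neg (by omega)]
  | 4 => by
    rw [letter, letter, apply_ite (vmap _), vmap_cls, map_zero]
    by_cases hij : i + 1 = j
    · rw [if_pos hij, if_pos (by omega),
        permAut_d5 (rev8_M8 (k := j' + 3) (by omega) (by omega) (by omega))
        (rev8_M8 (k := j' + 2) (by omega) (by omega) (by omega))
        (rev8_M8 (k := j' + 1) (by omega) (by omega) (by omega)) rev8_nine rev8_zero,
        cls_d5_reverse']
    · rw [if_neg hij, if_neg (by omega)]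
  | _ + 5 => map_zero _

theorem valC_eq_vmap_cyc {k c : ℕ} (h : Kernel.Within (k + 1) c) :
    valC (c - 17 * k) = vmap (permAut 10 5 cyc) (valC (c - 17 * (k + 1))) := by
  obtain ⟨h1, h2, h3, h4⟩ := h
  have e1 : c - 17 * k = 256 * (c / 256) + 16 * (c / 16 % 16 - k) + (c % 16 - k) := by omega
  have e2 : c - 17 * (k + 1) =
      256 * (c / 256) + 16 * (c / 16 % 16 - k - 1) + (c % 16 - k - 1) := by omega
  rw [e1, e2, valC_code _ (by omega) (by omega), valC_code _ (by omega) (by omega),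
    vmap_cyc_letter (by omega) (by omega)]
  congr 1 <;> omega

theorem Kernel.Within.of_succ {k c : ℕ} (h : Kernel.Within (k + 1) c) : Kernel.Within k c :=
  ⟨(Nat.lt_succ_self k).trans h.1, h.2⟩

section Generic

variable {V M : Type*} [AddCommGroup M] [Module ℚ M] {q : V → V → V → V → V → M} {val : ℕ → V}
  {φ ψ : V → V}

theorem onLetters_shift (hφ : ∀ a b c d e, q (φ a) (φ b) (φ c) (φ d) (φ e) = -q a b c d e)
    (hval : ∀ k c, Kernel.Within (k + 1) c → val (c - 17 * k) = φ (val (c - 17 * (k + 1))))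
    (k a b c d e : ℕ) (ha : Kernel.Within k a) (hb : Kernel.Within k b)
    (hc : Kernel.Within k c) (hd : Kernel.Within k d) (he : Kernel.Within k e) :
    Kernel.onLetters q val a b c d e = (-1 : ℚ) ^ k • Kernel.onLetters q val (a - 17 * k)
      (b - 17 * k) (c - 17 * k) (d - 17 * k) (e - 17 * k) := by
  induction k with
  | zero => simp
  | succ k ih =>
    rw [ih ha.of_succ hb.of_succ hc.of_succ hd.of_succ he.of_succ, pow_succ, mul_neg_one, neg_smul,
      ← smul_neg]
    simp only [Kernel.onLetters]
    rw [hval k a ha, hval k b hb, hval k c hc, hval k d hd, hval k e he, hφ]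

theorem onLetters_flip (hφ : ∀ a b c d e, q (φ a) (φ b) (φ c) (φ d) (φ e) = -q a b c d e)
    (hval : ∀ k c, Kernel.Within (k + 1) c → val (c - 17 * k) = φ (val (c - 17 * (k + 1))))
    (hψ : ∀ a b c d e, q (ψ a) (ψ b) (ψ c) (ψ d) (ψ e) = q a b c d e)
    (hval' : ∀ n c, Kernel.Within 0 c → c % 16 < n → n ≤ 6 →
      Kernel.Within (6 - n) (Kernel.flip 6 c) ∧
        Kernel.flip 6 c - 17 * (6 - n) = Kernel.flip n c ∧ ψ (val c) = val (Kernel.flip 6 c))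
    (n a b c d e : ℕ) (ha : Kernel.Within 0 a) (hb : Kernel.Within 0 b)
    (hc : Kernel.Within 0 c) (hd : Kernel.Within 0 d) (he : Kernel.Within 0 e) (ha' : a % 16 < n)
    (hb' : b % 16 < n) (hc' : c % 16 < n) (hd' : d % 16 < n) (he' : e % 16 < n) (hn : n ≤ 6) :
    Kernel.onLetters q val a b c d e = (-1 : ℚ) ^ n • Kernel.onLetters q val
      (Kernel.flip n a) (Kernel.flip n b) (Kernel.flip n c) (Kernel.flip n d)
      (Kernel.flip n e) := by
  obtain ⟨a1, a2, a3⟩ := hval' n a ha ha' hn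
  obtain ⟨b1, b2, b3⟩ := hval' n b hb hb' hn
  obtain ⟨c1, c2, c3⟩ := hval' n c hc hc' hn
  obtain ⟨d1, d2, d3⟩ := hval' n d hd hd' hn
  obtain ⟨e1, e2, e3⟩ := hval' n e he he' hn
  have h2 := onLetters_shift hφ hval (6 - n) _ _ _ _ _ a1 b1 c1 d1 e1
  rw [a2, b2, c2, d2, e2] at h2
  have hp : (-1 : ℚ) ^ (6 - n) = (-1 : ℚ) ^ n := by
    interval_cases n <;> norm_num
  rw [← hp, ← h2]
  simp only [Kernel.onLetters]
  rw [← a3, ← b3, ← c3, ← d3, ← e3, hψ]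

end Generic

theorem vmap_rev8_valC {n c : ℕ} (h : Kernel.Within 0 c) (hn : c % 16 < n) (hn' : n ≤ 6) :
    Kernel.Within (6 - n) (Kernel.flip 6 c) ∧
      Kernel.flip 6 c - 17 * (6 - n) = Kernel.flip n c ∧
        vmap (permAut 10 5 rev8) (valC c) = valC (Kernel.flip 6 c) := by
  obtain ⟨h1, h2, h3, h4⟩ := h
  have e : Kernel.flip 6 c = 256 * (c / 256) + 16 * (6 - c % 16) + (6 - c / 16 % 16) := by
    unfold Kernel.flip
    omega
  have key : ∀ x τ u v : ℕ, u < 16 → v < 16 → x = 256 * τ + 16 * u + v →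
      x / 16 % 16 = u ∧ x % 16 = v := by omega
  obtain ⟨e1, e2⟩ := key _ _ _ _ (by omega) (by omega) e
  refine ⟨⟨by omega, by omega, by omega, by omega⟩, ?_, ?_⟩
  · rw [e]
    unfold Kernel.flip
    omega
  · rw [e, valC_code _ (by omega) (by omega)]
    exact vmap_rev8_letter (by omega) (by omega) (by omega) (by omega) (by omega) (by omega) _

theorem valC_shift (k a b c d e : ℕ) (ha : Kernel.Within k a) (hb : Kernel.Within k b)
    (hc : Kernel.Within k c) (hd : Kernel.Within k d) (he : Kernel.Within k e) :
    Kernel.onLetters aword valC a b c d e = (-1 : ℚ) ^ k • Kernel.onLetters aword valC (a - 17 * k)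
      (b - 17 * k) (c - 17 * k) (d - 17 * k) (e - 17 * k) :=
  onLetters_shift (aword_odd sign_cyc) (fun _ _ => valC_eq_vmap_cyc) k a b c d e ha hb hc hd he

theorem valC_flip (n a b c d e : ℕ) (ha : Kernel.Within 0 a) (hb : Kernel.Within 0 b)
    (hc : Kernel.Within 0 c) (hd : Kernel.Within 0 d) (he : Kernel.Within 0 e) (ha' : a % 16 < n)
    (hb' : b % 16 < n) (hc' : c % 16 < n) (hd' : d % 16 < n) (he' : e % 16 < n) (hn : n ≤ 6) :
    Kernel.onLetters aword valC a b c d e = (-1 : ℚ) ^ n • Kernel.onLetters aword valC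
      (Kernel.flip n a) (Kernel.flip n b) (Kernel.flip n c) (Kernel.flip n d)
      (Kernel.flip n e) :=
  onLetters_flip (aword_odd sign_cyc) (fun _ _ => valC_eq_vmap_cyc) (aword_even sign_rev8)
    (fun _ _ => vmap_rev8_valC) n a b c d e ha hb hc hd he ha' hb' hc' hd' he' hn

end GrassPoly

end

noncomputable section

namespace GrassPoly

section Transposition

/-- The two vectors both occur or both do not occur in the bracket. -/
def Neutral (v : Fin 5 → Fin 10) (a b : Fin 10) : Prop :=
  (∃ k l, k ≠ l ∧ v k = a ∧ v l = b) ∨ ((∀ k, v k ≠ a) ∧ ∀ k, v k ≠ b)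

instance (v : Fin 5 → Fin 10) (a b : Fin 10) : Decidable (Neutral v a b) :=
  inferInstanceAs (Decidable (_ ∨ _))

theorem Neutral.permAut_div {v w : Fin 5 → Fin 10} (hv : Function.Injective v)
    (hw : Function.Injective w) {a b : Fin 10}
    (h : (∃ k l, k ≠ l ∧ v k = a ∧ v l = b ∧ w k = a ∧ w l = b) ∨
      ((∀ k, v k ≠ a) ∧ ∀ k, v k ≠ b) ∧ (∀ k, w k ≠ a) ∧ ∀ k, w k ≠ b) :
    permAut 10 5 (Equiv.swap a b) (dets 10 5 v / dets 10 5 w) = dets 10 5 v / dets 10 5 w := by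
  rw [map_div₀]
  rcases h with ⟨k, l, hkl, rfl, rfl, h1, h2⟩ | ⟨⟨h1, h2⟩, h3, h4⟩
  · rw [permAut_swap_dets hv hkl, ← h1, ← h2, permAut_swap_dets hw hkl, neg_div_neg_eq]
  · rw [permAut_swap_dets_of_notMem h1 h2, permAut_swap_dets_of_notMem h3 h4]

theorem Neutral.vmap_cls {v : Fin 5 → Fin 10} (hv : Function.Injective v) {a b : Fin 10}
    (h : Neutral v a b) :
    vmap (permAut 10 5 (Equiv.swap a b)) (cls (dets 10 5 v)) = cls (dets 10 5 v) := by
  rw [GrassPoly.vmap_cls]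
  rcases h with ⟨k, l, hkl, rfl, rfl⟩ | ⟨h1, h2⟩
  · rw [permAut_swap_dets hv hkl, cls_neg]
  · rw [permAut_swap_dets_of_notMem h1 h2]

/-- `v` is one of the four cyclically consecutive vectors starting with the `i`th. -/
def inArc (i : ℕ) (v : Fin 10) : Bool := decide (v.val < 8) && decide ((v.val + 9 - i) % 8 < 4)

theorem injective_arc {i : ℕ} (h1 : 1 ≤ i) (h5 : i ≤ 5) : Function.Injective
      ![L10 (M8 i), L10 (M8 (i + 1)), L10 (M8 (i + 2)), L10 (M8 (i + 3)), L10 9] ∧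
    Function.Injective
      ![L10 (M8 i), L10 (M8 (i + 1)), L10 (M8 (i + 2)), L10 (M8 (i + 3)), L10 0] := by
  interval_cases i <;> decide

theorem swap_arc {i : ℕ} (h1 : 1 ≤ i) (h5 : i ≤ 5) : ∀ a b : Fin 10, a.val < 8 → b.val < 8 → a ≠ b →
    inArc i a = inArc i b → (∃ k l,  k ≠ l ∧
      ![L10 (M8 i), L10 (M8 (i + 1)), L10 (M8 (i + 2)), L10 (M8 (i + 3)), L10 9] k = a ∧
      ![L10 (M8 i), L10 (M8 (i + 1)), L10 (M8 (i + 2)), L10 (M8 (i + 3)), L10 9] l = b ∧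
      ![L10 (M8 i), L10 (M8 (i + 1)), L10 (M8 (i + 2)), L10 (M8 (i + 3)), L10 0] k = a ∧
      ![L10 (M8 i), L10 (M8 (i + 1)), L10 (M8 (i + 2)), L10 (M8 (i + 3)), L10 0] l = b) ∨
    ((∀ k, ![L10 (M8 i), L10 (M8 (i + 1)), L10 (M8 (i + 2)), L10 (M8 (i + 3)), L10 9] k ≠ a) ∧
      ∀ k, ![L10 (M8 i), L10 (M8 (i + 1)), L10 (M8 (i + 2)), L10 (M8 (i + 3)), L10 9] k ≠ b) ∧
    (∀ k, ![L10 (M8 i), L10 (M8 (i + 1)), L10 (M8 (i + 2)), L10 (M8 (i + 3)), L10 0] k ≠ a) ∧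
      ∀ k, ![L10 (M8 i), L10 (M8 (i + 1)), L10 (M8 (i + 2)), L10 (M8 (i + 3)), L10 0] k ≠ b := by
  interval_cases i <;> decide +kernel

theorem permAut_rho5_of_inArc {i : ℕ} (h1 : 1 ≤ i) (h5 : i ≤ 5) {a b : Fin 10} (ha : a.val < 8)
    (hb : b.val < 8) (hab : a ≠ b) (h : inArc i a = inArc i b) :
    permAut 10 5 (Equiv.swap a b) (rho5 i) = rho5 i :=
  Neutral.permAut_div (injective_arc h1 h5).1 (injective_arc h1 h5).2 (swap_arc h1 h5 a b ha hb hab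
      h)

theorem vmap_point_of_inArc {i : ℕ} (h1 : 1 ≤ i) (h5 : i ≤ 5) {a b : Fin 10} (ha : a.val < 8)
    (hb : b.val < 8) (hab : a ≠ b) (h : inArc i a = inArc i b) :
    vmap (permAut 10 5 (Equiv.swap a b)) (letter 2 i i) = letter 2 i i := by
  rw [letter, if_pos rfl, map_add]
  congr 1
  · refine Neutral.vmap_cls (injective_arc h1 h5).1 ?_
    rcases swap_arc h1 h5 a b ha hb hab h with ⟨k, l, h1, h2, h3, -⟩ | ⟨h1, -⟩
    · exact Or.inl ⟨k, l, h1, h2, h3⟩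
    · exact Or.inr h1
  · refine Neutral.vmap_cls (injective_arc h1 h5).2 ?_
    rcases swap_arc h1 h5 a b ha hb hab h with ⟨k, l, h1, -, -, h2, h3⟩ | ⟨-, h1⟩
    · exact Or.inl ⟨k, l, h1, h2, h3⟩
    · exact Or.inr h1

theorem vmap_swap_point (i : ℕ) : vmap (permAut 10 5 (Equiv.swap 8 9)) (letter 2 i i) =
    letter 2 i i := by
  have h : ∀ j : ℕ, Equiv.swap (8 : Fin 10) 9 (L10 (M8 j)) = L10 (M8 j) := by
    intro j
    refine Equiv.swap_apply_of_ne_of_ne ?_ ?_ <;> rw [Ne, Fin.ext_iff] <;>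
      simp only [L10, M8] <;> omega
  rw [letter, if_pos rfl, map_add, vmap_cls, vmap_cls, permAut_d5 (h _) (h _) (h _) (h _)
    (show _ = L10 0 from Equiv.swap_apply_left _ _), permAut_d5 (h _) (h _) (h _) (h _)
    (show _ = L10 9 from Equiv.swap_apply_right _ _), add_comm]

theorem double_sub_add_neg {M : Type*} [AddCommGroup M] [Module ℚ M] (r a b : M) :
    (2 : ℚ) • (r - (a + b)) - -a - -b = (2 : ℚ) • r - a - b := by
  module

theorem vmap_swap_pair {i j : ℕ} (hi : 1 ≤ i) (hi' : i ≤ 5) (hj : 1 ≤ j) (hj' : j ≤ 5)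
    (hij : i ≠ j) : vmap (permAut 10 5 (Equiv.swap 8 9)) (letter 0 i j) = letter 0 i j := by
  have h1 := rho5_ne_zero hi hi'
  have h2 := rho5_ne_zero hj hj'
  have h3 := rr5_ne_zero hj hj' hi hi' hij.symm
  rw [letter, if_neg hij, map_sub, map_sub, map_smul, vmap_cls, vmap_cls, vmap_cls,
    permAut_swap_rho5, permAut_swap_rho5, rr5, map_sub, permAut_swap_rho5, permAut_swap_rho5,
    inv_sub_inv h1 h2, cls_div (a := rho5 j - rho5 i) h3 (mul_ne_zero h1 h2), cls_mul h1 h2,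
        cls_inv, cls_inv,
    cls_sub_comm (rho5 j)]
  exact double_sub_add_neg _ _ _

theorem vmap_swap_singleton (i : ℕ) : vmap (permAut 10 5 (Equiv.swap 8 9)) (letter 0 i i) =
    -letter 0 i i := by
  rw [letter, if_pos rfl, vmap_cls, permAut_swap_rho5, cls_inv]

/-- The transposition of `a` and `b` fixes the letter with the given type and indices. -/
def neutral (i j : ℕ) (a b : Fin 10) : ℕ → Bool
  | 0 => (decide (a.val < 8) && decide (b.val < 8) && (inArc i a == inArc i b) &&
      (inArc j a == inArc j b)) || (decide (i ≠ j) && decide (a = 8) && decide (b = 9))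
  | 2 => (decide (a.val < 8) && decide (b.val < 8) && decide (i = j) && (inArc i a == inArc j b)) ||
      (decide (i = j) && decide (a = 8) && decide (b = 9))
  | 3 => decide (i + 1 = j) && ((inArc i a || inArc j a) == (inArc i b || inArc j b))
  | 4 => decide (i + 1 = j) && ((decide (8 ≤ a.val) || (inArc i a && inArc j a)) ==
      (decide (8 ≤ b.val) || (inArc i b && inArc j b)))
  | _ => false

theorem neutral_line {i : ℕ} (h1 : 1 ≤ i) (h4 : i ≤ 4) : ∀ a b : Fin 10, a ≠ b →
    (inArc i a || inArc (i + 1) a) = (inArc i b || inArc (i + 1) b) →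
    Neutral ![L10 (M8 i), L10 (M8 (i + 1)), L10 (M8 (i + 2)), L10 (M8 (i + 3)), L10 (M8 (i + 4))]
      a b := by
  interval_cases i <;> decide +kernel

theorem neutral_plane {i : ℕ} (h1 : 1 ≤ i) (h4 : i ≤ 4) : ∀ a b : Fin 10, a ≠ b →
    (decide (8 ≤ a.val) || (inArc i a && inArc (i + 1) a)) =
      (decide (8 ≤ b.val) || (inArc i b && inArc (i + 1) b)) →
    Neutral ![L10 (M8 (i + 1)), L10 (M8 (i + 2)), L10 (M8 (i + 3)), L10 9, L10 0] a b := by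
  interval_cases i <;> decide +kernel

theorem vmap_swap_letter {i j : ℕ} (hi : 1 ≤ i) (hi' : i ≤ 5) (hj : 1 ≤ j) (hj' : j ≤ 5)
    {a b : Fin 10} (hab : a ≠ b) : ∀ τ, neutral i j a b τ = true →
    vmap (permAut 10 5 (Equiv.swap a b)) (letter τ i j) = letter τ i j
  | 0, h => by
    simp only [neutral, Bool.or_eq_true, Bool.and_eq_true, decide_eq_true_eq, beq_iff_eq] at h
    rcases h with ⟨⟨⟨ha, hb⟩, h⟩, h'⟩ | ⟨⟨hij, rfl⟩, rfl⟩
    · rw [letter, apply_ite (vmap _), map_sub, map_sub, map_smul, vmap_cls, vmap_cls,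
        vmap_cls, rr5, map_sub, permAut_rho5_of_inArc hi hi' ha hb hab h,
        permAut_rho5_of_inArc hj hj' ha hb hab h']
    · exact vmap_swap_pair hi hi' hj hj' hij
  | 1, h => by cases h
  | 2, h => by
    simp only [neutral, Bool.or_eq_true, Bool.and_eq_true, decide_eq_true_eq, beq_iff_eq] at h
    rcases h with ⟨⟨⟨ha, hb⟩, rfl⟩, h⟩ | ⟨⟨rfl, rfl⟩, rfl⟩
    · exact vmap_point_of_inArc hi hi' ha hb hab h
    · exact vmap_swap_point i
  | 3, h => by
    simp only [neutral, Bool.and_eq_true, decide_eq_true_eq, beq_iff_eq] at h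
    obtain ⟨rfl, h⟩ := h
    rw [letter, if_pos rfl, d5, Neutral.vmap_cls ?_ (neutral_line hi (by omega) a b hab h)]
    have h4 : i ≤ 4 := by omega
    clear h hi' hj hj'
    interval_cases i <;> decide
  | 4, h => by
    simp only [neutral, Bool.and_eq_true, decide_eq_true_eq, beq_iff_eq] at h
    obtain ⟨rfl, h⟩ := h
    rw [letter, if_pos rfl, d5, Neutral.vmap_cls ?_ (neutral_plane hi (by omega) a b hab h)]
    have h4 : i ≤ 4 := by omega
    clear h hi' hj hj'
    interval_cases i <;> decide
  | _ + 5, h => by cases h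

/-- The binary digits of `f` record transpositions that fix the letter with the code `c`. -/
def validMask (c f : ℕ) : Bool :=
  decide (1 ≤ c / 16 % 16) && decide (c / 16 % 16 ≤ 5) && decide (1 ≤ c % 16) &&
    decide (c % 16 ≤ 5) && decide (f < 2 ^ 100) &&
    (List.finRange 10).all fun a => (List.finRange 10).all fun b =>
      !f.testBit (10 * a + b) ||
        (decide (a ≠ b) && neutral (c / 16 % 16) (c % 16) a b (c / 256))

theorem swapFixes_valC {c f : ℕ} (h : validMask c f = true) {p : ℕ} (hp : f.testBit p = true) :
    SwapFixes p (valC c) := by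
  simp only [validMask, Bool.and_eq_true, decide_eq_true_eq, List.all_eq_true, Bool.or_eq_true,
    Bool.not_eq_true'] at h
  obtain ⟨⟨⟨⟨⟨h1, h2⟩, h3⟩, h4⟩, h5⟩, h⟩ := h
  have hp' : p < 100 := by
    by_contra hc
    rw [Nat.testBit_lt_two_pow (h5.trans_le (Nat.pow_le_pow_right (by omega) (by omega)))] at hp
    cases hp
  have hpe : 10 * (p / 10) + p % 10 = p := by omega
  have := h ⟨p / 10, by omega⟩ (List.mem_finRange _) ⟨p % 10, by omega⟩ (List.mem_finRange _)
  dsimp only at this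
  rw [hpe, hp] at this
  simp only [Bool.true_eq_false, false_or] at this
  exact ⟨_, _, hpe.symm, this.1, vmap_swap_letter h1 h2 h3 h4 this.1 _ this.2⟩

end Transposition

end GrassPoly

end

noncomputable section

namespace GrassPoly

section Pluecker

variable {N m : ℕ}

theorem of_gen_updateCol (c : Fin m → Fin N) (k : Fin m) (x : Fin N) :
    (Matrix.of fun r c' => gen N m (c c') r).updateCol k (gen N m x) =
      Matrix.of fun r c' => gen N m (Function.update c k x c') r := by
  ext r c'
  rcases eq_or_ne c' k with rfl | h
  · simp
  · simp [h]

theorem dets_eq_zero {c : Fin m → Fin N} (k l : Fin m) (hkl : k ≠ l) (h : c k = c l) :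
    dets N m c = 0 :=
  Matrix.det_zero_of_column_eq hkl fun r => by simp [h]

theorem dets_mul_dets (a b : Fin m → Fin N) (k : Fin m) (x : Fin N) :
    dets N m a * dets N m (Function.update b k x) =
      ∑ l, dets N m (Function.update a l x) * dets N m (Function.update b k (a l)) := by
  have h := congrArg (fun v => (Matrix.of fun r c' => gen N m (b c') r).cramer v k)
    (Matrix.mulVec_cramer (Matrix.of fun r c' => gen N m (a c') r) (gen N m x))
  simp only [Matrix.mulVec_eq_sum, op_smul_eq_smul, map_sum, map_smul, Finset.sum_apply,
    Pi.smul_apply, smul_eq_mul] at h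
  simp only [Matrix.cramer_apply, of_gen_updateCol] at h
  refine h.symm.trans (Finset.sum_congr rfl fun l _ => congrArg (_ * ·) ?_)
  exact congrArg Matrix.det (of_gen_updateCol b k (a l))

end Pluecker

theorem dets_rotate (x y : Fin 10) : dets 10 5 ![1, 2, 3, x, y] = -dets 10 5 ![x, 1, 2, 3, y] := by
  have h := dets_comp_perm ![x, 1, 2, 3, y] (Fin.cycleRange 3)
  rw [Fin.sign_cycleRange, show ![x, 1, 2, 3, y] ∘ Fin.cycleRange 3 = ![1, 2, 3, x, y] by
    ext k; fin_cases k <;> rfl] at h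
  rw [h]
  norm_num

theorem dets_swap (x y : Fin 10) : dets 10 5 ![1, 2, 3, x, y] = -dets 10 5 ![1, 2, 3, y, x] := by
  have h := dets_comp_perm ![1, 2, 3, y, x] (Equiv.swap 3 4)
  rw [Equiv.Perm.sign_swap (by decide), show ![1, 2, 3, y, x] ∘ Equiv.swap 3 4 = ![1, 2, 3, x, y] by
    ext k; fin_cases k <;> rfl] at h
  rw [h]
  norm_num

theorem d5_mul_d5 : d5 1 2 3 4 9 * d5 2 3 4 5 0 - d5 2 3 4 5 9 * d5 1 2 3 4 0 =
    d5 1 2 3 4 5 * d5 2 3 4 9 0 := by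
  have h := dets_mul_dets (N := 10) (m := 5) ![1, 2, 3, 8, 9] ![1, 2, 3, 8, 4] 3 0
  have hb : ∀ x : Fin 10, Function.update ![(1 : Fin 10), 2, 3, 8, 4] 3 x = ![1, 2, 3, x, 4] := by
    intro x
    ext k
    fin_cases k <;> rfl
  have h8 : Function.update ![(1 : Fin 10), 2, 3, 8, 9] 3 0 = ![1, 2, 3, 0, 9] := by decide
  have h9 : Function.update ![(1 : Fin 10), 2, 3, 8, 9] 4 0 = ![1, 2, 3, 8, 0] := by decide
  rw [Fin.sum_univ_five] at h
  simp only [hb] at h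
  rw [dets_eq_zero (c := ![(1 : Fin 10), 2, 3, ![(1 : Fin 10), 2, 3, 8, 9] 0, 4]) 0 3 (by decide)
      (by decide), dets_eq_zero (c := ![(1 : Fin 10), 2, 3, ![(1 : Fin 10), 2, 3, 8, 9] 1, 4]) 1 3
      (by decide) (by decide), dets_eq_zero
      (c := ![(1 : Fin 10), 2, 3, ![(1 : Fin 10), 2, 3, 8, 9] 2, 4]) 2 3 (by decide) (by decide),
    h8, h9, dets_rotate 0 9, dets_swap 8 0, dets_rotate 0 8, dets_rotate 0 4,
    show ![(1 : Fin 10), 2, 3, 8, 9] 3 = 8 from rfl,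
        show ![(1 : Fin 10), 2, 3, 8, 9] 4 = 9 from rfl,
    dets_swap 8 4, dets_swap 9 4] at h
  have e1 : d5 1 2 3 4 9 = dets 10 5 ![0, 1, 2, 3, 8] := rfl
  have e2 : d5 2 3 4 5 0 = dets 10 5 ![1, 2, 3, 4, 9] := rfl
  have e3 : d5 2 3 4 5 9 = dets 10 5 ![1, 2, 3, 4, 8] := rfl
  have e4 : d5 1 2 3 4 0 = dets 10 5 ![0, 1, 2, 3, 9] := rfl
  have e5 : d5 1 2 3 4 5 = dets 10 5 ![0, 1, 2, 3, 4] := rfl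
  have e6 : d5 2 3 4 9 0 = dets 10 5 ![1, 2, 3, 8, 9] := rfl
  rw [e1, e2, e3, e4, e5, e6]
  linear_combination h

theorem d5_ne_zero {a b c d e : ℕ}
    (h : Function.Injective ![L10 a, L10 b, L10 c, L10 d, L10 e]) : d5 a b c d e ≠ 0 :=
  dets_ne_zero h

theorem letter_zero_succ : ∀ {i : ℕ}, 1 ≤ i → letter 0 i (i + 1) = (2 : ℚ) • letter 3 i (i + 1) +
    (2 : ℚ) • letter 4 i (i + 1) - letter 2 i i - letter 2 (i + 1) (i + 1) := by
  intro i hi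
  induction i, hi using Nat.le_induction with
  | base =>
    have h := d5_mul_d5
    have n1 : d5 1 2 3 4 9 ≠ 0 := d5_ne_zero (by decide)
    have n2 : d5 1 2 3 4 0 ≠ 0 := d5_ne_zero (by decide)
    have n3 : d5 2 3 4 5 9 ≠ 0 := d5_ne_zero (by decide)
    have n4 : d5 2 3 4 5 0 ≠ 0 := d5_ne_zero (by decide)
    have n5 : d5 1 2 3 4 5 ≠ 0 := d5_ne_zero (by decide)
    have n6 : d5 2 3 4 9 0 ≠ 0 := d5_ne_zero (by decide)
    have e1 : rho5 1 = d5 1 2 3 4 9 / d5 1 2 3 4 0 := rfl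
    have e2 : rho5 2 = d5 2 3 4 5 9 / d5 2 3 4 5 0 := rfl
    have e3 : rr5 1 2 = d5 1 2 3 4 5 * d5 2 3 4 9 0 / (d5 1 2 3 4 0 * d5 2 3 4 5 0) := by
      rw [rr5, e1, e2, div_sub_div _ _ n2 n4, ← h, mul_comm (d5 1 2 3 4 0) (d5 2 3 4 5 9)]
    have e4 : letter 0 1 2 = (2 : ℚ) • cls (rr5 1 2) - cls (rho5 1) - cls (rho5 2) := rfl
    have e5 : letter 2 1 1 = cls (d5 1 2 3 4 9) + cls (d5 1 2 3 4 0) := rfl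
    have e6 : letter 2 2 2 = cls (d5 2 3 4 5 9) + cls (d5 2 3 4 5 0) := rfl
    have e7 : letter 3 1 2 = cls (d5 1 2 3 4 5) := rfl
    have e8 : letter 4 1 2 = cls (d5 2 3 4 9 0) := rfl
    rw [e4, e5, e6, e7, e8, e3, e1, e2, cls_div (mul_ne_zero n5 n6) (mul_ne_zero n2 n4),
      cls_mul n5 n6, cls_mul n2 n4, cls_div n1 n2, cls_div n3 n4]
    module
  | succ i hi ih =>
    have h := congrArg (vmap (permAut 10 5 cyc)) ih
    rw [map_sub, map_sub, map_add, map_smul, map_smul, vmap_cyc_letter hi (by omega),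
      vmap_cyc_letter hi (by omega), vmap_cyc_letter hi (by omega), vmap_cyc_letter hi hi,
      vmap_cyc_letter (by omega) (by omega)] at h
    exact h

end GrassPoly

end

noncomputable section

namespace GrassPoly

namespace Kernel

variable {V : Type*} [AddCommGroup V] [Module ℚ V]

/-- The values assigned to the letters listed in a table. -/
def tabVal (tab : List Ent) (val : ℕ → V) (c : ℕ) : V :=
  match tab.find? fun x => x.c == c with
  | some x => total val x.o
  | none => 0

theorem tabVal_eq {tab : List Ent} (h : (tab.map Ent.c).Nodup) (val : ℕ → V) {x : Ent}
    (hx : x ∈ tab) : tabVal tab val x.c = total val x.o := by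
  have hf : (tab.find? fun y => y.c == x.c) = some x := by
    induction tab with
    | nil => cases hx
    | cons y tab ih =>
      rw [List.map_cons, List.nodup_cons] at h
      rcases List.mem_cons.1 hx with rfl | hx
      · simp
      · rw [List.find?_cons_of_neg, ih h.2 hx]
        rw [beq_iff_eq]
        exact fun he => h.1 (he ▸ List.mem_map_of_mem hx)
  rw [tabVal, hf]

theorem map_total {W : Type*} [AddCommGroup W] [Module ℚ W] (f : V →ₗ[ℚ] W) (val : ℕ → V)
    (o : List Opt) : f (total val o) = total (fun l => f (val l)) o := by
  rw [total, total, map_list_sum, List.map_map]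
  exact congrArg List.sum (List.map_congr_left fun x _ => map_smul f _ _)

theorem total_congr {val val' : ℕ → V} {o : List Opt} (h : ∀ x ∈ o, val x.l = val' x.l) :
    total val o = total val' o :=
  congrArg List.sum (List.map_congr_left fun x hx => by rw [h x hx])

theorem total_singleton (val : ℕ → V) (c f : ℕ) : total val [⟨0, 1, c, f⟩] = val c := by
  simp [total, sg]

theorem total_pair (val : ℕ → V) (c f c' f' s : ℕ) :
    total val [⟨0, 1, c, f⟩, ⟨s, 1, c', f'⟩] = val c + (-1 : ℚ) ^ s • val c' := by
  simp [total, sg]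

theorem TabSpec.of_tabVal {Fix : ℕ → V → Prop} {val' : ℕ → V} {tab : List Ent}
    (h : (tab.map Ent.c).Nodup) (fix : ∀ x ∈ tab, ∀ p,
        x.f.testBit p = true → Fix p (Kernel.total val' x.o))
    (fix' : ∀ x ∈ tab, ∀ y ∈ x.o, ∀ p, y.f.testBit p = true → Fix p (val' y.l)) :
    TabSpec Fix (tabVal tab val') val' tab where
  total x hx := tabVal_eq h val' hx
  fix x hx p hp := by
    rw [tabVal_eq h val' hx]
    exact fix x hx p hp
  fix' := fix'

theorem tabVal_cases {tab : List Ent} {val : ℕ → V} {P : ℕ → V → Prop} (h0 : ∀ c, P c 0)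
    (h : ∀ x ∈ tab, P x.c (total val x.o)) (c : ℕ) : P c (tabVal tab val c) := by
  rw [tabVal]
  split
  · next x hx =>
    have hc := List.find?_some hx
    rw [beq_iff_eq] at hc
    exact hc ▸ h x (List.mem_of_find?_eq_some hx)
  · exact h0 c

theorem Good.eq_true {b : Bool} (h : Good b) : b = true := by
  cases h
  rfl

end Kernel

open Kernel

theorem SwapFixes.total {p : ℕ} {val : ℕ → VF K5} {o : List Opt} (ho : o ≠ [])
    (h : ∀ x ∈ o, SwapFixes p (val x.l)) : SwapFixes p (total val o) := by
  obtain ⟨x, hx⟩ := List.exists_mem_of_ne_nil o ho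
  obtain ⟨i, j, rfl, hij, -⟩ := h x hx
  exact ⟨i, j, rfl, hij, (map_total _ _ _).trans (total_congr fun y hy => (h y hy).vmap_eq)⟩

/-- The binary digits of `f` record transpositions that fix the bracket with the code `c`. -/
def validBracketMask (c f : ℕ) : Bool :=
  decide (f < 2 ^ 100) && (List.finRange 10).all fun a => (List.finRange 10).all fun b =>
    !f.testBit (10 * a + b) || (decide (a ≠ b) && (c.testBit (5 * a) == c.testBit (5 * b)))

theorem swapFixes_valB_of_mask {c f : ℕ} (h : validBracketMask c f = true) {p : ℕ}
    (hp : f.testBit p = true) : SwapFixes p (valB c) := by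
  simp only [validBracketMask, Bool.and_eq_true, decide_eq_true_eq, List.all_eq_true,
    Bool.or_eq_true, Bool.not_eq_true', beq_iff_eq] at h
  obtain ⟨h5, h⟩ := h
  have hp' : p < 100 := by
    by_contra hc
    rw [Nat.testBit_lt_two_pow (h5.trans_le (Nat.pow_le_pow_right (by omega) (by omega)))] at hp
    cases hp
  have hpe : 10 * (p / 10) + p % 10 = p := by omega
  have := h ⟨p / 10, by omega⟩ (List.mem_finRange _) ⟨p % 10, by omega⟩ (List.mem_finRange _)
  dsimp only at this
  rw [hpe, hp] at this
  simp only [Bool.true_eq_false, false_or] at this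
  have hs := swapFixes_valB this.1 this.2
  dsimp only at hs
  rwa [hpe] at hs

/-- The halves of the doubled letters on which the exchange of the last two vectors acts as
`1` and `-1`. -/
def valS : ℕ → VF K5 := tabVal tabS valC

/-- The doubled letters. -/
def valF : ℕ → VF K5 := tabVal tabF valS

theorem tabSpec_tabF : TabSpec SwapFixes valF valS tabF := by
  have h : Good (decide (tabF.map Ent.c).Nodup &&
      tabF.all fun x => decide (x.f = 0) && x.o.all fun y => decide (y.f = 0)) := by
    decide +kernel
  have h := h.eq_true
  simp only [Bool.and_eq_true, decide_eq_true_eq, List.all_eq_true] at h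
  refine .of_tabVal h.1 (fun x hx p hp => ?_) fun x hx y hy p hp => ?_
  · simp [(h.2 x hx).1] at hp
  · simp [(h.2 x hx).2 y hy] at hp

theorem tabSpec_tabS : TabSpec SwapFixes valS valC tabS := by
  have h : Good (decide (tabS.map Ent.c).Nodup && tabS.all fun x => !x.o.isEmpty &&
      x.o.all fun y => (x.f &&& y.f == x.f) && validMask y.l y.f) := by
    decide +kernel
  have h := h.eq_true
  simp only [Bool.and_eq_true, decide_eq_true_eq, List.all_eq_true, beq_iff_eq,
    Bool.not_eq_true', List.isEmpty_eq_false_iff] at h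
  refine .of_tabVal h.1 (fun x hx p hp => ?_) fun x hx y hy p hp =>
    swapFixes_valC ((h.2 x hx).2 y hy).2 hp
  refine SwapFixes.total (h.2 x hx).1 fun y hy => swapFixes_valC ((h.2 x hx).2 y hy).2 ?_
  rw [← ((h.2 x hx).2 y hy).1, Nat.testBit_and, Bool.and_eq_true] at hp
  exact hp.2

/-- The letter with the code `c` is of type `0` and distinguishes its indices if and only if `b` is
even. -/
def validParity (b c : ℕ) : Bool :=
  decide (c / 256 = 0) && decide (1 ≤ c / 16 % 16) && decide (c / 16 % 16 ≤ 5) &&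
    decide (1 ≤ c % 16) && decide (c % 16 ≤ 5) && decide (b = if c / 16 % 16 = c % 16 then 1 else 0)

theorem vmap_swap_valC {b c : ℕ} (h : validParity b c = true) :
    vmap (permAut 10 5 (Equiv.swap 8 9)) (valC c) = (-1 : ℚ) ^ b • valC c := by
  simp only [validParity, Bool.and_eq_true, decide_eq_true_eq] at h
  obtain ⟨⟨⟨⟨⟨h0, h1⟩, h2⟩, h3⟩, h4⟩, rfl⟩ := h
  rw [valC, h0]
  by_cases hij : c / 16 % 16 = c % 16
  · rw [if_pos hij, ← hij, vmap_swap_singleton, pow_one, neg_one_smul]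
  · rw [if_neg hij, vmap_swap_pair h1 h2 h3 h4 hij, pow_zero, one_smul]

theorem vmap_swap_valS (c : ℕ) :
    vmap (permAut 10 5 (Equiv.swap 8 9)) (valS c) = (-1 : ℚ) ^ oddN c • valS c := by
  have h : Good (tabS.all fun x => x.o.all fun y => validParity (oddN x.c) y.l) := by
    decide +kernel
  have h := h.eq_true
  simp only [List.all_eq_true] at h
  refine tabVal_cases (P := fun c v => vmap (permAut 10 5 (Equiv.swap 8 9)) v =
    (-1 : ℚ) ^ oddN c • v) (fun c => ?_) (fun x hx => ?_) c
  · rw [map_zero, smul_zero]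
  · exact (map_total _ _ _).trans ((total_congr fun y hy => vmap_swap_valC (h x hx y hy)).trans
      (map_total (LinearMap.lsmul ℚ (VF K5) ((-1) ^ oddN x.c)) valC x.o).symm)

theorem onLetters_eq_zero_of_even {V M : Type*} [AddCommGroup V] [Module ℚ V] [AddCommGroup M]
    [Module ℚ M] {Fix : ℕ → V → Prop} {q : V → V → V → V → V → M} (hq : Alternating Fix q)
    (f : V →ₗ[ℚ] V) (hf : ∀ a b c d e, q (f a) (f b) (f c) (f d) (f e) = -q a b c d e)
    {val : ℕ → V} (hval : ∀ c, f (val c) = (-1 : ℚ) ^ oddN c • val c) (a b c d e : ℕ)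
    (h : (oddN a + (oddN b + (oddN c + (oddN d + oddN e)))) % 2 = 0) :
    onLetters q val a b c d e = 0 := by
  have h1 := hf (val a) (val b) (val c) (val d) (val e)
  rw [hval, hval, hval, hval, hval, (hq.lin1 _ _ _ _).map_smul, (hq.lin2 _ _ _ _).map_smul,
    (hq.lin3 _ _ _ _).map_smul, (hq.lin4 _ _ _ _).map_smul, (hq.lin5 _ _ _ _).map_smul, smul_smul,
    smul_smul, smul_smul, smul_smul, ← pow_add, ← pow_add, ← pow_add, ← pow_add,
    (Nat.even_iff.2 (by omega : _ % 2 = 0)).neg_one_pow, one_smul] at h1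
  have h2 : (2 : ℚ) • q (val a) (val b) (val c) (val d) (val e) = 0 := by
    rw [two_smul]
    nth_rewrite 1 [h1]
    exact neg_add_cancel _
  exact (smul_eq_zero.1 h2).resolve_left two_ne_zero

theorem onLetters_valS_eq_zero (a b c d e : ℕ)
    (h : (oddN a + (oddN b + (oddN c + (oddN d + oddN e)))) % 2 = 0) :
    onLetters aword valS a b c d e = 0 :=
  onLetters_eq_zero_of_even alternating_aword _
    (aword_odd (Equiv.Perm.sign_swap (by decide))) vmap_swap_valS a b c d e h

theorem total_four {V : Type*} [AddCommGroup V] [Module ℚ V] (val : ℕ → V) (a b c d f g h k : ℕ) :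
    total val [⟨0, 2, a, f⟩, ⟨0, 2, b, g⟩, ⟨1, 1, c, h⟩, ⟨1, 1, d, k⟩] =
      (2 : ℚ) • val a + (2 : ℚ) • val b - val c - val d := by
  simp [total, sg]
  abel

theorem letter_zero_succ_eq_total {i : ℕ} (h1 : 1 ≤ i) (h4 : i ≤ 4) (f g h k : ℕ) :
    letter 0 i (i + 1) = total valC [⟨0, 2, 256 * 3 + 16 * i + (i + 1), f⟩,
      ⟨0, 2, 256 * 4 + 16 * i + (i + 1), g⟩, ⟨1, 1, 256 * 2 + 16 * i + i, h⟩,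
      ⟨1, 1, 256 * 2 + 16 * (i + 1) + (i + 1), k⟩] := by
  rw [letter_zero_succ h1, total_four, valC_code _ (by omega) (by omega),
    valC_code _ (by omega) (by omega), valC_code _ (by omega) (by omega),
    valC_code _ (by omega) (by omega)]

theorem total_tabP : ∀ x ∈ tabP, valC x.c = total valC x.o := by
  simp only [tabP, List.forall_mem_cons, total_singleton, true_and]
  refine ⟨?_, ?_, ?_, ?_, by simp⟩
  · exact letter_zero_succ_eq_total (i := 1) (by omega) (by omega) _ _ _ _
  · exact letter_zero_succ_eq_total (i := 2) (by omega) (by omega) _ _ _ _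
  · exact letter_zero_succ_eq_total (i := 3) (by omega) (by omega) _ _ _ _
  · exact letter_zero_succ_eq_total (i := 4) (by omega) (by omega) _ _ _ _

theorem tabSpec_tabP : TabSpec SwapFixes valC valC tabP := by
  have h : Good (tabP.all fun x => validMask x.c x.f && x.o.all fun y => validMask y.l y.f) := by
    decide +kernel
  have h := h.eq_true
  simp only [Bool.and_eq_true, List.all_eq_true] at h
  exact ⟨total_tabP, fun x hx p hp => swapFixes_valC (h x hx).1 hp,
    fun x hx y hy p hp => swapFixes_valC ((h x hx).2 y hy) hp⟩

/-- The vectors with the labels `a`, `b`, `c`, `d` and `e` are distinct and marked by `p`. -/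
def validBracket (p a b c d e : ℕ) : Bool :=
  decide (Function.Injective ![L10 a, L10 b, L10 c, L10 d, L10 e]) &&
    (List.finRange 10).all fun v => p.testBit (5 * v) ==
      ((v == L10 a) || (v == L10 b) || (v == L10 c) || (v == L10 d) || (v == L10 e))

theorem valB_eq {p a b c d e : ℕ} (h : validBracket p a b c d e = true) :
    valB p = cls (d5 a b c d e) := by
  simp only [validBracket, Bool.and_eq_true, List.all_eq_true, decide_eq_true_eq, beq_iff_eq] at h
  refine IsBracket.valB_eq ⟨h.1, fun v => ?_⟩
  rw [h.2 v (List.mem_finRange v)]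
  simp only [Bool.or_eq_true, beq_iff_eq]
  constructor
  · rintro ((((h | h) | h) | h) | h)
    exacts [⟨0, h.symm⟩, ⟨1, h.symm⟩, ⟨2, h.symm⟩, ⟨3, h.symm⟩, ⟨4, h.symm⟩]
  · rintro ⟨k, rfl⟩
    fin_cases k
    exacts [.inl (.inl (.inl (.inl rfl))), .inl (.inl (.inl (.inr rfl))), .inl (.inl (.inr rfl)),
      .inl (.inr rfl), .inr rfl]

theorem letter_zero_eq_total {i p p' f f' : ℕ}
    (h : (validBracket p (M8 i) (M8 (i + 1)) (M8 (i + 2)) (M8 (i + 3)) 9 &&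
      validBracket p' (M8 i) (M8 (i + 1)) (M8 (i + 2)) (M8 (i + 3)) 0) = true) :
    letter 0 i i = total valB [⟨0, 1, p, f⟩, ⟨1, 1, p', f'⟩] := by
  rw [Bool.and_eq_true] at h
  have h1 := h.1
  have h2 := h.2
  simp only [validBracket, Bool.and_eq_true, decide_eq_true_eq] at h1 h2
  rw [letter, if_pos rfl, total_pair, valB_eq h.1, valB_eq h.2, rho5,
    cls_div (d5_ne_zero h1.1) (d5_ne_zero h2.1), pow_one, neg_one_smul, sub_eq_add_neg]

theorem letter_two_eq_total {i p p' f f' : ℕ}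
    (h : (validBracket p (M8 i) (M8 (i + 1)) (M8 (i + 2)) (M8 (i + 3)) 9 &&
      validBracket p' (M8 i) (M8 (i + 1)) (M8 (i + 2)) (M8 (i + 3)) 0) = true) :
    letter 2 i i = total valB [⟨0, 1, p, f⟩, ⟨0, 1, p', f'⟩] := by
  rw [Bool.and_eq_true] at h
  rw [letter, if_pos rfl, total_pair, valB_eq h.1, valB_eq h.2, pow_zero, one_smul]

theorem letter_three_eq_valB {i p : ℕ}
    (h : validBracket p (M8 i) (M8 (i + 1)) (M8 (i + 2)) (M8 (i + 3)) (M8 (i + 4)) = true) :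
    letter 3 i (i + 1) = valB p := by
  rw [letter, if_pos rfl, valB_eq h]

theorem letter_four_eq_valB {i p : ℕ}
    (h : validBracket p (M8 (i + 1)) (M8 (i + 2)) (M8 (i + 3)) 9 0 = true) :
    letter 4 i (i + 1) = valB p := by
  rw [letter, if_pos rfl, valB_eq h]

theorem total_tabB : ∀ x ∈ tabB, valC x.c = total valB x.o := by
  simp only [tabB, List.forall_mem_cons, total_singleton]
  refine ⟨letter_zero_eq_total (i := 1) (by decide), ?_⟩
  refine ⟨letter_two_eq_total (i := 1) (by decide), ?_⟩
  refine ⟨letter_three_eq_valB (i := 1) (by decide), ?_⟩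
  refine ⟨letter_four_eq_valB (i := 1) (by decide), ?_⟩
  refine ⟨letter_zero_eq_total (i := 2) (by decide), ?_⟩
  refine ⟨letter_two_eq_total (i := 2) (by decide), ?_⟩
  refine ⟨letter_three_eq_valB (i := 2) (by decide), ?_⟩
  refine ⟨letter_four_eq_valB (i := 2) (by decide), ?_⟩
  refine ⟨letter_zero_eq_total (i := 3) (by decide), ?_⟩
  refine ⟨letter_two_eq_total (i := 3) (by decide), ?_⟩
  refine ⟨letter_three_eq_valB (i := 3) (by decide), ?_⟩
  refine ⟨letter_four_eq_valB (i := 3) (by decide), ?_⟩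
  refine ⟨letter_zero_eq_total (i := 4) (by decide), ?_⟩
  refine ⟨letter_two_eq_total (i := 4) (by decide), ?_⟩
  refine ⟨letter_three_eq_valB (i := 4) (by decide), ?_⟩
  refine ⟨letter_four_eq_valB (i := 4) (by decide), ?_⟩
  refine ⟨letter_zero_eq_total (i := 5) (by decide), ?_⟩
  refine ⟨letter_two_eq_total (i := 5) (by decide), ?_⟩
  simp

theorem tabSpec_tabB : TabSpec SwapFixes valC valB tabB := by
  have h : Good (tabB.all fun x => validMask x.c x.f && x.o.all fun y =>
      validBracketMask y.l y.f) := by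
    decide +kernel
  have h := h.eq_true
  simp only [Bool.and_eq_true, List.all_eq_true] at h
  exact ⟨total_tabB, fun x hx p hp => swapFixes_valC (h x hx).1 hp,
    fun x hx y hy p hp => swapFixes_valB_of_mask ((h x hx).2 y hy) hp⟩

end GrassPoly

end

noncomputable section

namespace GrassPoly

open Kernel

theorem Kernel.onLetters_congr {V M : Type*} {q : V → V → V → V → V → M} {val : ℕ → V}
    {a b c d e : ℕ} {A B C D E : V} (ha : val a = A) (hb : val b = B) (hc : val c = C)
    (hd : val d = D) (he : val e = E) : onLetters q val a b c d e = q A B C D E := by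
  rw [onLetters, ha, hb, hc, hd, he]

theorem onLetters_valB_land {M : Type*} (q : VF K5 → VF K5 → VF K5 → VF K5 → VF K5 → M)
    (a b c d e : ℕ) :
    onLetters q valB (Nat.land a fstMask) (Nat.land b fstMask) (Nat.land c fstMask)
      (Nat.land d fstMask) (Nat.land e fstMask) = onLetters q valB a b c d e :=
  onLetters_congr (valB_land a) (valB_land b) (valB_land c) (valB_land d) (valB_land e)

theorem Kernel.add_smul_congr {M : Type*} [AddCommGroup M] [Module ℚ M] {r : ℚ} {x y z : M}
    (h : x + r • y = 0) (e : y = z) : x + r • z = 0 :=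
  e ▸ h

theorem sum_baseWords_aword :
    (10 : ℚ) • (baseWords.map fun w => sg w.s w.m • onLetters aword valF w.a w.b w.c w.d w.e).sum +
      (14400 : ℚ) • aword (cls (d5 1 2 3 4 5)) (cls (d5 2 3 4 5 6)) (cls (d5 3 4 5 6 7))
        (cls (d5 4 5 6 7 8)) (cls (d5 5 6 7 8 9)) = 0 := by
  have h := sum_baseWords good_verify.eq_true alternating_aword tabSpec_tabF tabSpec_tabS
      tabSpec_tabP
    tabSpec_tabB leads_aword onLetters_valS_eq_zero valC_shift valC_flip (onLetters_valB_land _)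
    skew_valB
  exact add_smul_congr h (onLetters_congr (valB_eq (by decide))
    (valB_eq (by decide)) (valB_eq (by decide)) (valB_eq (by decide))
    (valB_eq (by decide)))

end GrassPoly

end

noncomputable section

namespace GrassPoly

variable {F : Type} [Field F]

theorem snoc_tens0 (x : VF F) : snoc (tens ![]) x = tens ![x] := by
  rw [tens, snoc_tprod]
  congr 1
  ext i
  fin_cases i
  rfl

theorem tCoef_self_left {a q : F} (h : a ≠ q) : tCoef a a q = cls (q - a) := by
  rw [tCoef, if_pos rfl, if_neg h]

theorem tCoef_self (a : F) : tCoef a a a = 0 := by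
  rw [tCoef, if_pos rfl, if_pos rfl]

theorem tCoef_self_right {p a : F} (h : p ≠ a) : tCoef p a a = -cls (p - a) := by
  rw [tCoef, if_neg h, if_pos rfl]

theorem tCoef_of_ne {p a q : F} (h : p ≠ a) (h' : a ≠ q) :
    tCoef p a q = cls (q - a) - cls (p - a) := by
  rw [tCoef, if_neg h, if_neg h', cls_div (sub_ne_zero.2 h'.symm) (sub_ne_zero.2 h)]

theorem tCoef_zero_zero_one : tCoef (0 : F) 0 1 = 0 := by
  rw [tCoef_self_left zero_ne_one, sub_zero, cls_one]

theorem tCoef_zero_zero {x : F} (hx : x ≠ 0) : tCoef 0 0 x = cls x := by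
  rw [tCoef_self_left hx.symm, sub_zero]

theorem tCoef_zero_left_right {x : F} (hx : x ≠ 0) : tCoef 0 x 0 = 0 := by
  rw [tCoef_of_ne hx.symm hx, sub_self]

theorem tCoef_zero_one {x : F} (hx : x ≠ 0) (hx' : x ≠ 1) :
    tCoef 0 x 1 = cls (1 - x) - cls x := by
  rw [tCoef_of_ne hx.symm hx', zero_sub, cls_neg]

theorem tCoef_mid_zero_one {x : F} (hx : x ≠ 0) : tCoef x 0 1 = -cls x := by
  rw [tCoef_of_ne hx zero_ne_one, sub_zero, sub_zero, cls_one, zero_sub]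

theorem tCoef_right_zero {x : F} (hx : x ≠ 0) : tCoef x 0 0 = -cls x := by
  rw [tCoef_self_right hx, sub_zero]

theorem tCoef_mid_zero {x y : F} (hx : x ≠ 0) (hy : y ≠ 0) : tCoef x 0 y = cls y - cls x := by
  rw [tCoef_of_ne hx hy.symm, sub_zero, sub_zero]

theorem tCoef_zero_left {x y : F} (hx : x ≠ 0) (h : x ≠ y) :
    tCoef 0 x y = cls (x - y) - cls x := by
  rw [tCoef_of_ne hx.symm h, zero_sub, cls_neg, cls_sub_comm]

theorem SIaux_one (x : F) : SIaux 1 0 [x] 1 rfl = tens ![tCoef 0 x 1] := by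
  refine (Fin.sum_univ_one _).trans ((snoc_tens0 _).symm.trans ?_).symm
  change snoc (tens ![]) _ = snoc (SIaux 0 0 [] 1 rfl) _
  congr 2

theorem SIaux_zeros2 {x : F} (hx : x ≠ 0) :
    SIaux 2 0 [x, 0] 1 rfl = snoc (SIaux 1 0 [x] 1 rfl) (-cls x) := by
  refine (Fin.sum_univ_two _).trans ?_
  change snoc _ (tCoef 0 x 0) + snoc (SIaux 1 0 [x] 1 rfl) (tCoef x 0 1) = _
  rw [tCoef_zero_left_right hx, tCoef_mid_zero_one hx, map_zero, zero_add]

theorem SIaux_zeros3 {x : F} (hx : x ≠ 0) :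
    SIaux 3 0 [x, 0, 0] 1 rfl = snoc (SIaux 2 0 [x, 0] 1 rfl) (-cls x) := by
  refine (Fin.sum_univ_three _).trans ?_
  change snoc _ (tCoef 0 x 0) + snoc (SIaux 2 0 [x, 0] 1 rfl) (tCoef x 0 0) +
    snoc _ (tCoef 0 0 1) = _
  rw [tCoef_zero_left_right hx, tCoef_right_zero hx, tCoef_zero_zero_one, map_zero, map_zero,
    zero_add, add_zero]

theorem SIaux_zeros4 {x : F} (hx : x ≠ 0) :
    SIaux 4 0 [x, 0, 0, 0] 1 rfl = snoc (SIaux 3 0 [x, 0, 0] 1 rfl) (-cls x) := by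
  refine (Fin.sum_univ_four _).trans ?_
  change snoc _ (tCoef 0 x 0) + snoc (SIaux 3 0 [x, 0, 0] 1 rfl) (tCoef x 0 0) +
    snoc _ (tCoef 0 0 0) + snoc _ (tCoef 0 0 1) = _
  rw [tCoef_zero_left_right hx, tCoef_right_zero hx, tCoef_zero_zero_one, tCoef_self, map_zero,
    map_zero, map_zero, zero_add, add_zero, add_zero]

theorem SIaux_zeros5 {x : F} (hx : x ≠ 0) :
    SIaux 5 0 [x, 0, 0, 0, 0] 1 rfl = snoc (SIaux 4 0 [x, 0, 0, 0] 1 rfl) (-cls x) := by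
  refine (Fin.sum_univ_five _).trans ?_
  change snoc _ (tCoef 0 x 0) + snoc (SIaux 4 0 [x, 0, 0, 0] 1 rfl) (tCoef x 0 0) +
    snoc _ (tCoef 0 0 0) + snoc _ (tCoef 0 0 0) + snoc _ (tCoef 0 0 1) = _
  rw [tCoef_zero_left_right hx, tCoef_right_zero hx, tCoef_zero_zero_one, tCoef_self, map_zero,
    map_zero, map_zero, map_zero, zero_add, add_zero, add_zero, add_zero]

theorem SIaux_two {x y : F} (hx : x ≠ 0) (hxy : x ≠ y) (hy : y ≠ 1) : SIaux 2 0 [x, y] 1 rfl =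
    snoc (SIaux 1 0 [y] 1 rfl) (cls (x - y) - cls x) +
      snoc (SIaux 1 0 [x] 1 rfl) (cls (1 - y) - cls (x - y)) := by
  refine (Fin.sum_univ_two _).trans ?_
  change snoc (SIaux 1 0 [y] 1 rfl) (tCoef 0 x y) + snoc (SIaux 1 0 [x] 1 rfl) (tCoef x y 1) = _
  rw [tCoef_zero_left hx hxy, tCoef_of_ne hxy hy]

theorem SIaux_three {x y : F} (hx : x ≠ 0) (hy : y ≠ 0) (hy' : y ≠ 1) :
    SIaux 3 0 [x, 0, y] 1 rfl = snoc (SIaux 2 0 [x, y] 1 rfl) (cls y - cls x) +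
      snoc (SIaux 2 0 [x, 0] 1 rfl) (cls (1 - y) - cls y) := by
  refine (Fin.sum_univ_three _).trans ?_
  change snoc _ (tCoef 0 x 0) + snoc (SIaux 2 0 [x, y] 1 rfl) (tCoef x 0 y) +
    snoc (SIaux 2 0 [x, 0] 1 rfl) (tCoef 0 y 1) = _
  rw [tCoef_zero_left_right hx, tCoef_mid_zero hx hy, tCoef_zero_one hy hy', map_zero, zero_add]

theorem SIaux_four {x y : F} (hx : x ≠ 0) (hy : y ≠ 0) (hy' : y ≠ 1) :
    SIaux 4 0 [x, 0, 0, y] 1 rfl = snoc (SIaux 3 0 [x, 0, y] 1 rfl) (cls y - cls x) +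
      snoc (SIaux 3 0 [x, 0, 0] 1 rfl) (cls (1 - y) - cls y) := by
  refine (Fin.sum_univ_four _).trans ?_
  change snoc _ (tCoef 0 x 0) + snoc (SIaux 3 0 [x, 0, y] 1 rfl) (tCoef x 0 0) +
    snoc (SIaux 3 0 [x, 0, y] 1 rfl) (tCoef 0 0 y) +
    snoc (SIaux 3 0 [x, 0, 0] 1 rfl) (tCoef 0 y 1) = _
  rw [tCoef_zero_left_right hx, tCoef_right_zero hx, tCoef_zero_zero hy, tCoef_zero_one hy hy',
    map_zero, zero_add, ← map_add, neg_add_eq_sub]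

theorem SIaux_five {x y : F} (hx : x ≠ 0) (hy : y ≠ 0) (hy' : y ≠ 1) :
    SIaux 5 0 [x, 0, 0, 0, y] 1 rfl = snoc (SIaux 4 0 [x, 0, 0, y] 1 rfl) (cls y - cls x) +
      snoc (SIaux 4 0 [x, 0, 0, 0] 1 rfl) (cls (1 - y) - cls y) := by
  refine (Fin.sum_univ_five _).trans ?_
  change snoc _ (tCoef 0 x 0) + snoc (SIaux 4 0 [x, 0, 0, y] 1 rfl) (tCoef x 0 0) +
    snoc _ (tCoef 0 0 0) + snoc (SIaux 4 0 [x, 0, 0, y] 1 rfl) (tCoef 0 0 y) +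
    snoc (SIaux 4 0 [x, 0, 0, 0] 1 rfl) (tCoef 0 y 1) = _
  rw [tCoef_zero_left_right hx, tCoef_right_zero hx, tCoef_self, tCoef_zero_zero hy,
    tCoef_zero_one hy hy', map_zero, map_zero, zero_add, add_zero, ← map_add, neg_add_eq_sub]

theorem SI41_eq {x y : F} (hx : x ≠ 0) (hx' : x ≠ 1) (hy : y ≠ 0) (hy' : y ≠ 1) (hxy : x ≠ y) :
    SI41 x y =
      tens ![cls (1 - y) - cls y, cls (x - y) - cls x, cls y - cls x, cls y - cls x,
        cls y - cls x] +
      tens ![cls (1 - x) - cls x, cls (1 - y) - cls (x - y), cls y - cls x, cls y - cls x,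
        cls y - cls x] +
      tens ![cls (1 - x) - cls x, -cls x, cls (1 - y) - cls y, cls y - cls x, cls y - cls x] +
      tens ![cls (1 - x) - cls x, -cls x, -cls x, cls (1 - y) - cls y, cls y - cls x] +
      tens ![cls (1 - x) - cls x, -cls x, -cls x, -cls x, cls (1 - y) - cls y] := by
  rw [SI41, SIaux_five hx hy hy', SIaux_four hx hy hy', SIaux_three hx hy hy',
    SIaux_two hx hxy hy', SIaux_zeros4 hx, SIaux_zeros3 hx, SIaux_zeros2 hx, SIaux_one, SIaux_one,
    tCoef_zero_one hx hx', tCoef_zero_one hy hy']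
  simp only [map_add, LinearMap.add_apply, snoc_tens1, snoc_tens2, snoc_tens3, snoc_tens4]

theorem SLi5_eq {x : F} (hx : x ≠ 0) (hx' : x ≠ 1) :
    SLi5 x = -tens ![cls (1 - x), cls x, cls x, cls x, cls x] := by
  have h0 : x⁻¹ ≠ 0 := inv_ne_zero hx
  have h1 : x⁻¹ ≠ 1 := fun h => hx' (inv_eq_one.1 h)
  have hc : cls (1 - x⁻¹) - cls x⁻¹ = cls (1 - x) := by
    have h : 1 - x⁻¹ = (x - 1) / x := by field_simp
    rw [h, cls_div (sub_ne_zero.2 hx') hx, cls_inv, sub_neg_eq_add, sub_add_cancel, cls_sub_comm]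
  rw [SLi5, SIaux_zeros5 h0, SIaux_zeros4 h0, SIaux_zeros3 h0, SIaux_zeros2 h0, SIaux_one,
    tCoef_zero_one h0 h1, hc, cls_inv, neg_neg]
  simp only [snoc_tens1, snoc_tens2, snoc_tens3, snoc_tens4]

end GrassPoly

end

noncomputable section

namespace GrassPoly

namespace Kernel

variable {V M : Type*} [AddCommGroup V] [Module ℚ V] [AddCommGroup M] [Module ℚ M]

/-- A function which is linear in each of five vectors and vanishes on shuffle products. -/
structure Shuffling (q : V → V → V → V → V → M) : Prop where
  lin1 : ∀ b c d e, IsLinearMap ℚ fun a => q a b c d e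
  lin2 : ∀ a c d e, IsLinearMap ℚ fun b => q a b c d e
  lin3 : ∀ a b d e, IsLinearMap ℚ fun c => q a b c d e
  lin4 : ∀ a b c e, IsLinearMap ℚ fun d => q a b c d e
  lin5 : ∀ a b c d, IsLinearMap ℚ fun e => q a b c d e
  leads : ∀ val, Leads (onLetters q val)

variable {q : V → V → V → V → V → M} (hq : Shuffling q)

namespace Shuffling

include hq

theorem two (a b c d e : V) :
    q a b c d e = -(q b a c d e + (q b c a d e + (q b c d a e + q b c d e a))) :=
  (hq.leads fun n => [a, b, c, d, e].getD n 0).two 0 1 2 3 4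

theorem three (a b c d e : V) : q a b c d e =
    q c b a d e + (q c b d a e + (q c b d e a + (q c d b a e + (q c d b e a + q c d e b a)))) :=
  (hq.leads fun n => [a, b, c, d, e].getD n 0).three 0 1 2 3 4

theorem four (a b c d e : V) :
    q a b c d e = -(q d c b a e + (q d c b e a + (q d c e b a + q d e c b a))) :=
  (hq.leads fun n => [a, b, c, d, e].getD n 0).four 0 1 2 3 4

theorem five (a b c d e : V) : q a b c d e = q e d c b a :=
  (hq.leads fun n => [a, b, c, d, e].getD n 0).five 0 1 2 3 4

theorem add1 (a a' b c d e : V) : q (a + a') b c d e = q a b c d e + q a' b c d e :=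
  (hq.lin1 b c d e).map_add a a'

theorem add2 (a b b' c d e : V) : q a (b + b') c d e = q a b c d e + q a b' c d e :=
  (hq.lin2 a c d e).map_add b b'

theorem add3 (a b c c' d e : V) : q a b (c + c') d e = q a b c d e + q a b c' d e :=
  (hq.lin3 a b d e).map_add c c'

theorem add4 (a b c d d' e : V) : q a b c (d + d') e = q a b c d e + q a b c d' e :=
  (hq.lin4 a b c e).map_add d d'

theorem add5 (a b c d e e' : V) : q a b c d (e + e') = q a b c d e + q a b c d e' :=
  (hq.lin5 a b c d).map_add e e'

theorem sub1 (a a' b c d e : V) : q (a - a') b c d e = q a b c d e - q a' b c d e :=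
  (hq.lin1 b c d e).map_sub a a'

theorem sub2 (a b b' c d e : V) : q a (b - b') c d e = q a b c d e - q a b' c d e :=
  (hq.lin2 a c d e).map_sub b b'

theorem sub3 (a b c c' d e : V) : q a b (c - c') d e = q a b c d e - q a b c' d e :=
  (hq.lin3 a b d e).map_sub c c'

theorem sub4 (a b c d d' e : V) : q a b c (d - d') e = q a b c d e - q a b c d' e :=
  (hq.lin4 a b c e).map_sub d d'

theorem sub5 (a b c d e e' : V) : q a b c d (e - e') = q a b c d e - q a b c d e' :=
  (hq.lin5 a b c d).map_sub e e'

theorem neg2 (a b c d e : V) : q a (-b) c d e = -q a b c d e := (hq.lin2 a c d e).map_neg b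

theorem neg3 (a b c d e : V) : q a b (-c) d e = -q a b c d e := (hq.lin3 a b d e).map_neg c

theorem neg4 (a b c d e : V) : q a b c (-d) e = -q a b c d e := (hq.lin4 a b c e).map_neg d

theorem neg5 (a b c d e : V) : q a b c d (-e) = -q a b c d e := (hq.lin5 a b c d).map_neg e

theorem smul1 (r : ℚ) (a b c d e : V) : q (r • a) b c d e = r • q a b c d e :=
  (hq.lin1 b c d e).map_smul r a

theorem smul2 (r : ℚ) (a b c d e : V) : q a (r • b) c d e = r • q a b c d e :=
  (hq.lin2 a c d e).map_smul r b

theorem smul3 (r : ℚ) (a b c d e : V) : q a b (r • c) d e = r • q a b c d e :=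
  (hq.lin3 a b d e).map_smul r c

theorem smul4 (r : ℚ) (a b c d e : V) : q a b c (r • d) e = r • q a b c d e :=
  (hq.lin4 a b c e).map_smul r d

theorem smul5 (r : ℚ) (a b c d e : V) : q a b c d (r • e) = r • q a b c d e :=
  (hq.lin5 a b c d).map_smul r e

theorem sum_insert_single (m y z : V) :
    q m (z + y) z z z + q (z + y) m z z z + q (z + y) (z + y) m z z +
      q (z + y) (z + y) (z + y) m z + q (z + y) (z + y) (z + y) (z + y) m =
    q m y z z z + q m y y y y := by
  rw [hq.two _ m, hq.three _ _ m, hq.four _ _ _ m, hq.five _ _ _ _ m]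
  simp only [hq.add2, hq.add3, hq.add4, hq.add5]
  abel

theorem sum_insert_sum (y z : V) :
    q y (z + y) z z z + q (z + y) (z + y) y z z + q (z + y) (z + y) (z + y) y z +
      q (z + y) (z + y) (z + y) (z + y) y = -q z y z z z := by
  simp only [hq.add1, hq.add2, hq.add3, hq.add4]
  linear_combination (norm := module) (1 / 5 : ℚ) • hq.four y y y y y - hq.four y y y y z -
    hq.three y z y y y + hq.four z y y y y - hq.three y y z z z + hq.two y y z z z +
    hq.two y z z z z + hq.two z z y y y - hq.three z z y y y

end Shuffling

end Kernel

end GrassPoly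

end

noncomputable section

namespace GrassPoly

namespace Kernel

variable {V M : Type*} [AddCommGroup V] [Module ℚ V] [AddCommGroup M] [Module ℚ M]

/-- The terms of the symbol of `I_{4,1}` that involve the difference of its arguments, modulo
shuffle products. -/
def insertion (q : V → V → V → V → V → M) (d u z : V) : M :=
  q d u z z z + q d z u z z + q d z z u z + q d z z z u

/-- The terms of the symbol of `I_{4,1}` that do not involve the difference of its arguments,
modulo shuffle products. -/
def remainder (q : V → V → V → V → V → M) (x y z v p r : V) : M :=
  -q p r z z z - q p x v z z - q p x x v z - q p x x x v + q r y z z z + q r y y y y + q z y z z z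

/-- The symbol of `I_{4,1}`. -/
def fourOne (q : V → V → V → V → V → M) (x y p r d : V) : M :=
  -q (r - y) (d - x) (x - y) (x - y) (x - y) - q (p - x) (r - d) (x - y) (x - y) (x - y) -
    q (p - x) x (r - y) (x - y) (x - y) - q (p - x) x x (r - y) (x - y) -
    q (p - x) x x x (r - y)

namespace Shuffling

variable {q : V → V → V → V → V → M} (hq : Shuffling q)

include hq

theorem insertion_add (b d u z : V) :
    insertion q (d + b) u z = insertion q b u z + insertion q d u z := by
  simp only [insertion, hq.add1]
  abel

theorem insertion_combination (b u v z : V) :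
    insertion q b u z + (2 : ℚ) • insertion q b v z - (8 : ℚ) • q b z z z z =
      insertion q b (u + (2 : ℚ) • v - (2 : ℚ) • z) z := by
  simp only [insertion, hq.add2, hq.add3, hq.add4, hq.add5, hq.sub2, hq.sub3, hq.sub4, hq.sub5,
    hq.smul2, hq.smul3, hq.smul4, hq.smul5]
  module

/-- The symbol of `I_{4,1}` modulo shuffle products. -/
theorem fourOne_eq_insertion_add_remainder (x y p r d : V) :
    fourOne q x y p r d =
    insertion q d (r - p + (x - y)) (x - y) + remainder q x y (x - y) (r - y) p r := by
  obtain ⟨z, hz⟩ : ∃ z, x - y = z := ⟨_, rfl⟩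
  have hr := hq.sum_insert_single r y z
  have hy := hq.sum_insert_sum y z
  rw [fourOne, hz]
  obtain rfl : x = z + y := by rw [← hz, sub_add_cancel]
  obtain ⟨x, hx⟩ : ∃ x, z + y = x := ⟨_, rfl⟩
  rw [hx] at hr hy ⊢
  have hz : z = x - y := by rw [← hx, add_sub_cancel_right]
  have hu : ∀ u, insertion q d u z = -q u d z z z := by
    intro u
    rw [hq.two u d, neg_neg, insertion]
    abel
  have hu : insertion q d (r - p + z) z = -q r d z z z + q p d z z z - q x d z z z +
      q y d z z z := by
    have hd := hq.sub1 x y d z z z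
    rw [← hz] at hd
    rw [hu, hq.add1, hq.sub1, hd]
    abel
  rw [hu]
  simp only [remainder, hq.sub1, hq.sub2, hq.sub3, hq.sub4, hq.sub5]
  linear_combination (norm := module) hr - hy

theorem fourOne_eq {x y z v p r b c d u : V} (hd : c + b = d) (hz : x - y = z) (hv : r - y = v)
    (hu : r - p + z = u) : fourOne q x y p r d =
      insertion q b u z + (insertion q c u z + remainder q x y z v p r) := by
  rw [hq.fourOne_eq_insertion_add_remainder, ← hd, hz, hv, hu, hq.insertion_add, add_assoc]

theorem five_eq {p c b z : V} (hd : c + b = p) :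
    -q p z z z z = -q b (-z) (-z) (-z) (-z) - q c z z z z := by
  rw [← hd, hq.add1, hq.neg2, hq.neg3, hq.neg4, hq.neg5, neg_neg, neg_neg]
  abel

omit hq in
theorem eq_zero_of_eq_neg {x : M} (h : x = -x) : x = 0 := by
  have h2 : (2 : ℚ) • x = 0 := by
    rw [two_smul]
    nth_rewrite 1 [h]
    exact neg_add_cancel x
  exact (smul_eq_zero.1 h2).resolve_left two_ne_zero

theorem insertion_eq_zero_of_neg_right {f : V → V}
    (hf : ∀ a b c d e, q (f a) (f b) (f c) (f d) (f e) = q a b c d e) {b u z : V} (hb : f b = b)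
    (hu : f u = u) (hz : f z = -z) : insertion q b u z = 0 := by
  have h1 := hf b u z z z
  have h2 := hf b z u z z
  have h3 := hf b z z u z
  have h4 := hf b z z z u
  rw [hb, hu, hz] at h1 h2 h3 h4
  simp only [hq.neg2, hq.neg3, hq.neg4, hq.neg5, neg_neg] at h1 h2 h3 h4
  rw [insertion, eq_zero_of_eq_neg h1.symm, eq_zero_of_eq_neg h2.symm, eq_zero_of_eq_neg h3.symm,
    eq_zero_of_eq_neg h4.symm, add_zero, add_zero, add_zero]

theorem insertion_eq_zero_of_neg_left {f : V → V}
    (hf : ∀ a b c d e, q (f a) (f b) (f c) (f d) (f e) = q a b c d e) {b u z : V} (hb : f b = b)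
    (hu : f u = -u) (hz : f z = z) : insertion q b u z = 0 := by
  have h1 := hf b u z z z
  have h2 := hf b z u z z
  have h3 := hf b z z u z
  have h4 := hf b z z z u
  rw [hb, hu, hz] at h1 h2 h3 h4
  simp only [hq.neg2, hq.neg3, hq.neg4, hq.neg5] at h1 h2 h3 h4
  rw [insertion, eq_zero_of_eq_neg h1.symm, eq_zero_of_eq_neg h2.symm, eq_zero_of_eq_neg h3.symm,
    eq_zero_of_eq_neg h4.symm, add_zero, add_zero, add_zero]

end Shuffling

end Kernel

end GrassPoly

end

noncomputable section

namespace GrassPoly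

namespace Kernel

variable {V M : Type*} [AddCommGroup V] [Module ℚ V] [AddCommGroup M] [Module ℚ M]

/-- The letters of the symbols of the six terms, where the two quadratic letters are replaced
by combinations of the other ones. -/
def form (r : ℕ → ℕ → V) (h : ℕ → V) (k : ℕ) : V :=
  [-r 1 2 - r 4 5,
    r 3 5 - r 1 3 + r 2 3 - r 3 4,
    r 2 3 - r 1 2 - r 3 4 + r 4 5,
    r 1 3 - r 1 2,
    r 3 5 - r 4 5,
    r 2 3 - r 1 2,
    r 3 5 - r 3 4,
    r 3 4 - r 4 5,
    -r 1 4 - r 2 3,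
    r 1 3 + r 2 4 - r 1 5 - r 1 2 - r 3 4 + r 4 5,
    r 1 5 - r 1 4,
    r 1 3 + r 2 4 - r 2 3 - r 1 4,
    r 4 5 - r 1 4,
    r 1 3 + r 2 4 - r 1 2 - r 3 4,
    r 1 2 + r 3 4 - r 2 3 - r 1 4,
    -r 2 3 - r 4 5,
    r 1 2 + r 3 4 - r 2 3 - r 4 5,
    -r 2 3 - r 1 4 + (1 / 2 : ℚ) • (h 1 + h 2 + h 3 + h 4),
    h 4 - h 1 - r 1 3 - r 2 4 + r 1 2 + r 3 4,
    r 1 2 + r 3 4 - r 2 3 - h 1,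
    h 4 - r 1 4,
    h 4 - h 1,
    h 1 - r 1 4,
    -h 1 - r 3 4 + (1 / 2 : ℚ) • (h 1 + h 2 + h 3 + h 4),
    r 2 4 - h 2 + r 1 2 - r 2 3,
    h 2 - h 1,
    r 2 4 - r 3 4,
    r 1 2 - h 1,
    r 2 4 - r 2 3,
    r 2 3 - r 3 4,
    -r 1 2 - r 3 4 + (1 / 2 : ℚ) • (h 1 + h 2 + h 3 + h 4),
    h 1 + r 2 3 - r 1 2 - r 3 4].getD k 0

theorem total_tabF {r : ℕ → ℕ → V} {h : ℕ → V} {val w : ℕ → V}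
    (hval : ∀ i j, 1 ≤ i → j ≤ 5 → i < j → val (16 * i + j) = (2 : ℚ) • r i j - h i - h j)
    (hval' : ∀ i, 1 ≤ i → i ≤ 5 → val (16 * i + i) = h i)
    (hw : ∀ x ∈ tabS, w x.c = total val x.o) :
    ∀ x ∈ tabF, total w x.o = (2 : ℚ) • form r h (x.c - 4096) := by
  have h12 := hval 1 2 (by omega) (by omega) (by omega)
  have h13 := hval 1 3 (by omega) (by omega) (by omega)
  have h14 := hval 1 4 (by omega) (by omega) (by omega)
  have h15 := hval 1 5 (by omega) (by omega) (by omega)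
  have h23 := hval 2 3 (by omega) (by omega) (by omega)
  have h24 := hval 2 4 (by omega) (by omega) (by omega)
  have h34 := hval 3 4 (by omega) (by omega) (by omega)
  have h35 := hval 3 5 (by omega) (by omega) (by omega)
  have h45 := hval 4 5 (by omega) (by omega) (by omega)
  have h1 := hval' 1 (by omega) (by omega)
  have h2 := hval' 2 (by omega) (by omega)
  have h3 := hval' 3 (by omega) (by omega)
  have h4 := hval' 4 (by omega) (by omega)
  have h5 := hval' 5 (by omega) (by omega)
  simp only [Nat.reduceMul, Nat.reduceAdd] at h12 h13 h14 h15 h23 h24 h34 h35 h45 h1 h2 h3 h4 h5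
  simp only [tabS, List.forall_mem_cons, List.not_mem_nil, false_imp_iff, implies_true, total,
    List.map_cons, List.map_nil, List.sum_cons, List.sum_nil, add_zero, sg, pow_zero, pow_one,
    Nat.cast_one, one_mul, mul_one, one_smul, neg_one_smul, h12, h13, h14, h15, h23, h24, h34,
    h35, h45, h1, h2, h3, h4, h5, and_true] at hw
  simp only [tabF, List.forall_mem_cons, List.not_mem_nil, false_imp_iff, implies_true, total,
    List.map_cons, List.map_nil, List.sum_cons, List.sum_nil, add_zero, sg, pow_zero,
    Nat.cast_one, mul_one, one_smul, hw, and_true, Nat.reduceSub]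
  and_intros <;> simp only [form, List.getD_cons_succ, List.getD_cons_zero] <;> module

variable {q : V → V → V → V → V → M}

theorem Shuffling.sum_baseWords_eq (hq : Shuffling q) {f val : ℕ → V}
    (h : ∀ k < 32, val (k + 4096) = (2 : ℚ) • f k) :
    (baseWords.map fun w => sg w.s w.m • onLetters q val w.a w.b w.c w.d w.e).sum = (32 : ℚ) •
      (insertion q (f 0) (f 1) (f 2) + remainder q (f 5) (f 7) (f 2) (f 6) (f 3) (f 4) +
      (2 : ℚ) • (insertion q (f 8) (f 9) (f 2) +
        remainder q (f 12) (f 14) (f 2) (f 13) (f 10) (f 11)) -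
      (8 : ℚ) • q (f 15) (f 16) (f 16) (f 16) (f 16) +
      (insertion q (f 17) (f 18) (f 19) + remainder q (f 14) (f 22) (f 19) (f 21) (f 11) (f 20)) +
      (2 : ℚ) • (insertion q (f 23) (f 24) (f 19) +
        remainder q (f 27) (f 29) (f 19) (f 28) (f 25) (f 26)) -
      (8 : ℚ) • q (f 30) (f 31) (f 31) (f 31) (f 31)) := by
  have hb : (baseWords.all fun w => decide ((4096 ≤ w.a ∧ w.a < 4128) ∧ (4096 ≤ w.b ∧ w.b < 4128) ∧
      (4096 ≤ w.c ∧ w.c < 4128) ∧ (4096 ≤ w.d ∧ w.d < 4128) ∧ (4096 ≤ w.e ∧ w.e < 4128))) =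
          true := by
    decide
  simp only [List.all_eq_true, decide_eq_true_eq] at hb
  have hf (c : ℕ) (hc : 4096 ≤ c ∧ c < 4128) : val c = (2 : ℚ) • f (c - 4096) := by
    rw [← h _ (by omega), Nat.sub_add_cancel hc.1]
  have hw : ∀ w ∈ baseWords, sg w.s w.m • onLetters q val w.a w.b w.c w.d w.e =
      (32 : ℚ) • sg w.s w.m • onLetters q (fun c => f (c - 4096)) w.a w.b w.c w.d w.e := by
    intro w hw
    obtain ⟨ha, hb, hc, hd, he⟩ := hb w hw
    rw [onLetters, hf _ ha, hf _ hb, hf _ hc, hf _ hd, hf _ he, hq.smul1, hq.smul2, hq.smul3,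
      hq.smul4, hq.smul5, onLetters]
    module
  rw [List.map_congr_left hw]
  simp only [baseWords, List.map_cons, List.map_nil, List.sum_cons, List.sum_nil, onLetters, sg,
    Nat.reduceSub, insertion, remainder]
  module

end Kernel

end GrassPoly

end

noncomputable section

namespace GrassPoly

namespace Kernel

variable {V M : Type*} [AddCommGroup V] [Module ℚ V] [AddCommGroup M] [Module ℚ M]
  {q : V → V → V → V → V → M}

namespace Shuffling

variable (hq : Shuffling q)

include hq

/-- In the combination of two terms `I_{4,1}` and a term `Li_5` whose symbols involve `b`, the
contribution of `b` vanishes. -/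
theorem fourOne_add_five {b z x y p r v u c x' y' p' r' v' u' c' z₁ c₁ : V}
    (hb : insertion q b (u + (2 : ℚ) • u' - (2 : ℚ) • z) z = 0)
    (hz : x - y = z) (hv : r - y = v) (hu : r - p + z = u)
    (hz' : x' - y' = z) (hv' : r' - y' = v') (hu' : r' - p' + z = u') (hz₁ : -z₁ = z) :
    fourOne q x y p r (c + b) + (2 : ℚ) • fourOne q x' y' p' r' (c' + b) +
        (8 : ℚ) • -q (c₁ + b) z₁ z₁ z₁ z₁ =
      insertion q c u z + remainder q x y z v p r +
        (2 : ℚ) • (insertion q c' u' z + remainder q x' y' z v' p' r') -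
        (8 : ℚ) • q c₁ z₁ z₁ z₁ z₁ := by
  rw [hq.fourOne_eq rfl hz hv hu, hq.fourOne_eq rfl hz' hv' hu', hq.five_eq rfl, hz₁]
  have h := hq.insertion_combination b u u' z
  rw [hb] at h
  linear_combination (norm := module) h

theorem form_combination {f : ℕ → V} {r : ℕ → ℕ → V} {h : ℕ → V} (hf : form r h = f) {b b' : V}
    (hb : insertion q b (f 1 + (2 : ℚ) • f 9 - (2 : ℚ) • f 2) (f 2) = 0)
    (hb' : insertion q b' (f 18 + (2 : ℚ) • f 24 - (2 : ℚ) • f 19) (f 19) = 0) :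
    fourOne q (f 5) (f 7) (f 3) (f 4) (f 0 + b) +
        (2 : ℚ) • fourOne q (f 12) (f 14) (f 10) (f 11) (f 8 + b) +
        (8 : ℚ) • -q (f 15 + b) (f 16) (f 16) (f 16) (f 16) +
        fourOne q (f 14) (f 22) (f 11) (f 20) (f 17 + b') +
        (2 : ℚ) • fourOne q (f 27) (f 29) (f 25) (f 26) (f 23 + b') +
        (8 : ℚ) • -q (f 30 + b') (f 31) (f 31) (f 31) (f 31) =
      insertion q (f 0) (f 1) (f 2) + remainder q (f 5) (f 7) (f 2) (f 6) (f 3) (f 4) +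
      (2 : ℚ) • (insertion q (f 8) (f 9) (f 2) +
        remainder q (f 12) (f 14) (f 2) (f 13) (f 10) (f 11)) -
      (8 : ℚ) • q (f 15) (f 16) (f 16) (f 16) (f 16) +
      (insertion q (f 17) (f 18) (f 19) + remainder q (f 14) (f 22) (f 19) (f 21) (f 11) (f 20)) +
      (2 : ℚ) • (insertion q (f 23) (f 24) (f 19) +
        remainder q (f 27) (f 29) (f 19) (f 28) (f 25) (f 26)) -
      (8 : ℚ) • q (f 30) (f 31) (f 31) (f 31) (f 31) := by
  have e := hq.fourOne_add_five (x := f 5) (y := f 7) (p := f 3) (r := f 4) (v := f 6) (c := f 0)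
    (x' := f 12) (y' := f 14) (p' := f 10) (r' := f 11) (v' := f 13) (c' := f 8) (z₁ := f 16)
    (c₁ := f 15) hb
  have e' := hq.fourOne_add_five (x := f 14) (y := f 22) (p := f 11) (r := f 20) (v := f 21)
    (c := f 17) (x' := f 27) (y' := f 29) (p' := f 25) (r' := f 26) (v' := f 28) (c' := f 23)
    (z₁ := f 31) (c₁ := f 30) hb'
  have h₁ := e ?_ ?_ ?_ ?_ ?_ ?_ ?_
  · have h₂ := e' ?_ ?_ ?_ ?_ ?_ ?_ ?_
    · linear_combination (norm := module) h₁ + h₂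
    all_goals
      simp only [← hf, form, List.getD_cons_succ, List.getD_cons_zero]
      abel
  all_goals
    simp only [← hf, form, List.getD_cons_succ, List.getD_cons_zero]
    abel

end Shuffling

end Kernel

end GrassPoly

end

noncomputable section

namespace GrassPoly

open Kernel

section Generic

variable {N m : ℕ}

theorem shuffling_aword : Shuffling (aword (N := N) (m := m)) where
  lin1 := aword_linear1
  lin2 := aword_linear2
  lin3 := aword_linear3
  lin4 := aword_linear4
  lin5 := aword_linear5
  leads := leads_aword

theorem altPit_SI41 {x y : FF N m} (hx : x ≠ 0) (hx' : x ≠ 1) (hy : y ≠ 0) (hy' : y ≠ 1)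
    (hxy : x ≠ y) {a b p r d : VF (FF N m)} (ha : cls x = a) (hb : cls y = b)
    (hp : cls (1 - x) = p) (hr : cls (1 - y) = r) (hd : cls (x - y) = d) :
    altPit (SI41 x y) = fourOne aword a b p r d := by
  have hs := shuffling_aword (N := N) (m := m)
  rw [SI41_eq hx hx' hy hy' hxy, ha, hb, hp, hr, hd, map_add, map_add, map_add, map_add]
  change aword _ _ _ _ _ + aword _ _ _ _ _ + aword _ _ _ _ _ + aword _ _ _ _ _ +
    aword _ _ _ _ _ = _
  rw [fourOne, ← neg_sub a b]
  simp only [hs.neg2, hs.neg3, hs.neg4, hs.neg5, neg_neg]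
  abel

theorem altPit_SLi5 {x : FF N m} (hx : x ≠ 0) (hx' : x ≠ 1) {z p : VF (FF N m)} (hz : cls x = z)
    (hp : cls (1 - x) = p) : altPit (SLi5 x) = -aword p z z z z := by
  rw [SLi5_eq hx hx', hz, hp, map_neg]
  rfl

theorem altPit_SI41_div {p q s t m₁ m₂ k l : FF N m} (hp : p ≠ 0) (hq : q ≠ 0) (hs : s ≠ 0)
    (ht : t ≠ 0) (hm₁ : m₁ ≠ 0) (hm₂ : m₂ ≠ 0) (hk : k ≠ 0) (hl : l ≠ 0) (h₁ : q - p = m₁)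
    (h₂ : t - s = m₂) (h : p * t - s * q = k * (q * t / l)) {a b c d e : VF (FF N m)}
    (ha : cls p - cls q = a) (hb : cls s - cls t = b) (hc : cls m₁ - cls q = c)
    (hd : cls m₂ - cls t = d) (he : cls k - cls l = e) :
    altPit (SI41 (p / q) (s / t)) = fourOne aword a b c d e := by
  have h₁ : 1 - p / q = m₁ / q := by rw [← h₁]; field_simp
  have h₂ : 1 - s / t = m₂ / t := by rw [← h₂]; field_simp
  have h : p / q - s / t = k / l := by
    rw [div_sub_div _ _ hq ht, mul_comm q s, h]
    field_simp
  refine altPit_SI41 (div_ne_zero hp hq) ?_ (div_ne_zero hs ht) ?_ ?_ ?_ ?_ ?_ ?_ ?_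
  · exact fun e => div_ne_zero hm₁ hq (h₁ ▸ sub_eq_zero.2 e.symm)
  · exact fun e => div_ne_zero hm₂ ht (h₂ ▸ sub_eq_zero.2 e.symm)
  · exact fun e => div_ne_zero hk hl (h ▸ sub_eq_zero.2 e)
  · rw [cls_div hp hq, ha]
  · rw [cls_div hs ht, hb]
  · rw [h₁, cls_div hm₁ hq, hc]
  · rw [h₂, cls_div hm₂ ht, hd]
  · rw [h, cls_div hk hl, he]

theorem altPit_SLi5_div {p q k : FF N m} (hp : p ≠ 0) (hq : q ≠ 0) (hk : k ≠ 0) (h : q - p = k)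
    {z d : VF (FF N m)} (hz : cls p - cls q = z) (hd : cls k - cls q = d) :
    altPit (SLi5 (p / q)) = -aword d z z z z := by
  have h : 1 - p / q = k / q := by rw [← h]; field_simp
  refine altPit_SLi5 (div_ne_zero hp hq) ?_ ?_ ?_
  · exact fun e => div_ne_zero hk hq (h ▸ sub_eq_zero.2 e.symm)
  · rw [cls_div hp hq, hz]
  · rw [h, cls_div hk hq, hd]

end Generic

end GrassPoly

end

noncomputable section

namespace GrassPoly

open Kernel

/-- The class of a difference of ratios. -/
def clsDiff (i j : ℕ) : VF K5 := cls (rr5 i j)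

/-- The class of a ratio. -/
def clsRho (i : ℕ) : VF K5 := cls (rho5 i)

theorem clsDiff_comm (i j : ℕ) : clsDiff i j = clsDiff j i := cls_sub_comm _ _

theorem exists_mem_tabF : ∀ k < 32, ∃ x ∈ tabF, x.c = k + 4096 := by
  decide

theorem valF_add (k : ℕ) (hk : k < 32) : valF (k + 4096) = (2 : ℚ) • form clsDiff clsRho k := by
  obtain ⟨x, hx, hc⟩ := exists_mem_tabF k hk
  have h := total_tabF (val := valC) (w := valS) (r := clsDiff) (h := clsRho)
    (fun i j hi hj hij => ?_) (fun i hi hi' => ?_) tabSpec_tabS.total x hx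
  · rw [hc, Nat.add_sub_cancel] at h
    rw [← hc, tabSpec_tabF.total x hx, h]
  · have e := valC_code 0 (i := i) (j := j) (by omega) (by omega)
    rw [Nat.mul_zero, Nat.zero_add] at e
    rw [e, letter, if_neg hij.ne]
    rfl
  · have e := valC_code 0 (i := i) (j := i) (by omega) (by omega)
    rw [Nat.mul_zero, Nat.zero_add] at e
    rw [e, letter, if_pos rfl]
    rfl

theorem vmap_rev8_clsDiff {i j i' j' : ℕ} (hi : 1 ≤ i) (hi' : 1 ≤ i') (h : i + i' = 6)
    (hj : 1 ≤ j) (hj' : 1 ≤ j') (h' : j + j' = 6) :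
    vmap (permAut 10 5 rev8) (clsDiff i j) = clsDiff j' i' := by
  rw [clsDiff_comm, clsDiff, rr5, vmap_cls, map_sub, permAut_rev8_rho5 hi hi' h,
    permAut_rev8_rho5 hj hj' h', clsDiff, rr5]

theorem vmap_rev7_clsRho {i j : ℕ} (hi : 1 ≤ i) (hj : 1 ≤ j) (h : i + j = 5) :
    vmap (permAut 10 5 rev7) (clsRho i) = -clsRho j := by
  rw [clsRho, vmap_cls, permAut_rev7_rho5 hi hj h, cls_inv, clsRho]

theorem vmap_rev7_clsDiff {i j i' j' : ℕ} (hi : 1 ≤ i) (hi' : 1 ≤ i') (h : i + i' = 5)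
    (hj : 1 ≤ j) (hj' : 1 ≤ j') (h' : j + j' = 5) (hne : i' ≠ j') :
    vmap (permAut 10 5 rev7) (clsDiff i j) = clsDiff j' i' - clsRho i' - clsRho j' := by
  have h₁ := rho5_ne_zero hi' (by omega)
  have h₂ := rho5_ne_zero hj' (by omega)
  rw [clsDiff, rr5, vmap_cls, map_sub, permAut_rev7_rho5 hi hi' h, permAut_rev7_rho5 hj hj' h',
    inv_sub_inv h₁ h₂, ← rr5, cls_div (rr5_ne_zero hj' (by omega) hi' (by omega) hne.symm)
      (mul_ne_zero h₁ h₂), cls_mul h₁ h₂, sub_add_eq_sub_sub]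
  rfl

/-- The class of the quadric invariant under the reversal of eight vectors. -/
def clsQuadric : VF K5 := cls (rr5 1 2 * rr5 3 4 - rr5 2 3 * rr5 4 5)

/-- The class of the quadric invariant up to monomials under the reversal of seven vectors. -/
def clsQuadric' : VF K5 := cls (rr5 1 2 * rr5 3 4 + rho5 1 * rr5 2 3)

theorem vmap_rev8_clsQuadric : vmap (permAut 10 5 rev8) clsQuadric = clsQuadric := by
  have h1 := permAut_rev8_rho5 (i := 1) (j := 5) (by omega) (by omega) rfl
  have h2 := permAut_rev8_rho5 (i := 2) (j := 4) (by omega) (by omega) rfl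
  have h3 := permAut_rev8_rho5 (i := 3) (j := 3) (by omega) (by omega) rfl
  have h4 := permAut_rev8_rho5 (i := 4) (j := 2) (by omega) (by omega) rfl
  have h5 := permAut_rev8_rho5 (i := 5) (j := 1) (by omega) (by omega) rfl
  rw [clsQuadric, vmap_cls]
  simp only [rr5, map_sub, map_mul, h1, h2, h3, h4, h5]
  rw [cls_sub_comm]
  congr 1
  ring

theorem vmap_rev7_clsQuadric' : vmap (permAut 10 5 rev7) clsQuadric' =
    clsQuadric' - clsRho 1 - clsRho 2 - clsRho 3 - clsRho 4 := by
  have h1 := permAut_rev7_rho5 (i := 1) (j := 4) (by omega) (by omega) rfl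
  have h2 := permAut_rev7_rho5 (i := 2) (j := 3) (by omega) (by omega) rfl
  have h3 := permAut_rev7_rho5 (i := 3) (j := 2) (by omega) (by omega) rfl
  have h4 := permAut_rev7_rho5 (i := 4) (j := 1) (by omega) (by omega) rfl
  have n1 := rho5_ne_zero (i := 1) (by omega) (by omega)
  have n2 := rho5_ne_zero (i := 2) (by omega) (by omega)
  have n3 := rho5_ne_zero (i := 3) (by omega) (by omega)
  have n4 := rho5_ne_zero (i := 4) (by omega) (by omega)
  have h : permAut 10 5 rev7 (rr5 1 2 * rr5 3 4 + rho5 1 * rr5 2 3) =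
      (rr5 1 2 * rr5 3 4 + rho5 1 * rr5 2 3) / (rho5 1 * rho5 2 * rho5 3 * rho5 4) := by
    simp only [rr5, map_sub, map_mul, map_add, h1, h2, h3, h4]
    generalize rho5 1 = a at *
    generalize rho5 2 = b at *
    generalize rho5 3 = c at *
    generalize rho5 4 = d at *
    field_simp
  rw [clsQuadric', vmap_cls, h, cls_div quadric_ne_zero' (mul_ne_zero (mul_ne_zero
    (mul_ne_zero n1 n2) n3) n4), cls_mul (mul_ne_zero (mul_ne_zero n1 n2) n3) n4,
    cls_mul (mul_ne_zero n1 n2) n3, cls_mul n1 n2]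
  change _ - (clsRho 1 + clsRho 2 + clsRho 3 + clsRho 4) = _
  abel

theorem insertion_clsQuadric {f : ℕ → VF K5} (hf : form clsDiff clsRho = f) :
    insertion aword clsQuadric (f 1 + (2 : ℚ) • f 9 - (2 : ℚ) • f 2) (f 2) = 0 := by
  refine shuffling_aword.insertion_eq_zero_of_neg_right (aword_even sign_rev8)
    vmap_rev8_clsQuadric ?_ ?_
  all_goals
    have h12 := vmap_rev8_clsDiff (i := 1) (j := 2) (i' := 5) (j' := 4) (by omega) (by omega) rfl
      (by omega) (by omega) rfl
    have h13 := vmap_rev8_clsDiff (i := 1) (j := 3) (i' := 5) (j' := 3) (by omega) (by omega) rfl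
      (by omega) (by omega) rfl
    have h15 := vmap_rev8_clsDiff (i := 1) (j := 5) (i' := 5) (j' := 1) (by omega) (by omega) rfl
      (by omega) (by omega) rfl
    have h23 := vmap_rev8_clsDiff (i := 2) (j := 3) (i' := 4) (j' := 3) (by omega) (by omega) rfl
      (by omega) (by omega) rfl
    have h24 := vmap_rev8_clsDiff (i := 2) (j := 4) (i' := 4) (j' := 2) (by omega) (by omega) rfl
      (by omega) (by omega) rfl
    have h34 := vmap_rev8_clsDiff (i := 3) (j := 4) (i' := 3) (j' := 2) (by omega) (by omega) rfl
      (by omega) (by omega) rfl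
    have h35 := vmap_rev8_clsDiff (i := 3) (j := 5) (i' := 3) (j' := 1) (by omega) (by omega) rfl
      (by omega) (by omega) rfl
    have h45 := vmap_rev8_clsDiff (i := 4) (j := 5) (i' := 2) (j' := 1) (by omega) (by omega) rfl
      (by omega) (by omega) rfl
    simp only [← hf, form, List.getD_cons_succ, List.getD_cons_zero, map_add, map_sub, map_smul,
      h12, h13, h15, h23, h24, h34, h35, h45]
    module

theorem insertion_clsQuadric' {f : ℕ → VF K5} (hf : form clsDiff clsRho = f) :
    insertion aword
      (clsQuadric' - (1 / 2 : ℚ) • (clsRho 1 + clsRho 2 + clsRho 3 + clsRho 4))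
      (f 18 + (2 : ℚ) • f 24 - (2 : ℚ) • f 19) (f 19) = 0 := by
  have h1 := vmap_rev7_clsRho (i := 1) (j := 4) (by omega) (by omega) rfl
  have h2 := vmap_rev7_clsRho (i := 2) (j := 3) (by omega) (by omega) rfl
  have h3 := vmap_rev7_clsRho (i := 3) (j := 2) (by omega) (by omega) rfl
  have h4 := vmap_rev7_clsRho (i := 4) (j := 1) (by omega) (by omega) rfl
  refine shuffling_aword.insertion_eq_zero_of_neg_left (aword_even sign_rev7) ?_ ?_ ?_
  · rw [map_sub, map_smul, map_add, map_add, map_add, h1, h2, h3, h4, vmap_rev7_clsQuadric']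
    module
  all_goals
    have h12 := vmap_rev7_clsDiff (i := 1) (j := 2) (i' := 4) (j' := 3) (by omega) (by omega) rfl
      (by omega) (by omega) rfl (by omega)
    have h13 := vmap_rev7_clsDiff (i := 1) (j := 3) (i' := 4) (j' := 2) (by omega) (by omega) rfl
      (by omega) (by omega) rfl (by omega)
    have h23 := vmap_rev7_clsDiff (i := 2) (j := 3) (i' := 3) (j' := 2) (by omega) (by omega) rfl
      (by omega) (by omega) rfl (by omega)
    have h24 := vmap_rev7_clsDiff (i := 2) (j := 4) (i' := 3) (j' := 1) (by omega) (by omega) rfl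
      (by omega) (by omega) rfl (by omega)
    have h34 := vmap_rev7_clsDiff (i := 3) (j := 4) (i' := 2) (j' := 1) (by omega) (by omega) rfl
      (by omega) (by omega) rfl (by omega)
    simp only [← hf, form, List.getD_cons_succ, List.getD_cons_zero, map_add, map_sub, map_smul,
      h1, h2, h4, h12, h13, h23, h24, h34]
    module

end GrassPoly

end

noncomputable section

namespace GrassPoly

open Kernel

section Generic

variable {N m : ℕ} {ρ : ℕ → FF N m} {r : ℕ → ℕ → FF N m} (hr : ∀ i j, r i j = ρ i - ρ j)
  (n : ∀ {i j : ℕ}, 1 ≤ i ∧ i ≤ 5 → 1 ≤ j ∧ j ≤ 5 → i ≠ j → r i j ≠ 0)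
  (n' : ∀ {i : ℕ}, 1 ≤ i ∧ i ≤ 5 → ρ i ≠ 0)
  {f : ℕ → VF (FF N m)} (hf : form (fun i j => cls (r i j)) (fun i => cls (ρ i)) = f)
  {b : VF (FF N m)}

include hr n hf

theorem altPit_SI41_triples (hb₀ : r 1 2 * r 3 4 - r 2 3 * r 4 5 ≠ 0)
    (hb : cls (r 1 2 * r 3 4 - r 2 3 * r 4 5) = b) :
    altPit (SI41 (r 2 3 / r 2 1) (r 4 3 / r 4 5)) =
      fourOne aword (f 5) (f 7) (f 3) (f 4) (f 0 + b) := by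
  have s21 : cls (r 2 1) = cls (r 1 2) := by rw [hr, hr, cls_sub_comm]
  have s43 : cls (r 4 3) = cls (r 3 4) := by rw [hr, hr, cls_sub_comm]
  have s31 : cls (r 3 1) = cls (r 1 3) := by rw [hr, hr, cls_sub_comm]
  have hn₁ : r 2 1 - r 2 3 = r 3 1 := by
    simp only [hr]
    ring
  have hn₂ : r 4 5 - r 4 3 = r 3 5 := by
    simp only [hr]
    ring
  have hl : r 2 1 * r 4 5 ≠ 0 := (mul_ne_zero (n (by omega) (by omega) (by omega)) (n (by omega)
      (by omega) (by omega)))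
  refine altPit_SI41_div (k := -(r 1 2 * r 3 4 - r 2 3 * r 4 5)) (l := r 2 1 * r 4 5)
    (n (by omega) (by omega) (by omega))
    (n (by omega) (by omega) (by omega))
    (n (by omega) (by omega) (by omega))
    (n (by omega) (by omega) (by omega))
    (n (by omega) (by omega) (by omega))
    (n (by omega) (by omega) (by omega))
    (neg_ne_zero.2 hb₀) hl hn₁ hn₂ ?_ ?_ ?_ ?_ ?_ ?_
  · rw [mul_div_assoc', eq_div_iff hl]
    simp only [hr]
    ring
  · simp only [← hf, form, List.getD_cons_succ, List.getD_cons_zero, s21]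
  · simp only [← hf, form, List.getD_cons_succ, List.getD_cons_zero, s43]
  · simp only [← hf, form, List.getD_cons_succ, List.getD_cons_zero, s21, s31]
  · simp only [← hf, form, List.getD_cons_succ, List.getD_cons_zero]
  · rw [cls_neg,
      cls_mul (n (by omega) (by omega) (by omega)) (n (by omega) (by omega) (by omega))]
    rw [← hb]
    simp only [← hf, form, List.getD_cons_zero, s21]
    module

theorem altPit_SI41_crossRatio_right (hb₀ : r 1 2 * r 3 4 - r 2 3 * r 4 5 ≠ 0)
    (hb : cls (r 1 2 * r 3 4 - r 2 3 * r 4 5) = b) :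
    altPit (SI41 (r 4 5 / r 4 1) (r 1 2 * r 3 4 / (r 3 2 * r 1 4))) =
      fourOne aword (f 12) (f 14) (f 10) (f 11) (f 8 + b) := by
  have s41 : cls (r 4 1) = cls (r 1 4) := by rw [hr, hr, cls_sub_comm]
  have s32 : cls (r 3 2) = cls (r 2 3) := by rw [hr, hr, cls_sub_comm]
  have s51 : cls (r 5 1) = cls (r 1 5) := by rw [hr, hr, cls_sub_comm]
  have s42 : cls (r 4 2) = cls (r 2 4) := by rw [hr, hr, cls_sub_comm]
  have hn₁ : r 4 1 - r 4 5 = r 5 1 := by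
    simp only [hr]
    ring
  have hn₂ : r 3 2 * r 1 4 - r 1 2 * r 3 4 = r 1 3 * r 4 2 := by
    simp only [hr]
    ring
  have hl : r 3 2 * r 4 1 ≠ 0 := (mul_ne_zero (n (by omega) (by omega) (by omega)) (n (by omega)
      (by omega) (by omega)))
  refine altPit_SI41_div (k := r 1 2 * r 3 4 - r 2 3 * r 4 5) (l := r 3 2 * r 4 1)
    (n (by omega) (by omega) (by omega))
    (n (by omega) (by omega) (by omega))
    (mul_ne_zero (n (by omega) (by omega) (by omega)) (n (by omega) (by omega) (by omega)))
    (mul_ne_zero (n (by omega) (by omega) (by omega)) (n (by omega) (by omega) (by omega)))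
    (n (by omega) (by omega) (by omega))
    (mul_ne_zero (n (by omega) (by omega) (by omega)) (n (by omega) (by omega) (by omega)))
    hb₀ hl hn₁ hn₂ ?_ ?_ ?_ ?_ ?_ ?_
  · rw [mul_div_assoc', eq_div_iff hl]
    simp only [hr]
    ring
  · simp only [← hf, form, List.getD_cons_succ, List.getD_cons_zero, s41]
  · rw [cls_mul (n (by omega) (by omega) (by omega)) (n (by omega) (by omega) (by omega)),
      cls_mul (n (by omega) (by omega) (by omega)) (n (by omega) (by omega) (by omega))]
    simp only [← hf, form, List.getD_cons_succ, List.getD_cons_zero, s32]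
    module
  · simp only [← hf, form, List.getD_cons_succ, List.getD_cons_zero, s41, s51]
  · rw [cls_mul (n (by omega) (by omega) (by omega)) (n (by omega) (by omega) (by omega)),
      cls_mul (n (by omega) (by omega) (by omega)) (n (by omega) (by omega) (by omega))]
    simp only [← hf, form, List.getD_cons_succ, List.getD_cons_zero, s32, s42]
    module
  · rw [cls_mul (n (by omega) (by omega) (by omega)) (n (by omega) (by omega) (by omega))]
    rw [← hb]
    simp only [← hf, form, List.getD_cons_succ, List.getD_cons_zero, s41, s32]
    module

theorem altPit_SLi5_quadric (hb₀ : r 1 2 * r 3 4 - r 2 3 * r 4 5 ≠ 0)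
    (hb : cls (r 1 2 * r 3 4 - r 2 3 * r 4 5) = b) :
    altPit (SLi5 (r 1 2 * r 3 4 / (r 2 3 * r 4 5))) =
      -aword (f 15 + b) (f 16) (f 16) (f 16) (f 16) := by
  have hn₁ : r 2 3 * r 4 5 - r 1 2 * r 3 4 = -(r 1 2 * r 3 4 - r 2 3 * r 4 5) := by
    simp only [hr]
    ring
  refine altPit_SLi5_div (k := -(r 1 2 * r 3 4 - r 2 3 * r 4 5))
    (mul_ne_zero (n (by omega) (by omega) (by omega)) (n (by omega) (by omega) (by omega)))
    (mul_ne_zero (n (by omega) (by omega) (by omega)) (n (by omega) (by omega) (by omega)))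
    (neg_ne_zero.2 hb₀) hn₁ ?_ ?_
  · rw [cls_mul (n (by omega) (by omega) (by omega)) (n (by omega) (by omega) (by omega)),
      cls_mul (n (by omega) (by omega) (by omega)) (n (by omega) (by omega) (by omega))]
    simp only [← hf, form, List.getD_cons_succ, List.getD_cons_zero]
    module
  · rw [cls_neg,
      cls_mul (n (by omega) (by omega) (by omega)) (n (by omega) (by omega) (by omega))]
    rw [← hb]
    simp only [← hf, form, List.getD_cons_succ, List.getD_cons_zero]
    module

include n' in
theorem altPit_SI41_crossRatio_left (hb₀ : r 1 2 * r 3 4 + ρ 1 * r 2 3 ≠ 0)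
    (hb : cls (r 1 2 * r 3 4 + ρ 1 * r 2 3) -
      (1 / 2 : ℚ) • (cls (ρ 1) + cls (ρ 2) + cls (ρ 3) + cls (ρ 4)) = b) :
    altPit (SI41 (r 1 2 * r 3 4 / (r 3 2 * r 1 4)) (ρ 1 / r 1 4)) =
      fourOne aword (f 14) (f 22) (f 11) (f 20) (f 17 + b) := by
  have s32 : cls (r 3 2) = cls (r 2 3) := by rw [hr, hr, cls_sub_comm]
  have s42 : cls (r 4 2) = cls (r 2 4) := by rw [hr, hr, cls_sub_comm]
  have hn₁ : r 3 2 * r 1 4 - r 1 2 * r 3 4 = r 1 3 * r 4 2 := by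
    simp only [hr]
    ring
  have hn₂ : r 1 4 - ρ 1 = -ρ 4 := by
    simp only [hr]
    ring
  have hl : r 3 2 * r 1 4 ≠ 0 := (mul_ne_zero (n (by omega) (by omega) (by omega)) (n (by omega)
      (by omega) (by omega)))
  refine altPit_SI41_div (k := r 1 2 * r 3 4 + ρ 1 * r 2 3) (l := r 3 2 * r 1 4)
    (mul_ne_zero (n (by omega) (by omega) (by omega)) (n (by omega) (by omega) (by omega)))
    (mul_ne_zero (n (by omega) (by omega) (by omega)) (n (by omega) (by omega) (by omega)))
    (n' (by omega))
    (n (by omega) (by omega) (by omega))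
    (mul_ne_zero (n (by omega) (by omega) (by omega)) (n (by omega) (by omega) (by omega)))
    (neg_ne_zero.2 (n' (by omega)))
    hb₀ hl hn₁ hn₂ ?_ ?_ ?_ ?_ ?_ ?_
  · rw [mul_div_assoc', eq_div_iff hl]
    simp only [hr]
    ring
  · rw [cls_mul (n (by omega) (by omega) (by omega)) (n (by omega) (by omega) (by omega)),
      cls_mul (n (by omega) (by omega) (by omega)) (n (by omega) (by omega) (by omega))]
    simp only [← hf, form, List.getD_cons_succ, List.getD_cons_zero, s32]
    module
  · simp only [← hf, form, List.getD_cons_succ, List.getD_cons_zero]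
  · rw [cls_mul (n (by omega) (by omega) (by omega)) (n (by omega) (by omega) (by omega)),
      cls_mul (n (by omega) (by omega) (by omega)) (n (by omega) (by omega) (by omega))]
    simp only [← hf, form, List.getD_cons_succ, List.getD_cons_zero, s32, s42]
    module
  · rw [cls_neg]
    simp only [← hf, form, List.getD_cons_succ, List.getD_cons_zero]
  · rw [cls_mul (n (by omega) (by omega) (by omega)) (n (by omega) (by omega) (by omega))]
    rw [← hb]
    simp only [← hf, form, List.getD_cons_succ, List.getD_cons_zero, s32]
    module

include n' in
theorem altPit_SI41_rho (hb₀ : r 1 2 * r 3 4 + ρ 1 * r 2 3 ≠ 0)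
    (hb : cls (r 1 2 * r 3 4 + ρ 1 * r 2 3) -
      (1 / 2 : ℚ) • (cls (ρ 1) + cls (ρ 2) + cls (ρ 3) + cls (ρ 4)) = b) :
    altPit (SI41 (r 1 2 / ρ 1) (r 3 2 / r 3 4)) =
      fourOne aword (f 27) (f 29) (f 25) (f 26) (f 23 + b) := by
  have s32 : cls (r 3 2) = cls (r 2 3) := by rw [hr, hr, cls_sub_comm]
  have hn₁ : ρ 1 - r 1 2 = ρ 2 := by
    simp only [hr]
    ring
  have hn₂ : r 3 4 - r 3 2 = r 2 4 := by
    simp only [hr]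
    ring
  have hl : ρ 1 * r 3 4 ≠ 0 := (mul_ne_zero (n' (by omega)) (n (by omega) (by omega) (by omega)))
  refine altPit_SI41_div (k := r 1 2 * r 3 4 + ρ 1 * r 2 3) (l := ρ 1 * r 3 4)
    (n (by omega) (by omega) (by omega))
    (n' (by omega))
    (n (by omega) (by omega) (by omega))
    (n (by omega) (by omega) (by omega))
    (n' (by omega))
    (n (by omega) (by omega) (by omega))
    hb₀ hl hn₁ hn₂ ?_ ?_ ?_ ?_ ?_ ?_
  · rw [mul_div_assoc', eq_div_iff hl]
    simp only [hr]
    ring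
  · simp only [← hf, form, List.getD_cons_succ, List.getD_cons_zero]
  · simp only [← hf, form, List.getD_cons_succ, List.getD_cons_zero, s32]
  · simp only [← hf, form, List.getD_cons_succ, List.getD_cons_zero]
  · simp only [← hf, form, List.getD_cons_succ, List.getD_cons_zero]
  · rw [cls_mul (n' (by omega)) (n (by omega) (by omega) (by omega))]
    rw [← hb]
    simp only [← hf, form, List.getD_cons_succ, List.getD_cons_zero]
    module

include n' in
theorem altPit_SLi5_quadric' (hb₀ : r 1 2 * r 3 4 + ρ 1 * r 2 3 ≠ 0)
    (hb : cls (r 1 2 * r 3 4 + ρ 1 * r 2 3) -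
      (1 / 2 : ℚ) • (cls (ρ 1) + cls (ρ 2) + cls (ρ 3) + cls (ρ 4)) = b) :
    altPit (SLi5 (ρ 1 * r 3 2 / (r 1 2 * r 3 4))) =
      -aword (f 30 + b) (f 31) (f 31) (f 31) (f 31) := by
  have s32 : cls (r 3 2) = cls (r 2 3) := by rw [hr, hr, cls_sub_comm]
  have hn₁ : r 1 2 * r 3 4 - ρ 1 * r 3 2 = r 1 2 * r 3 4 + ρ 1 * r 2 3 := by
    simp only [hr]
    ring
  refine altPit_SLi5_div (k := r 1 2 * r 3 4 + ρ 1 * r 2 3)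
    (mul_ne_zero (n' (by omega)) (n (by omega) (by omega) (by omega)))
    (mul_ne_zero (n (by omega) (by omega) (by omega)) (n (by omega) (by omega) (by omega)))
    hb₀ hn₁ ?_ ?_
  · rw [cls_mul (n' (by omega)) (n (by omega) (by omega) (by omega)),
      cls_mul (n (by omega) (by omega) (by omega)) (n (by omega) (by omega) (by omega))]
    simp only [← hf, form, List.getD_cons_succ, List.getD_cons_zero, s32]
    module
  · rw [cls_mul (n (by omega) (by omega) (by omega)) (n (by omega) (by omega) (by omega))]
    rw [← hb]
    simp only [← hf, form, List.getD_cons_succ, List.getD_cons_zero]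
    module

end Generic

end GrassPoly

end

noncomputable section

namespace GrassPoly

open Kernel

theorem eq_smul_of_baseWords {N m : ℕ} {val : ℕ → VF (FF N m)} {t x y : TP (FF N m) 5}
    (h : (10 : ℚ) •
      (baseWords.map fun w => sg w.s w.m • onLetters aword val w.a w.b w.c w.d w.e).sum +
        (14400 : ℚ) • y = 0)
    (hs : (baseWords.map fun w => sg w.s w.m • onLetters aword val w.a w.b w.c w.d w.e).sum =
      (32 : ℚ) • t)
    (hx : x = t) : x = (-45 : ℚ) • y := by
  rw [hx]
  rw [hs] at h
  linear_combination (norm := module) (1 / 320 : ℚ) • h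

theorem smul_Pit_Alt {N m : ℕ} {s : TP (FF N m) 5} {k : ℚ} {a b c d e : VF (FF N m)}
    (hs : s = k • Alt (tprod ℚ ![a, b, c, d, e])) {l n : ℚ} (hn : l * k = n) :
    l • Pit 5 s = n • aword a b c d e := by
  rw [← hn, hs, map_smul, smul_smul, aword, altPit_apply, Alt, Alt, map_sum]
  simp only [map_smul, Pit_tpMap]
  rfl

theorem altPit_combination {N m : ℕ} {t₁ t₂ t₃ t₄ t₅ t₆ T₁ T₂ T₃ T₄ T₅ T₆ : TP (FF N m) 5}
    (h₁ : altPit t₁ = T₁) (h₂ : altPit t₂ = T₂) (h₃ : altPit t₃ = T₃) (h₄ : altPit t₄ = T₄)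
    (h₅ : altPit t₅ = T₅) (h₆ : altPit t₆ = T₆) :
    Alt (Pit 5 (t₁ + (2 : ℚ) • t₂ + (8 : ℚ) • t₃ + t₄ + (2 : ℚ) • t₅ + (8 : ℚ) • t₆)) =
      T₁ + (2 : ℚ) • T₂ + (8 : ℚ) • T₃ + T₄ + (2 : ℚ) • T₅ + (8 : ℚ) • T₆ := by
  rw [← altPit_apply]
  simp only [map_add, map_smul, h₁, h₂, h₃, h₄, h₅, h₆]

theorem rr5_ne_zero' {i j : ℕ} (hi : 1 ≤ i ∧ i ≤ 5) (hj : 1 ≤ j ∧ j ≤ 5) (hij : i ≠ j) :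
    rr5 i j ≠ 0 :=
  rr5_ne_zero hi.1 hi.2 hj.1 hj.2 hij

theorem rho5_ne_zero' {i : ℕ} (hi : 1 ≤ i ∧ i ≤ 5) : rho5 i ≠ 0 :=
  rho5_ne_zero hi.1 hi.2

theorem rr5_eq (i j : ℕ) : rr5 i j = rho5 i - rho5 j := rfl

end GrassPoly

end

open GrassPoly

/-- Theorem `gr5toi41`: the mod-products symbol identity for `Gr₅`. -/
theorem gr5_to_i41 :
    ((640 : ℚ))⁻¹ • Pit 5 SGr5 =
      Alt (Pit 5 (
        SI41 (rr5 2 3 / rr5 2 1) (rr5 4 3 / rr5 4 5)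
        + (2 : ℚ) • SI41 (rr5 4 5 / rr5 4 1) (rr5 1 2 * rr5 3 4 / (rr5 3 2 * rr5 1 4))
        + (8 : ℚ) • SLi5 (rr5 1 2 * rr5 3 4 / (rr5 2 3 * rr5 4 5))
        + SI41 (rr5 1 2 * rr5 3 4 / (rr5 3 2 * rr5 1 4)) (rho5 1 / rr5 1 4)
        + (2 : ℚ) • SI41 (rr5 1 2 / rho5 1) (rr5 3 2 / rr5 3 4)
        + (8 : ℚ) • SLi5 (rho5 1 * rr5 3 2 / (rr5 1 2 * rr5 3 4)))) := by
  obtain ⟨f, hf⟩ : ∃ f, Kernel.form clsDiff clsRho = f := ⟨_, rfl⟩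
  obtain ⟨b, hb⟩ : ∃ b, clsQuadric = b := ⟨_, rfl⟩
  obtain ⟨b', hb'⟩ : ∃ b', clsQuadric' -
    (1 / 2 : ℚ) • (clsRho 1 + clsRho 2 + clsRho 3 + clsRho 4) = b' := ⟨_, rfl⟩
  have h := (altPit_combination
    (altPit_SI41_triples rr5_eq rr5_ne_zero' hf quadric_ne_zero hb)
    (altPit_SI41_crossRatio_right rr5_eq rr5_ne_zero' hf quadric_ne_zero hb)
    (altPit_SLi5_quadric rr5_eq rr5_ne_zero' hf quadric_ne_zero hb)
    (altPit_SI41_crossRatio_left rr5_eq rr5_ne_zero' rho5_ne_zero' hf quadric_ne_zero' hb')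
    (altPit_SI41_rho rr5_eq rr5_ne_zero' rho5_ne_zero' hf quadric_ne_zero' hb')
    (altPit_SLi5_quadric' rr5_eq rr5_ne_zero' rho5_ne_zero' hf quadric_ne_zero' hb')).trans
    (shuffling_aword.form_combination hf (hb ▸ insertion_clsQuadric hf)
      (hb' ▸ insertion_clsQuadric' hf))
  have hs := shuffling_aword.sum_baseWords_eq (hf ▸ valF_add)
  have hk : (640 : ℚ)⁻¹ * ((-2 : ℚ) * ((Nat.factorial 5 : ℚ)) ^ 2) = -45 := by
    norm_num [Nat.factorial]
  have hl := @smul_Pit_Alt 10 5 SGr5 _ _ _ _ _ _ SGr5.eq_1 _ _ hk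
  have hr := eq_smul_of_baseWords sum_baseWords_aword hs h
  set_option maxRecDepth 3000 in exact hl.trans hr.symm
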